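/- arXiv:2206.02174 — 2 statements merged into one kernel-verified Lean document; each statement's English description precedes it below -/
import Mathlib

section
/- Let λ > 1 and W > 0, and let Ψ_L = Ψ_L^{λ,W} be extended to ℝ² by the same polar-coordinate formula (so that Ψ_L(x₁,x₂) = −Ψ_L(x₁,−x₂)). Then Ψ_L is continuously differentiable on ℝ² \ {0} and, in Π, Ψ_L satisfies −ΔΨ_L + Ψ_L = λ(Ψ_L − W x₂)₊ pointwise on Π \ {x : |x| = a} (equivalently, in the sense of distributions on Π); moreover Ψ_L = 0 on ∂Π, Ψ_L(x) → 0 as |x| → ∞, and Ψ_L > 0 in B_a(0) ∩ Π. -/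
open MeasureTheory Real Filter

noncomputable section

/-- The upper half plane `Π = {x ∈ ℝ² : x₂ > 0}`. -/
def UHP : Set (ℝ × ℝ) := {x | 0 < x.2}

/-- Euclidean norm of a point of `ℝ²`. -/
def rad (x : ℝ × ℝ) : ℝ := Real.sqrt (x.1 ^ 2 + x.2 ^ 2)

/-- Modified Bessel function of the second kind of order `0`:
`K₀(r) = ∫₀^∞ exp(-r cosh t) dt`. -/
def K0 (r : ℝ) : ℝ := ∫ t in Set.Ioi (0 : ℝ), Real.exp (-(r * Real.cosh t))

/-- Fundamental solution `G(x,y) = (1/2π) K₀(|x-y|)` of `−Δ + Id` on `ℝ²`. -/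
def Gker (x y : ℝ × ℝ) : ℝ := (1 / (2 * Real.pi)) * K0 (rad (x - y))

/-- Reflection `x̄ = (x₁, −x₂)` across the `x₁`-axis. -/
def reflPt (x : ℝ × ℝ) : ℝ × ℝ := (x.1, -x.2)

/-- Green's function `G_Π(x,y) = G(x,y) − G(x̄,y)` of `−Δ + Id` on the half plane. -/
def GUHP (x y : ℝ × ℝ) : ℝ := Gker x y - Gker (reflPt x) y

/-- The operator `𝒢ω(x) = ∫_Π G_Π(x,y) ω(y) dy`. -/
def Gop (ω : ℝ × ℝ → ℝ) (x : ℝ × ℝ) : ℝ := ∫ y in UHP, GUHP x y * ω y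

/-- Kinetic energy `E(ω) = (1/2) ∫_Π ω 𝒢ω`. -/
def kineticE (ω : ℝ × ℝ → ℝ) : ℝ := (1 / 2) * ∫ x in UHP, ω x * Gop ω x

/-- Impulse `I(ω) = ∫_Π x₂ ω dx`. -/
def impulse (ω : ℝ × ℝ → ℝ) : ℝ := ∫ x in UHP, x.2 * ω x

/-- `L¹(Π)` norm. -/
def normL1 (f : ℝ × ℝ → ℝ) : ℝ := ∫ x in UHP, |f x|

/-- `L²(Π)` norm. -/
def normL2 (f : ℝ × ℝ → ℝ) : ℝ := (∫ x in UHP, (f x) ^ 2) ^ ((1 : ℝ) / 2)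

/-- `L^s(Π)` norm. -/
def normLs (s : ℝ) (f : ℝ × ℝ → ℝ) : ℝ := (∫ x in UHP, |f x| ^ s) ^ (1 / s)

/-- Nonnegative member of `L¹(Π) ∩ L²(Π)`. -/
def NonnegL1L2 (ω : ℝ × ℝ → ℝ) : Prop :=
  (∀ x ∈ UHP, 0 ≤ ω x) ∧ IntegrableOn ω UHP ∧ IntegrableOn (fun x => (ω x) ^ 2) UHP

/-- Steiner symmetry in the `x₁` variable. -/
def SteinerSym (f : ℝ × ℝ → ℝ) : Prop :=
  (∀ x : ℝ × ℝ, f (-x.1, x.2) = f x) ∧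
  ∀ x₂ : ℝ, 0 < x₂ → AntitoneOn (fun x₁ => f (x₁, x₂)) (Set.Ioi (0 : ℝ))

/-- The admissible class `𝒜_{μ,ν}`. -/
def InAdm (μ ν : ℝ) (ω : ℝ × ℝ → ℝ) : Prop :=
  (∀ x ∈ UHP, 0 ≤ ω x) ∧ IntegrableOn ω UHP ∧ IntegrableOn (fun x => (ω x) ^ 2) UHP ∧
  IntegrableOn (fun x => x.2 * ω x) UHP ∧
  impulse ω = μ ∧ (∫ x in UHP, ω x) ≤ ν

/-- The energy functional `ℰ_λ(ω) = E(ω) − (1/(2λ)) ∫_Π ω²`. -/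
def Efun (lam : ℝ) (ω : ℝ × ℝ → ℝ) : ℝ :=
  kineticE ω - (1 / (2 * lam)) * ∫ x in UHP, (ω x) ^ 2

/-- The supremum `S_{μ,ν,λ} = sup_{ω ∈ 𝒜_{μ,ν}} ℰ_λ(ω)`. -/
def Sval (lam μ ν : ℝ) : ℝ := sSup {s | ∃ ω, InAdm μ ν ω ∧ s = Efun lam ω}

/-- `ω` is a maximizer, i.e. `ω ∈ Σ_{μ,ν,λ}`. -/
def IsMaximizer (lam μ ν : ℝ) (ω : ℝ × ℝ → ℝ) : Prop :=
  InAdm μ ν ω ∧ Efun lam ω = Sval lam μ ν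

/-- Bessel function of the first kind of order one. -/
def J1 (r : ℝ) : ℝ :=
  ∑' k : ℕ, ((-1 : ℝ) ^ k / ((Nat.factorial k : ℝ) * (Nat.factorial (k + 1) : ℝ))) *
    (r / 2) ^ (2 * k + 1)

/-- Modified Bessel function of the second kind of order one. -/
def K1 (r : ℝ) : ℝ := ∫ t in Set.Ioi (0 : ℝ), Real.exp (-(r * Real.cosh t)) * Real.cosh t

/-- The set of `t > 0` with `J₁(√(λ−1) t) ≠ 0` solving the transcendental equation
`t (K₁'(t)/K₁(t) + (λ−1)^{-1/2} J₁'(√(λ−1)t)/J₁(√(λ−1)t)) = λ/(λ−1)`. -/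
def aSet (lam : ℝ) : Set ℝ :=
  {t | 0 < t ∧ J1 (Real.sqrt (lam - 1) * t) ≠ 0 ∧
    t * (deriv K1 t / K1 t +
      (1 / Real.sqrt (lam - 1)) *
        (deriv J1 (Real.sqrt (lam - 1) * t) / J1 (Real.sqrt (lam - 1) * t))) = lam / (lam - 1)}

/-- The smallest positive solution `a = a(λ)`. -/
def aLam (lam : ℝ) : ℝ := sInf (aSet lam)

/-- The stream function `Ψ_L^{λ,W}` of the Lamb dipole, written in polar coordinates
`x₁ = r cos θ`, `x₂ = r sin θ` (so that `sin θ = x₂ / r`). -/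
def PsiL (lam W : ℝ) (x : ℝ × ℝ) : ℝ :=
  if rad x ≤ aLam lam then
    ((-(W * aLam lam / (lam - 1)) / J1 (Real.sqrt (lam - 1) * aLam lam)) *
        J1 (Real.sqrt (lam - 1) * rad x) + (W * lam / (lam - 1)) * rad x) * (x.2 / rad x)
  else (W * aLam lam / K1 (aLam lam)) * K1 (rad x) * (x.2 / rad x)

/-- The Lamb dipole `ω_L^{λ,W} = λ (Ψ_L^{λ,W} − W x₂)₊` restricted to `Π`. -/
def omegaL (lam W : ℝ) (x : ℝ × ℝ) : ℝ :=
  if 0 < x.2 then lam * max (PsiL lam W x - W * x.2) 0 else 0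

/-- `ϱ(λ) = (∫_Π ω_L^{λ,1} dx) / I(ω_L^{λ,1})`. -/
def varrho (lam : ℝ) : ℝ := (∫ x in UHP, omegaL lam 1 x) / impulse (omegaL lam 1)

/-- The Laplacian on `ℝ²`, written coordinatewise. -/
def lap (ψ : ℝ × ℝ → ℝ) (x : ℝ × ℝ) : ℝ :=
  deriv (deriv fun t => ψ (t, x.2)) x.1 + deriv (deriv fun t => ψ (x.1, t)) x.2

/-- Distance (in `L¹ ∩ L²` plus weighted `L¹`) from `ζ` to a set of functions `S`. -/
def distToSet (S : Set ((ℝ × ℝ) → ℝ)) (ζ : (ℝ × ℝ) → ℝ) : ℝ :=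
  sInf {d | ∃ ω ∈ S, d = normL1 (fun x => ζ x - ω x) + normL2 (fun x => ζ x - ω x) +
    normL1 (fun x => x.2 * (ζ x - ω x))}

end

/-! ### Bessel-type entire series -/

noncomputable def cf (n k : ℕ) : ℝ := (-1 : ℝ) ^ k / ((Nat.factorial k : ℝ) * (Nat.factorial (k + n) : ℝ))

noncomputable def cc (n : ℕ) (z : ℝ) : ℝ := ∑' k : ℕ, cf n k * z ^ k

lemma cf_abs_le (n k : ℕ) : |cf n k| ≤ 1 / (Nat.factorial k : ℝ) := by
  unfold cf
  rw [abs_div, abs_pow, abs_neg, abs_one, one_pow, abs_of_pos (by positivity)]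
  apply one_div_le_one_div_of_le (by positivity)
  have : (1 : ℝ) ≤ (Nat.factorial (k + n) : ℝ) := by exact_mod_cast Nat.factorial_pos _
  have h2 : (0 : ℝ) < (Nat.factorial k : ℝ) := by positivity
  nlinarith

lemma cc_summable (n : ℕ) (z : ℝ) : Summable (fun k : ℕ => cf n k * z ^ k) := by
  apply Summable.of_norm_bounded (Real.summable_pow_div_factorial |z|)
  intro k
  rw [Real.norm_eq_abs, abs_mul, abs_pow]
  calc _ ≤ 1 / (Nat.factorial k : ℝ) * |z| ^ k := by
        gcongr; exact cf_abs_le n k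
    _ = _ := by ring

lemma cf_succ (n k : ℕ) : cf n (k + 1) * (k + 1 : ℕ) = - cf (n + 1) k := by
  unfold cf
  rw [show k + 1 + n = k + (n + 1) by ring, Nat.factorial_succ k]
  push_cast
  field_simp
  ring

lemma cc_hasDerivAt (n : ℕ) (z : ℝ) : HasDerivAt (cc n) (- cc (n + 1) z) z := by
  set R : ℝ := |z| + 1 with hR
  have hu : Summable (fun k : ℕ => (k : ℝ) * R ^ (k - 1) / (Nat.factorial k : ℝ)) := by
    rw [← summable_nat_add_iff 1]
    refine (Real.summable_pow_div_factorial R).congr ?_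
    intro k
    rw [Nat.factorial_succ]
    push_cast
    field_simp
  have h := hasDerivAt_tsum_of_isPreconnected (g := fun k y => cf n k * y ^ k)
    (g' := fun k y => cf n k * ((k : ℝ) * y ^ (k - 1))) (t := Metric.ball (0 : ℝ) R) (y₀ := 0) (y := z)
    hu Metric.isOpen_ball (convex_ball _ _).isPreconnected
    (fun k y _ => (hasDerivAt_pow k y).const_mul _)
    (by
      intro k y hy
      rw [mem_ball_zero_iff, Real.norm_eq_abs] at hy
      rw [Real.norm_eq_abs, abs_mul, abs_mul, abs_pow, Nat.abs_cast]
      calc |cf n k| * ((k : ℝ) * |y| ^ (k - 1)) ≤ 1 / (Nat.factorial k : ℝ) * ((k : ℝ) * R ^ (k - 1)) := by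
            gcongr; exact cf_abs_le n k
        _ = _ := by ring)
    (by simp [hR]; positivity) (cc_summable n 0) (by simp [hR])
  have e : ∑' k : ℕ, cf n k * ((k : ℝ) * z ^ (k - 1)) = - cc (n + 1) z := by
    have hs : Summable (fun k : ℕ => cf n (k + 1) * (((k + 1 : ℕ) : ℝ) * z ^ (k + 1 - 1))) := by
      refine (cc_summable (n + 1) z).neg.congr ?_
      intro k
      rw [← mul_assoc, cf_succ]; simp
    rw [((summable_nat_add_iff (f := fun k : ℕ => cf n k * ((k : ℝ) * z ^ (k - 1))) 1).1 hs).tsum_eq_zero_add]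
    unfold cc
    rw [← tsum_neg]
    simp only [Nat.cast_zero, zero_mul, mul_zero, zero_add]
    apply tsum_congr
    intro k
    rw [← mul_assoc, cf_succ]; simp
  rw [e] at h
  exact h

lemma cc_continuous (n : ℕ) : Continuous (cc n) :=
  continuous_iff_continuousAt.2 fun z => (cc_hasDerivAt n z).continuousAt

lemma cc_zero (n : ℕ) : cc n 0 = 1 / (Nat.factorial n : ℝ) := by
  unfold cc
  rw [tsum_eq_single 0]
  · simp [cf]
  · intro k hk; simp [hk]

lemma cc_rec (z : ℝ) : z * cc 3 z - 2 * cc 2 z + cc 1 z = 0 := by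
  have h : 2 * cc 2 z - cc 1 z = z * cc 3 z := by
    unfold cc
    rw [← tsum_mul_left, ← tsum_mul_left, ← ((cc_summable 2 z).mul_left 2).tsum_sub (cc_summable 1 z),
      (((cc_summable 2 z).mul_left 2).sub (cc_summable 1 z)).tsum_eq_zero_add]
    rw [show (2 * (cf 2 0 * z ^ 0) - cf 1 0 * z ^ 0) = 0 by simp [cf]]
    rw [zero_add]
    apply tsum_congr
    intro k
    simp only [cf, Nat.factorial_succ, show k + 1 + 2 = k + 3 from rfl, show k + 1 + 1 = k + 2 from rfl]
    push_cast
    field_simp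
    ring
  linarith

lemma J1_eq (s : ℝ) : J1 s = s / 2 * cc 1 (s ^ 2 / 4) := by
  unfold J1 cc
  rw [← tsum_mul_left]
  apply tsum_congr
  intro k
  unfold cf
  rw [pow_succ, pow_mul, show (s / 2) ^ 2 = s ^ 2 / 4 by ring]
  ring

lemma J1_hasDerivAt (s : ℝ) :
    HasDerivAt J1 (1 / 2 * cc 1 (s ^ 2 / 4) - s ^ 2 / 4 * cc 2 (s ^ 2 / 4)) s := by
  have h1 : HasDerivAt (fun s : ℝ => s ^ 2 / 4) (s / 2) s := by
    have := (hasDerivAt_pow 2 s).div_const 4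
    refine this.congr_deriv ?_
    push_cast; ring
  have h2 := (cc_hasDerivAt 1 (s ^ 2 / 4)).comp s h1
  have h3 := ((hasDerivAt_id s).div_const 2).mul h2
  have e : J1 = (fun s => id s / 2) * (cc 1 ∘ fun s : ℝ => s ^ 2 / 4) := by
    funext s; simp [J1_eq]
  rw [e]
  refine h3.congr_deriv ?_
  simp only [Function.comp, id]; ring

lemma cc2_nine : cc 2 9 < 0 := by
  unfold cc
  rw [← (cc_summable 2 9).sum_add_tsum_nat_add 8]
  have hb : ∀ k : ℕ, |cf 2 (k + 8) * 9 ^ (k + 8)| ≤ (1 / 1000) * (1 / 2) ^ k := by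
    intro k
    induction k with
    | zero =>
      simp [cf, Nat.factorial]; norm_num
    | succ k ih =>
      have : cf 2 (k + 1 + 8) * 9 ^ (k + 1 + 8) =
          (-9 / ((k + 9) * (k + 11))) * (cf 2 (k + 8) * 9 ^ (k + 8)) := by
        simp only [cf, show k + 1 + 8 = (k + 8) + 1 by ring, show k + 8 + 1 + 2 = (k + 8 + 2) + 1 by ring,
          Nat.factorial_succ (k + 8), Nat.factorial_succ (k + 8 + 2), pow_succ]
        push_cast
        field_simp
        ring
      rw [this, abs_mul]
      have h2 : |(-9 : ℝ) / ((k + 9) * (k + 11))| ≤ 1 / 2 := by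
        rw [abs_div, abs_of_pos (a := ((k : ℝ) + 9) * (k + 11)) (by positivity),
          div_le_div_iff₀ (by positivity) (by norm_num)]
        have : (0 : ℝ) ≤ k := by positivity
        norm_num; nlinarith
      calc _ ≤ 1 / 2 * ((1 / 1000) * (1 / 2) ^ k) := mul_le_mul h2 ih (abs_nonneg _) (by norm_num)
        _ = (1 / 1000) * (1 / 2) ^ (k + 1) := by ring
  have hg : HasSum (fun k : ℕ => (1 / 1000 : ℝ) * (1 / 2) ^ k) (1 / 1000 * 2) :=
    hasSum_geometric_two.mul_left _
  have ht := tsum_of_norm_bounded (f := fun k : ℕ => cf 2 (k + 8) * 9 ^ (k + 8)) hg hb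
  have ht2 := (abs_le.1 (by simpa using ht)).2
  have hs : ∑ i ∈ Finset.range 8, cf 2 i * 9 ^ i < - (1 / 50 : ℝ) := by
    simp [Finset.sum_range_succ, cf, Nat.factorial]; norm_num
  norm_num at ht2 hs ⊢
  linarith

lemma exists_z1 : ∃ z1 : ℝ, 0 < z1 ∧ (∀ z, 0 ≤ z → z < z1 → 0 < cc 2 z) ∧ cc 2 z1 = 0 ∧ cc 1 z1 < 0 := by
  have h0 : 0 < cc 2 0 := by rw [cc_zero]; positivity
  have hzero : ∀ y, 0 ≤ y → cc 2 y ≤ 0 → ∃ w ∈ Set.Icc 0 y, cc 2 w = 0 := by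
    intro y hy hc
    exact intermediate_value_Icc' hy (cc_continuous 2).continuousOn ⟨hc, h0.le⟩
  have hcomp : IsCompact (Set.Icc (0 : ℝ) 9 ∩ (cc 2) ⁻¹' {0}) :=
    isCompact_Icc.inter_right (isClosed_singleton.preimage (cc_continuous 2))
  obtain ⟨w, hw, hw0⟩ := hzero 9 (by norm_num) cc2_nine.le
  obtain ⟨z1, ⟨hz1, hz10⟩, hmin⟩ := hcomp.exists_isLeast ⟨w, hw, hw0⟩
  have hz10 : cc 2 z1 = 0 := hz10
  have hpos : 0 < z1 := by
    rcases hz1.1.lt_or_eq with h | h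
    · exact h
    · rw [← h] at hz10; linarith
  have hlt : ∀ z, 0 ≤ z → z < z1 → 0 < cc 2 z := by
    intro z hz hzz
    by_contra! hc
    obtain ⟨u, hu, hu0⟩ := hzero z hz hc
    have := hmin ⟨⟨hu.1, hu.2.trans (hzz.le.trans hz1.2)⟩, hu0⟩
    linarith [hu.2]
  refine ⟨z1, hpos, hlt, hz10, ?_⟩
  by_contra! hc
  have hanti : StrictAntiOn (cc 1) (Set.Icc 0 z1) := by
    apply strictAntiOn_of_deriv_neg (convex_Icc _ _) (cc_continuous 1).continuousOn
    intro x hx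
    rw [interior_Icc] at hx
    rw [(cc_hasDerivAt 1 x).deriv]
    have := hlt x hx.1.le hx.2
    simpa using this
  have hmono : StrictMonoOn (fun z => z ^ 2 * cc 2 z) (Set.Icc 0 z1) := by
    apply strictMonoOn_of_deriv_pos (convex_Icc _ _)
      (by have := cc_continuous 2; fun_prop)
    intro x hx
    rw [interior_Icc] at hx
    have hd : HasDerivAt (fun z => z ^ 2 * cc 2 z) _ x := (hasDerivAt_pow 2 x).mul (cc_hasDerivAt 2 x)
    rw [hd.deriv]
    have h1 : 0 < cc 1 x := lt_of_le_of_lt hc (hanti ⟨hx.1.le, hx.2.le⟩ ⟨hpos.le, le_rfl⟩ hx.2)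
    have hr := cc_rec x
    have hm := mul_pos hx.1 h1
    norm_num
    nlinarith
  have := hmono ⟨le_rfl, hpos.le⟩ ⟨hpos.le, le_rfl⟩ hpos
  simp [hz10] at this

lemma cc1_strictAnti {z1 : ℝ} (hlt : ∀ z, 0 ≤ z → z < z1 → 0 < cc 2 z) :
    StrictAntiOn (cc 1) (Set.Icc 0 z1) := by
  apply strictAntiOn_of_deriv_neg (convex_Icc _ _) (cc_continuous 1).continuousOn
  intro x hx
  rw [interior_Icc] at hx
  rw [(cc_hasDerivAt 1 x).deriv]
  have := hlt x hx.1.le hx.2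
  simpa using this

/-! ### The modified Bessel integrals -/

noncomputable def MM (n : ℕ) (r : ℝ) : ℝ :=
  ∫ t in Set.Ioi (0 : ℝ), Real.exp (-(r * Real.cosh t)) * Real.cosh t ^ n

lemma K1_eq : K1 = MM 1 := by
  funext r; simp [K1, MM]

lemma MM_bound (n : ℕ) {r : ℝ} (hr : 0 < r) (t : ℝ) :
    Real.exp (-(r * Real.cosh t)) * Real.cosh t ^ n ≤
      (Nat.factorial n * (2 / r) ^ n) * Real.exp (-(r / 2) * t) := by
  have hc := Real.cosh_pos t
  have h1 := Real.pow_div_factorial_le_exp (r / 2 * Real.cosh t) (by positivity) n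
  have h2 : t ≤ Real.cosh t := by
    rw [Real.cosh_eq]
    have := Real.add_one_le_exp (t)
    have h3 := Real.exp_pos (-t)
    have h4 := Real.quadratic_le_exp_of_nonneg (x := |t|) (abs_nonneg t)
    rcases le_or_gt 0 t with h | h
    · rw [abs_of_nonneg h] at h4; nlinarith
    · have := Real.exp_pos t; linarith
  have h3 : Real.cosh t ^ n ≤ (Nat.factorial n * (2 / r) ^ n) * Real.exp (r / 2 * Real.cosh t) := by
    calc Real.cosh t ^ n = (Nat.factorial n * (2 / r) ^ n) * ((r / 2 * Real.cosh t) ^ n / Nat.factorial n) := by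
          rw [mul_pow, div_pow, div_pow]; field_simp
      _ ≤ _ := by gcongr
  calc _ ≤ Real.exp (-(r * Real.cosh t)) * ((Nat.factorial n * (2 / r) ^ n) * Real.exp (r / 2 * Real.cosh t)) := by
        gcongr
    _ = (Nat.factorial n * (2 / r) ^ n) * Real.exp (-(r / 2) * Real.cosh t) := by
        rw [mul_comm, mul_assoc, ← Real.exp_add]; congr 2; ring
    _ ≤ _ := by
        gcongr ?_ * Real.exp ?_
        nlinarith

lemma MM_integrable (n : ℕ) {r : ℝ} (hr : 0 < r) :
    IntegrableOn (fun t => Real.exp (-(r * Real.cosh t)) * Real.cosh t ^ n) (Set.Ioi 0) := by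
  have hg : IntegrableOn (fun t => (Nat.factorial n * (2 / r) ^ n) * Real.exp (-(r / 2) * t)) (Set.Ioi 0) :=
    (exp_neg_integrableOn_Ioi 0 (by positivity : 0 < r / 2)).const_mul _
  refine Integrable.mono' hg ?_ ?_
  · apply Continuous.aestronglyMeasurable; fun_prop
  · filter_upwards with t
    have hc := Real.cosh_pos t
    rw [Real.norm_of_nonneg (by positivity)]
    exact MM_bound n hr t

lemma MM_pos (n : ℕ) {r : ℝ} (hr : 0 < r) : 0 < MM n r := by
  unfold MM
  rw [setIntegral_pos_iff_support_of_nonneg_ae]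
  · have : Function.support (fun t => Real.exp (-(r * Real.cosh t)) * Real.cosh t ^ n) = Set.univ := by
      ext t; have hc := Real.cosh_pos t; simp [hc.ne']
    rw [this]; simp
  · filter_upwards with t
    have hc := Real.cosh_pos t
    simp only [Pi.zero_apply]; positivity
  · exact MM_integrable n hr

lemma MM_hasDerivAt (n : ℕ) {r : ℝ} (hr : 0 < r) : HasDerivAt (MM n) (- MM (n + 1) r) r := by
  have h := hasDerivAt_integral_of_dominated_loc_of_deriv_le (μ := volume.restrict (Set.Ioi (0 : ℝ)))
    (F := fun r t => Real.exp (-(r * Real.cosh t)) * Real.cosh t ^ n)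
    (F' := fun r t => -(Real.exp (-(r * Real.cosh t)) * Real.cosh t ^ (n + 1)))
    (x₀ := r) (s := Set.Ioi (r / 2)) (bound := fun t => Real.exp (-(r / 2 * Real.cosh t)) * Real.cosh t ^ (n + 1))
    (Ioi_mem_nhds (by linarith))
    (by filter_upwards with x; apply Continuous.aestronglyMeasurable; fun_prop)
    (MM_integrable n hr)
    (by apply Continuous.aestronglyMeasurable; fun_prop)
    (by
      filter_upwards with t x hx
      have hc := Real.cosh_pos t
      rw [norm_neg, Real.norm_of_nonneg (by positivity)]
      gcongr
      exact (Set.mem_Ioi.1 hx).le)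
    (MM_integrable (n + 1) (by linarith))
    (by
      filter_upwards with t x hx
      have h1 : HasDerivAt (fun r : ℝ => -(r * Real.cosh t)) (-Real.cosh t) x := by
        exact (((hasDerivAt_id x).mul_const (Real.cosh t)).neg).congr_deriv (by ring)
      refine (h1.exp.mul_const (Real.cosh t ^ n)).congr_deriv ?_
      ring)
  have h2 := h.2
  rw [integral_neg] at h2
  exact h2

lemma MM_ibp (n : ℕ) {r : ℝ} (hr : 0 < r) {f : ℝ → ℝ}
    (hf : ∀ t, HasDerivAt (fun t => Real.sinh t * Real.cosh t ^ n * Real.exp (-(r * Real.cosh t))) (f t) t)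
    (hi : IntegrableOn f (Set.Ioi 0)) : ∫ t in Set.Ioi (0 : ℝ), f t = 0 := by
  have ht : Tendsto (fun t => Real.sinh t * Real.cosh t ^ n * Real.exp (-(r * Real.cosh t))) atTop (nhds 0) := by
    have hg : Tendsto (fun t : ℝ => (Nat.factorial (n + 1) * (2 / r) ^ (n + 1)) * Real.exp (-(r / 2) * t)) atTop (nhds 0) := by
      have : Tendsto (fun t : ℝ => Real.exp (-(r / 2) * t)) atTop (nhds 0) := by
        apply Real.tendsto_exp_atBot.comp
        exact tendsto_id.const_mul_atTop_of_neg (by linarith)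
      simpa using this.const_mul _
    apply squeeze_zero_norm _ hg
    intro t
    have hc := Real.cosh_pos t
    refine le_trans ?_ (MM_bound (n + 1) hr t)
    rw [norm_mul, norm_mul, Real.norm_of_nonneg (by positivity : 0 ≤ Real.cosh t ^ n),
      Real.norm_of_nonneg (by positivity : 0 ≤ Real.exp (-(r * Real.cosh t))), Real.norm_eq_abs]
    have : |Real.sinh t| ≤ Real.cosh t := abs_le_of_sq_le_sq (by rw [Real.cosh_sq]; linarith) hc.le
    calc _ ≤ Real.cosh t * Real.cosh t ^ n * Real.exp (-(r * Real.cosh t)) := by gcongr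
      _ = _ := by ring
  have := integral_Ioi_of_hasDerivAt_of_tendsto' (a := 0) (fun t _ => hf t) hi ht
  simpa using this

lemma exp_cosh_deriv (r t : ℝ) : HasDerivAt (fun t => Real.exp (-(r * Real.cosh t)))
    (Real.exp (-(r * Real.cosh t)) * (-(r * Real.sinh t))) t :=
  (((Real.hasDerivAt_cosh t).const_mul r).neg).exp

lemma MM_rec1 {r : ℝ} (hr : 0 < r) : MM 1 r - r * MM 2 r + r * MM 0 r = 0 := by
  have i0 := MM_integrable 0 hr
  have i1 := MM_integrable 1 hr
  have i2 := MM_integrable 2 hr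
  have j1 : IntegrableOn (fun t => Real.exp (-(r * Real.cosh t)) * Real.cosh t ^ 1
    - r * (Real.exp (-(r * Real.cosh t)) * Real.cosh t ^ 2)) (Set.Ioi 0) := i1.sub (i2.const_mul r)
  have h := MM_ibp 0 hr (f := fun t => Real.exp (-(r * Real.cosh t)) * Real.cosh t ^ 1
    - r * (Real.exp (-(r * Real.cosh t)) * Real.cosh t ^ 2)
    + r * (Real.exp (-(r * Real.cosh t)) * Real.cosh t ^ 0))
    (by
      intro t
      have := (Real.hasDerivAt_sinh t).mul (exp_cosh_deriv r t)
      simp only [pow_zero, mul_one, pow_one]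
      refine this.congr_deriv ?_
      have := Real.cosh_sq t
      rw [this]; ring)
    (j1.add (i0.const_mul r))
  rw [integral_add j1 (i0.const_mul r), integral_sub i1 (i2.const_mul r),
    integral_const_mul, integral_const_mul] at h
  exact h

lemma MM_rec2 {r : ℝ} (hr : 0 < r) : 2 * MM 2 r - MM 0 r - r * MM 3 r + r * MM 1 r = 0 := by
  have i0 := MM_integrable 0 hr
  have i1 := MM_integrable 1 hr
  have i2 := MM_integrable 2 hr
  have i3 := MM_integrable 3 hr
  have j1 : IntegrableOn (fun t => 2 * (Real.exp (-(r * Real.cosh t)) * Real.cosh t ^ 2)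
    - (Real.exp (-(r * Real.cosh t)) * Real.cosh t ^ 0)) (Set.Ioi 0) := (i2.const_mul 2).sub i0
  have j2 : IntegrableOn (fun t => 2 * (Real.exp (-(r * Real.cosh t)) * Real.cosh t ^ 2)
    - (Real.exp (-(r * Real.cosh t)) * Real.cosh t ^ 0)
    - r * (Real.exp (-(r * Real.cosh t)) * Real.cosh t ^ 3)) (Set.Ioi 0) := j1.sub (i3.const_mul r)
  have h := MM_ibp 1 hr (f := fun t => 2 * (Real.exp (-(r * Real.cosh t)) * Real.cosh t ^ 2)
    - (Real.exp (-(r * Real.cosh t)) * Real.cosh t ^ 0)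
    - r * (Real.exp (-(r * Real.cosh t)) * Real.cosh t ^ 3)
    + r * (Real.exp (-(r * Real.cosh t)) * Real.cosh t ^ 1))
    (by
      intro t
      have := ((Real.hasDerivAt_sinh t).mul (Real.hasDerivAt_cosh t)).mul (exp_cosh_deriv r t)
      simp only [pow_zero, mul_one, pow_one]
      refine this.congr_deriv ?_
      have := Real.sinh_sq t
      simp only [Pi.mul_apply]
      linear_combination (Real.exp (-(r * Real.cosh t)) - r * Real.cosh t * Real.exp (-(r * Real.cosh t))) * this)
    (j2.add (i1.const_mul r))
  rw [integral_add j2 (i1.const_mul r),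
    integral_sub j1 (i3.const_mul r), integral_sub (i2.const_mul 2) i0,
    integral_const_mul, integral_const_mul, integral_const_mul] at h
  exact h

lemma MM_ode {r : ℝ} (hr : 0 < r) : r ^ 2 * MM 3 r = r * MM 2 r + MM 1 r + r ^ 2 * MM 1 r := by
  have h1 := MM_rec1 hr
  have h2 := MM_rec2 hr
  linear_combination (-1) * h1 - r * h2

lemma MM_anti : AntitoneOn (MM 1) (Set.Ioi 0) := by
  intro x hx y hy hxy
  unfold MM
  apply setIntegral_mono (MM_integrable 1 hy) (MM_integrable 1 hx)
  intro t
  have hc := Real.cosh_pos t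
  simp only
  gcongr

/-- decay: `r * MM 1 r` is bounded by its value at one. -/
lemma MM_decay {r : ℝ} (hr : 1 ≤ r) : r * MM 1 r ≤ MM 1 1 := by
  have h : AntitoneOn (fun r => r * MM 1 r) (Set.Ici 1) := by
    have hd : ∀ x : ℝ, 1 ≤ x → HasDerivAt (fun r => r * MM 1 r) (1 * MM 1 x + x * -MM 2 x) x := by
      intro x hx
      exact (hasDerivAt_id x).mul (MM_hasDerivAt 1 (by linarith))
    apply antitoneOn_of_deriv_nonpos (convex_Ici 1)
    · intro x hx; exact (hd x hx).continuousAt.continuousWithinAt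
    · intro x hx
      rw [interior_Ici] at hx
      exact (hd x (le_of_lt hx)).differentiableAt.differentiableWithinAt
    · intro x hx
      rw [interior_Ici] at hx
      have hx' : (0 : ℝ) < x := lt_trans one_pos hx
      rw [(hd x (le_of_lt hx)).deriv]
      have := MM_rec1 hx'
      have := mul_pos hx' (MM_pos 0 hx')
      linarith
  simpa using h (Set.mem_Ici.2 le_rfl) hr hr

/-! ### The smallest root -/

noncomputable def GG (b t : ℝ) : ℝ :=
  2 * (t * MM 2 t + MM 1 t) * cc 1 (b * t ^ 2 / 4) + t ^ 2 * MM 1 t * cc 2 (b * t ^ 2 / 4)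

lemma mem_aSet_iff {lam t : ℝ} (hlam : 1 < lam) (ht : 0 < t) :
    t ∈ aSet lam ↔ cc 1 ((lam - 1) * t ^ 2 / 4) ≠ 0 ∧ GG (lam - 1) t = 0 := by
  have hb : 0 < lam - 1 := by linarith
  set m := Real.sqrt (lam - 1) with hm
  have hm0 : 0 < m := Real.sqrt_pos.2 hb
  have hmm : m ^ 2 = lam - 1 := Real.sq_sqrt hb.le
  have hl : lam = m ^ 2 + 1 := by linarith
  have hz : (m * t) ^ 2 / 4 = (lam - 1) * t ^ 2 / 4 := by rw [mul_pow, hmm]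
  have hM1 := MM_pos 1 ht
  unfold aSet
  rw [Set.mem_ofPred_eq, ← hm, (J1_hasDerivAt _).deriv, J1_eq, hz, K1_eq, (MM_hasDerivAt 1 ht).deriv]
  set c1 := cc 1 ((lam - 1) * t ^ 2 / 4) with hc1
  unfold GG
  rw [← hc1]
  set c2 := cc 2 ((lam - 1) * t ^ 2 / 4)
  have e1 : m * t / 2 * c1 ≠ 0 ↔ c1 ≠ 0 := by
    constructor
    · intro h h'; exact h (by rw [h', mul_zero])
    · intro h; positivity
  rw [e1]
  constructor
  · rintro ⟨-, h, h2⟩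
    refine ⟨h, ?_⟩
    rw [← hmm, hl] at h2
    norm_num at h2
    field_simp at h2
    have h3 : m ^ 2 ≠ 0 := by positivity
    apply mul_left_cancel₀ h3
    linear_combination (-1 / 2) * h2
  · rintro ⟨h, h2⟩
    refine ⟨ht, h, ?_⟩
    rw [← hmm, hl]
    norm_num
    field_simp
    linear_combination (-2) * m ^ 2 * h2

lemma GG_continuousOn (b : ℝ) : ContinuousOn (GG b) (Set.Ioi 0) := by
  have h1 : ContinuousOn (MM 1) (Set.Ioi 0) := fun x hx =>
    (MM_hasDerivAt 1 hx).continuousAt.continuousWithinAt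
  have h2 : ContinuousOn (MM 2) (Set.Ioi 0) := fun x hx =>
    (MM_hasDerivAt 2 hx).continuousAt.continuousWithinAt
  have h3 := cc_continuous 1
  have h4 := cc_continuous 2
  unfold GG
  fun_prop

lemma exists_a {lam : ℝ} (hlam : 1 < lam) :
    0 < aLam lam ∧ cc 1 ((lam - 1) * aLam lam ^ 2 / 4) < 0 ∧ GG (lam - 1) (aLam lam) = 0 ∧
    ∀ z, 0 ≤ z → z < (lam - 1) * aLam lam ^ 2 / 4 → cc 1 ((lam - 1) * aLam lam ^ 2 / 4) < cc 1 z := by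
  have hb : 0 < lam - 1 := by linarith
  set b := lam - 1 with hbdef
  obtain ⟨z1, hz1, hc2, hc2z, hc1z⟩ := exists_z1
  have hanti := cc1_strictAnti hc2
  have h10 : 0 < cc 1 0 := by rw [cc_zero]; positivity
  obtain ⟨z0, hz0, hc10⟩ := intermediate_value_Icc' hz1.le (cc_continuous 1).continuousOn
    (show (0 : ℝ) ∈ Set.Icc _ _ from ⟨hc1z.le, h10.le⟩)
  have hz0pos : 0 < z0 := by
    rcases hz0.1.lt_or_eq with h | h
    · exact h
    · rw [← h] at hc10; linarith
  have hz01 : z0 < z1 := by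
    rcases hz0.2.lt_or_eq with h | h
    · exact h
    · rw [h] at hc10; linarith
  set T : ℝ → ℝ := fun z => Real.sqrt (4 * z / b) with hT
  have hTz : ∀ z, 0 ≤ z → b * T z ^ 2 / 4 = z := by
    intro z hz
    simp only [hT]
    rw [Real.sq_sqrt (by positivity)]; field_simp
  have hTpos : ∀ z, 0 < z → 0 < T z := fun z hz => Real.sqrt_pos.2 (by positivity)
  have hlt_iff : ∀ {s t : ℝ}, 0 < s → 0 < t → (s < t ↔ b * s ^ 2 / 4 < b * t ^ 2 / 4) := by
    intro s t hs ht
    rw [← pow_lt_pow_iff_left₀ hs.le ht.le two_ne_zero]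
    constructor
    · intro h; gcongr
    · intro h; nlinarith
  have ht01 : T z0 < T z1 := by
    rw [hlt_iff (hTpos _ hz0pos) (hTpos _ hz1), hTz _ hz0pos.le, hTz _ hz1.le]; exact hz01
  have hG1 : GG b (T z1) < 0 := by
    unfold GG
    rw [hTz _ hz1.le, hc2z, mul_zero, add_zero]
    have h1 := MM_pos 1 (hTpos _ hz1)
    have h2 := MM_pos 2 (hTpos _ hz1)
    have h3 := hTpos _ hz1
    exact mul_neg_of_pos_of_neg (by positivity) hc1z
  have hGpos : ∀ t, 0 < t → t ≤ T z0 → 0 < GG b t := by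
    intro t ht htz
    have hle : b * t ^ 2 / 4 ≤ z0 := by
      rw [← hTz z0 hz0pos.le]; gcongr
    have hp : 0 ≤ b * t ^ 2 / 4 := by positivity
    have h1 := MM_pos 1 ht
    have h2 := MM_pos 2 ht
    have hc : 0 ≤ cc 1 (b * t ^ 2 / 4) := by
      rw [← hc10]
      exact hanti.antitoneOn ⟨hp, hle.trans hz01.le⟩ hz0 hle
    have hcc := hc2 _ hp (hle.trans_lt hz01)
    unfold GG
    positivity
  have hcont : ContinuousOn (GG b) (Set.Icc (T z0) (T z1)) :=
    (GG_continuousOn b).mono fun t ht => lt_of_lt_of_le (hTpos _ hz0pos) ht.1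
  have hcomp : IsCompact (Set.Icc (T z0) (T z1) ∩ (GG b) ⁻¹' {0}) :=
    isCompact_Icc.of_isClosed_subset (hcont.preimage_isClosed_of_isClosed isClosed_Icc isClosed_singleton)
      Set.inter_subset_left
  obtain ⟨w, hw, hw0⟩ := intermediate_value_Icc' ht01.le hcont
    (show (0 : ℝ) ∈ Set.Icc _ _ from ⟨hG1.le, (hGpos _ (hTpos _ hz0pos) le_rfl).le⟩)
  obtain ⟨a, ⟨ha, ha0⟩, hmin⟩ := hcomp.exists_isLeast ⟨w, hw, hw0⟩
  have ha0 : GG b a = 0 := ha0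
  have hapos : 0 < a := lt_of_lt_of_le (hTpos _ hz0pos) ha.1
  have hag : T z0 < a := by
    by_contra! h
    have := hGpos a hapos h
    linarith
  have hza0 : z0 < b * a ^ 2 / 4 := by
    rw [← hTz z0 hz0pos.le]
    exact (hlt_iff (hTpos _ hz0pos) hapos).1 hag
  have hza1 : b * a ^ 2 / 4 ≤ z1 := by
    rw [← hTz z1 hz1.le]
    have := ha.2
    gcongr
  have hzap : 0 ≤ b * a ^ 2 / 4 := by positivity
  have hc1a : cc 1 (b * a ^ 2 / 4) < 0 := by
    rw [← hc10]
    exact hanti hz0 ⟨hzap, hza1⟩ hza0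
  have hleast : IsLeast (aSet lam) a := by
    constructor
    · exact (mem_aSet_iff hlam hapos).2 ⟨hc1a.ne, ha0⟩
    · intro t ht
      have htpos : 0 < t := ht.1
      have hGt := ((mem_aSet_iff hlam htpos).1 ht).2
      by_contra! hta
      have h1 : T z0 ≤ t := by
        by_contra! h
        have := hGpos t htpos h.le
        linarith
      have := hmin ⟨⟨h1, hta.le.trans ha.2⟩, hGt⟩
      linarith
  have hae : aLam lam = a := hleast.csInf_eq
  rw [hae]
  refine ⟨hapos, hc1a, ha0, ?_⟩
  intro z hz hza
  exact hanti ⟨hz, hza.le.trans hza1⟩ ⟨hzap, hza1⟩ hza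

/-! ### Radial functions -/

lemma lap_radial {ψ : ℝ × ℝ → ℝ} {R R1 : ℝ → ℝ} {R2 : ℝ} {x : ℝ × ℝ}
    (hψ : ∀ᶠ y in nhds x, ψ y = y.2 * R (y.1 ^ 2 + y.2 ^ 2))
    (h1 : ∀ᶠ ρ in nhds (x.1 ^ 2 + x.2 ^ 2), HasDerivAt R (R1 ρ) ρ)
    (h2 : HasDerivAt R1 R2 (x.1 ^ 2 + x.2 ^ 2)) :
    lap ψ x = x.2 * (4 * (x.1 ^ 2 + x.2 ^ 2) * R2 + 8 * R1 (x.1 ^ 2 + x.2 ^ 2)) := by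
  obtain ⟨p, q⟩ := x
  simp only at *
  have dA : ∀ t : ℝ, HasDerivAt (fun t : ℝ => t ^ 2 + q ^ 2) (2 * t) t := fun t =>
    ((hasDerivAt_pow 2 t).add_const _).congr_deriv (by push_cast; ring)
  have dB : ∀ t : ℝ, HasDerivAt (fun t : ℝ => p ^ 2 + t ^ 2) (2 * t) t := fun t =>
    ((hasDerivAt_pow 2 t).const_add _).congr_deriv (by push_cast; ring)
  have cA : ContinuousAt (fun t : ℝ => t ^ 2 + q ^ 2) p := (dA p).continuousAt
  have cB : ContinuousAt (fun t : ℝ => p ^ 2 + t ^ 2) q := (dB q).continuousAt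
  have iA : ContinuousAt (fun t : ℝ => (t, q)) p := by fun_prop
  have iB : ContinuousAt (fun t : ℝ => (p, t)) q := by fun_prop
  have eA : ∀ᶠ t in nhds p, ψ (t, q) = q * R (t ^ 2 + q ^ 2) := iA.eventually hψ
  have eB : ∀ᶠ t in nhds q, ψ (p, t) = t * R (p ^ 2 + t ^ 2) := iB.eventually hψ
  have hA : ∀ᶠ t in nhds p, HasDerivAt R (R1 (t ^ 2 + q ^ 2)) (t ^ 2 + q ^ 2) := cA.eventually h1
  have hB : ∀ᶠ t in nhds q, HasDerivAt R (R1 (p ^ 2 + t ^ 2)) (p ^ 2 + t ^ 2) := cB.eventually h1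
  have fA : deriv (fun t => ψ (t, q)) =ᶠ[nhds p] fun t => q * (R1 (t ^ 2 + q ^ 2) * (2 * t)) := by
    filter_upwards [eA.eventually_nhds, hA] with t ht hd
    have := (hd.comp t (dA t)).const_mul q
    exact Filter.EventuallyEq.deriv_eq ht |>.trans this.deriv
  have fB : deriv (fun t => ψ (p, t)) =ᶠ[nhds q]
      fun t => 1 * R (p ^ 2 + t ^ 2) + t * (R1 (p ^ 2 + t ^ 2) * (2 * t)) := by
    filter_upwards [eB.eventually_nhds, hB] with t ht hd
    have := (hasDerivAt_id t).mul (hd.comp t (dB t))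
    exact Filter.EventuallyEq.deriv_eq ht |>.trans this.deriv
  have i2 : HasDerivAt (fun t : ℝ => 2 * t) 2 p := by simpa using (hasDerivAt_id p).const_mul 2
  have j2 : HasDerivAt (fun t : ℝ => 2 * t) 2 q := by simpa using (hasDerivAt_id q).const_mul 2
  have gA : HasDerivAt (fun t => q * (R1 (t ^ 2 + q ^ 2) * (2 * t)))
      (q * ((R2 * (2 * p)) * (2 * p) + R1 (p ^ 2 + q ^ 2) * 2)) p :=
    (((h2.comp p (dA p) :)).mul i2).const_mul q
  have hRq := hB.self_of_nhds
  have gB : HasDerivAt (fun t => 1 * R (p ^ 2 + t ^ 2) + t * (R1 (p ^ 2 + t ^ 2) * (2 * t)))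
      (1 * (R1 (p ^ 2 + q ^ 2) * (2 * q)) + (1 * (R1 (p ^ 2 + q ^ 2) * (2 * q))
        + q * ((R2 * (2 * q)) * (2 * q) + R1 (p ^ 2 + q ^ 2) * 2))) q :=
    ((hRq.comp q (dB q) :).const_mul 1).add ((hasDerivAt_id q).mul ((h2.comp q (dB q) :).mul j2))
  unfold lap
  simp only
  rw [fA.deriv_eq, fB.deriv_eq, gA.deriv, gB.deriv]
  ring

noncomputable def PP (al be b ρ : ℝ) : ℝ := al * cc 1 (b * ρ / 4) + be
noncomputable def PP1 (al b ρ : ℝ) : ℝ := -(al * b / 4 * cc 2 (b * ρ / 4))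
noncomputable def QQ (k ρ : ℝ) : ℝ := k * (MM 1 (Real.sqrt ρ) / Real.sqrt ρ)
noncomputable def QQ1 (k ρ : ℝ) : ℝ :=
  k * (-(Real.sqrt ρ * MM 2 (Real.sqrt ρ) + MM 1 (Real.sqrt ρ)) / (2 * Real.sqrt ρ ^ 3))

lemma lin_deriv (b ρ : ℝ) : HasDerivAt (fun ρ : ℝ => b * ρ / 4) (b / 4) ρ :=
  (((hasDerivAt_id ρ).const_mul b).div_const 4).congr_deriv (by ring)

lemma PP_deriv (al be b ρ : ℝ) : HasDerivAt (PP al be b) (PP1 al b ρ) ρ := by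
  have h := (((cc_hasDerivAt 1 (b * ρ / 4)).comp ρ (lin_deriv b ρ)).const_mul al).add_const be
  refine h.congr_deriv ?_
  unfold PP1; ring

lemma PP1_deriv (al b ρ : ℝ) : HasDerivAt (PP1 al b) (al * b ^ 2 / 16 * cc 3 (b * ρ / 4)) ρ := by
  have h := (((cc_hasDerivAt 2 (b * ρ / 4)).comp ρ (lin_deriv b ρ)).const_mul (al * b / 4)).neg
  refine h.congr_deriv ?_
  ring

lemma QQ_deriv (k : ℝ) {ρ : ℝ} (hρ : 0 < ρ) : HasDerivAt (QQ k) (QQ1 k ρ) ρ := by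
  have hu : 0 < Real.sqrt ρ := Real.sqrt_pos.2 hρ
  have hs := Real.hasDerivAt_sqrt hρ.ne'
  have hm := (MM_hasDerivAt 1 hu).comp ρ hs
  have h := (hm.div hs hu.ne').const_mul k
  refine h.congr_deriv ?_
  unfold QQ1
  simp only [Function.comp]
  set u := Real.sqrt ρ
  field_simp
  ring

lemma QQ1_deriv (k : ℝ) {ρ : ℝ} (hρ : 0 < ρ) :
    HasDerivAt (QQ1 k) ((QQ k ρ - 8 * QQ1 k ρ) / (4 * ρ)) ρ := by
  have hu : 0 < Real.sqrt ρ := Real.sqrt_pos.2 hρ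
  have hs := Real.hasDerivAt_sqrt hρ.ne'
  have hm := (MM_hasDerivAt 1 hu).comp ρ hs
  have hm2 := (MM_hasDerivAt 2 hu).comp ρ hs
  have hode := MM_ode hu
  have h := ((((hs.mul hm2).add hm).neg).div ((hs.pow 3).const_mul 2) (by simp only [Pi.pow_apply]; positivity)).const_mul k
  refine h.congr_deriv ?_
  have hsq : ρ = Real.sqrt ρ ^ 2 := (Real.sq_sqrt hρ.le).symm
  unfold QQ1 QQ
  simp only [Function.comp, Pi.mul_apply, Pi.add_apply, Pi.neg_apply, Pi.pow_apply]
  set u := Real.sqrt ρ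
  rw [hsq]
  norm_num
  field_simp
  linear_combination (4 : ℝ) * k * hode

noncomputable def RR (lam W ρ : ℝ) : ℝ :=
  if ρ ≤ aLam lam ^ 2 then
    PP (-(W / ((lam - 1) * cc 1 ((lam - 1) * aLam lam ^ 2 / 4)))) (W * lam / (lam - 1)) (lam - 1) ρ
  else QQ (W * aLam lam / MM 1 (aLam lam)) ρ

lemma rad_le_iff {a : ℝ} (ha : 0 < a) (x : ℝ × ℝ) : rad x ≤ a ↔ x.1 ^ 2 + x.2 ^ 2 ≤ a ^ 2 := by
  unfold rad
  rw [Real.sqrt_le_left ha.le]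

lemma PsiL_eq {lam : ℝ} (W : ℝ) (hlam : 1 < lam) (x : ℝ × ℝ) :
    PsiL lam W x = x.2 * RR lam W (x.1 ^ 2 + x.2 ^ 2) := by
  obtain ⟨ha, hc, -, -⟩ := exists_a hlam
  unfold PsiL RR
  have hb : 0 < lam - 1 := by linarith
  simp only [rad_le_iff ha]
  by_cases hx : rad x = 0
  · have h0 : x.1 ^ 2 + x.2 ^ 2 = 0 := by
      have h := (Real.sqrt_eq_zero (by positivity)).1 hx
      exact h
    have h2 : x.2 = 0 := by nlinarith [sq_nonneg x.1, sq_nonneg x.2]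
    simp [hx, h2]
  · have hr : 0 < rad x := lt_of_le_of_ne (Real.sqrt_nonneg _) (Ne.symm hx)
    have hr2 : x.1 ^ 2 + x.2 ^ 2 = rad x ^ 2 := (Real.sq_sqrt (by positivity)).symm
    split_ifs
    · unfold PP
      rw [hr2, J1_eq, J1_eq, mul_pow, mul_pow, Real.sq_sqrt hb.le]
      have hm0 : 0 < Real.sqrt (lam - 1) := Real.sqrt_pos.2 hb
      field_simp [hc.ne]
    · unfold QQ
      rw [hr2, Real.sqrt_sq hr.le, K1_eq]
      ring

lemma match0 {lam : ℝ} (W : ℝ) (hlam : 1 < lam) :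
    PP (-(W / ((lam - 1) * cc 1 ((lam - 1) * aLam lam ^ 2 / 4)))) (W * lam / (lam - 1)) (lam - 1) (aLam lam ^ 2)
     = QQ (W * aLam lam / MM 1 (aLam lam)) (aLam lam ^ 2) := by
  obtain ⟨ha, hc, -, -⟩ := exists_a hlam
  have hb : 0 < lam - 1 := by linarith
  have hM := MM_pos 1 ha
  unfold PP QQ
  rw [Real.sqrt_sq ha.le]
  have := hc.ne
  field_simp
  ring

lemma match1 {lam : ℝ} (W : ℝ) (hlam : 1 < lam) :
    PP1 (-(W / ((lam - 1) * cc 1 ((lam - 1) * aLam lam ^ 2 / 4)))) (lam - 1) (aLam lam ^ 2)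
     = QQ1 (W * aLam lam / MM 1 (aLam lam)) (aLam lam ^ 2) := by
  obtain ⟨ha, hc, hG, -⟩ := exists_a hlam
  have hb : 0 < lam - 1 := by linarith
  have hM := MM_pos 1 ha
  unfold GG at hG
  unfold PP1 QQ1
  rw [Real.sqrt_sq ha.le]
  have := hc.ne
  set c1 := cc 1 ((lam - 1) * aLam lam ^ 2 / 4)
  set c2 := cc 2 ((lam - 1) * aLam lam ^ 2 / 4)
  set a := aLam lam
  field_simp
  linear_combination 2 * W * hG

lemma glue {P Q P1 Q1 : ℝ → ℝ} {s : ℝ} (hs : 0 < s) (hP : ∀ ρ, HasDerivAt P (P1 ρ) ρ)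
    (hQ : ∀ ρ, 0 < ρ → HasDerivAt Q (Q1 ρ) ρ) (hP1 : Continuous P1) (hQ1 : ContinuousOn Q1 (Set.Ioi 0))
    (h0 : P s = Q s) (h1 : P1 s = Q1 s) :
    ContDiffOn ℝ 1 (fun ρ => if ρ ≤ s then P ρ else Q ρ) (Set.Ioi 0) := by
  have hd : ∀ ρ, 0 < ρ → HasDerivAt (fun ρ => if ρ ≤ s then P ρ else Q ρ)
      (if ρ ≤ s then P1 ρ else Q1 ρ) ρ := by
    intro ρ hρ
    rcases lt_trichotomy ρ s with h | h | h
    · rw [if_pos h.le]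
      refine (hP ρ).congr_of_eventuallyEq ?_
      filter_upwards [Iio_mem_nhds h] with y hy
      rw [if_pos (le_of_lt hy)]
    · subst h
      rw [if_pos le_rfl]
      rw [← hasDerivWithinAt_univ, ← Set.Iic_union_Ici (a := ρ)]
      apply HasDerivWithinAt.union
      · refine (hP ρ).hasDerivWithinAt.congr ?_ ?_
        · intro y hy; rw [if_pos (Set.mem_Iic.1 hy)]
        · rw [if_pos le_rfl]
      · rw [h1]
        refine (hQ ρ hρ).hasDerivWithinAt.congr ?_ ?_
        · intro y hy
          rcases eq_or_lt_of_le (Set.mem_Ici.1 hy) with h | h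
          · rw [← h, if_pos le_rfl, h0]
          · rw [if_neg (not_le.2 h)]
        · rw [if_pos le_rfl, h0]
    · rw [if_neg (not_le.2 h)]
      refine (hQ ρ hρ).congr_of_eventuallyEq ?_
      filter_upwards [Ioi_mem_nhds h] with y hy
      rw [if_neg (not_le.2 hy)]
  have hc : ContinuousOn (fun ρ => if ρ ≤ s then P1 ρ else Q1 ρ) (Set.Ioi 0) := by
    apply ContinuousOn.if
    · intro x hx
      have := (frontier_le_subset_eq continuous_id continuous_const) hx.2
      have hxs : x = s := this
      rw [hxs, h1]
    · exact hP1.continuousOn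
    · apply hQ1.mono Set.inter_subset_left
  rw [show (1 : WithTop ℕ∞) = 0 + 1 by rfl, contDiffOn_succ_iff_deriv_of_isOpen isOpen_Ioi]
  refine ⟨fun x hx => (hd x hx).differentiableAt.differentiableWithinAt, by simp, ?_⟩
  rw [contDiffOn_zero]
  exact hc.congr fun x hx => (hd x hx).deriv

lemma RR_contDiffOn {lam : ℝ} (W : ℝ) (hlam : 1 < lam) : ContDiffOn ℝ 1 (RR lam W) (Set.Ioi 0) := by
  obtain ⟨ha, hc, hG, -⟩ := exists_a hlam
  exact glue (by positivity) (fun ρ => PP_deriv _ _ _ ρ) (fun ρ hρ => QQ_deriv _ hρ)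
    (continuous_iff_continuousAt.2 fun z => (PP1_deriv _ _ z).continuousAt)
    (fun z hz => (QQ1_deriv _ hz).continuousAt.continuousWithinAt)
    (match0 W hlam) (match1 W hlam)

lemma PsiL_contDiffOn {lam : ℝ} (W : ℝ) (hlam : 1 < lam) :
    ContDiffOn ℝ 1 (PsiL lam W) {(0 : ℝ × ℝ)}ᶜ := by
  have h : ContDiffOn ℝ 1 (fun x : ℝ × ℝ => x.2 * RR lam W (x.1 ^ 2 + x.2 ^ 2)) {(0 : ℝ × ℝ)}ᶜ := by
    apply ContDiffOn.mul contDiff_snd.contDiffOn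
    refine (RR_contDiffOn W hlam).comp (g := RR lam W) (f := fun x : ℝ × ℝ => x.1 ^ 2 + x.2 ^ 2)
      (by fun_prop) ?_
    intro x hx
    simp only [Set.mem_Ioi]
    by_contra! h
    apply hx
    have h1 : x.1 = 0 := by nlinarith [sq_nonneg x.1, sq_nonneg x.2]
    have h2 : x.2 = 0 := by nlinarith [sq_nonneg x.1, sq_nonneg x.2]
    exact Prod.ext h1 h2
  exact h.congr fun x _ => PsiL_eq W hlam x

lemma inside_pos {lam W : ℝ} (hlam : 1 < lam) (hW : 0 < W) {ρ : ℝ} (h0 : 0 ≤ ρ) (h : ρ < aLam lam ^ 2) :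
    W < PP (-(W / ((lam - 1) * cc 1 ((lam - 1) * aLam lam ^ 2 / 4)))) (W * lam / (lam - 1)) (lam - 1) ρ := by
  obtain ⟨ha, hc, -, hmin⟩ := exists_a hlam
  have hb : 0 < lam - 1 := by linarith
  have hlt := hmin ((lam - 1) * ρ / 4) (by positivity) (by gcongr)
  unfold PP
  set c := cc 1 ((lam - 1) * aLam lam ^ 2 / 4)
  set d := cc 1 ((lam - 1) * ρ / 4)
  have e : -(W / ((lam - 1) * c)) * d + W * lam / (lam - 1) - W = W / (lam - 1) * (1 - d / c) := by
    have := hc.ne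
    field_simp
    ring
  have h1 : d / c < 1 := by
    rw [div_lt_iff_of_neg hc]; linarith
  have : 0 < W / (lam - 1) * (1 - d / c) := mul_pos (by positivity) (by linarith)
  linarith

lemma outside_le {lam W : ℝ} (hlam : 1 < lam) (hW : 0 < W) {ρ : ℝ} (h : aLam lam ^ 2 < ρ) :
    QQ (W * aLam lam / MM 1 (aLam lam)) ρ ≤ W := by
  obtain ⟨ha, -, -, -⟩ := exists_a hlam
  have hr : aLam lam ≤ Real.sqrt ρ := Real.le_sqrt_of_sq_le h.le
  have hr0 : 0 < Real.sqrt ρ := ha.trans_le hr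
  have hM := MM_pos 1 ha
  have hM' := MM_pos 1 hr0
  have hle := MM_anti (Set.mem_Ioi.2 ha) (Set.mem_Ioi.2 hr0) hr
  unfold QQ
  set a := aLam lam
  rw [div_mul_div_comm, div_le_iff₀ (by positivity), mul_assoc]
  gcongr W * ?_
  rw [mul_comm (MM 1 a)]
  gcongr

lemma PsiL_pde {lam W : ℝ} (hlam : 1 < lam) (hW : 0 < W) (x : ℝ × ℝ) (hx : x ∈ UHP)
    (hne : rad x ≠ aLam lam) :
    -lap (PsiL lam W) x + PsiL lam W x = lam * max (PsiL lam W x - W * x.2) 0 := by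
  obtain ⟨ha, hc, -, -⟩ := exists_a hlam
  have hb : 0 < lam - 1 := by linarith
  have hx2 : 0 < x.2 := hx
  have hρ : 0 < x.1 ^ 2 + x.2 ^ 2 := by positivity
  have hcont : ContinuousAt (fun y : ℝ × ℝ => y.1 ^ 2 + y.2 ^ 2) x := by fun_prop
  by_cases hle : rad x ≤ aLam lam
  · have hlt : x.1 ^ 2 + x.2 ^ 2 < aLam lam ^ 2 := by
      have := lt_of_le_of_ne hle hne
      rwa [rad, Real.sqrt_lt' ha] at this
    have hev : ∀ᶠ y in nhds x, PsiL lam W y = y.2 *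
        PP (-(W / ((lam - 1) * cc 1 ((lam - 1) * aLam lam ^ 2 / 4)))) (W * lam / (lam - 1)) (lam - 1)
          (y.1 ^ 2 + y.2 ^ 2) := by
      filter_upwards [hcont.eventually (Iio_mem_nhds hlt)] with y hy
      rw [PsiL_eq W hlam, RR, if_pos (le_of_lt hy)]
    rw [lap_radial hev (Filter.Eventually.of_forall fun ρ => PP_deriv _ _ _ ρ) (PP1_deriv _ _ _),
      hev.self_of_nhds]
    have hp := inside_pos hlam hW hρ.le hlt
    rw [max_eq_left (by nlinarith)]
    have hrec := cc_rec ((lam - 1) * (x.1 ^ 2 + x.2 ^ 2) / 4)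
    unfold PP PP1
    set A := -(W / ((lam - 1) * cc 1 ((lam - 1) * aLam lam ^ 2 / 4)))
    set ρ := x.1 ^ 2 + x.2 ^ 2
    have e : W * lam / (lam - 1) = lam * (W * lam / (lam - 1) - W) := by field_simp; ring
    linear_combination (-x.2 * A * (lam - 1)) * hrec + x.2 * e
  · have hlt : aLam lam ^ 2 < x.1 ^ 2 + x.2 ^ 2 := by
      rw [rad_le_iff ha] at hle; exact not_le.1 hle
    have hev : ∀ᶠ y in nhds x, PsiL lam W y = y.2 *
        QQ (W * aLam lam / MM 1 (aLam lam)) (y.1 ^ 2 + y.2 ^ 2) := by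
      filter_upwards [hcont.eventually (Ioi_mem_nhds hlt)] with y hy
      rw [PsiL_eq W hlam, RR, if_neg (not_le.2 hy)]
    rw [lap_radial hev (by filter_upwards [Ioi_mem_nhds hρ] with ρ h using QQ_deriv _ h)
      (QQ1_deriv _ hρ), hev.self_of_nhds]
    have hp := outside_le hlam hW hlt
    rw [max_eq_right (by nlinarith)]
    field_simp
    ring

lemma PsiL_decay {lam W : ℝ} (hlam : 1 < lam) (hW : 0 < W) (ε : ℝ) (hε : 0 < ε) :
    ∃ R : ℝ, ∀ x : ℝ × ℝ, R ≤ rad x → |PsiL lam W x| ≤ ε := by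
  obtain ⟨ha, -, -, -⟩ := exists_a hlam
  have hM := MM_pos 1 ha
  set k := W * aLam lam / MM 1 (aLam lam) with hk
  have hkp : 0 < k := by positivity
  refine ⟨max (aLam lam + 1) (max 1 (k * MM 1 1 / ε)), ?_⟩
  intro x hx
  have h1 : aLam lam < rad x := by linarith [(le_max_left _ _).trans hx]
  have h2 : 1 ≤ rad x := ((le_max_left _ _).trans (le_max_right _ _)).trans hx
  have h3 : k * MM 1 1 / ε ≤ rad x := ((le_max_right _ _).trans (le_max_right _ _)).trans hx
  have hr : 0 < rad x := by linarith
  unfold PsiL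
  rw [if_neg (not_le.2 h1), K1_eq, ← hk]
  have hx2 : |x.2 / rad x| ≤ 1 := by
    rw [abs_div, abs_of_pos hr, div_le_one hr]
    exact Real.abs_le_sqrt (by nlinarith [sq_nonneg x.1])
  have hMr := MM_pos 1 hr
  have hd := MM_decay h2
  rw [abs_mul, abs_of_pos (by positivity)]
  rw [div_le_iff₀ hε] at h3
  have h4 : k * MM 1 (rad x) ≤ ε := by
    have h5 : rad x * (k * MM 1 (rad x)) ≤ rad x * ε := by nlinarith
    exact le_of_mul_le_mul_left h5 hr
  calc _ ≤ k * MM 1 (rad x) * 1 := by gcongr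
    _ ≤ ε := by linarith

/-- properties of the Lamb dipole stream function `Ψ_L^{λ,W}`. -/
theorem stmt14 (lam W : ℝ) (hlam : 1 < lam) (hW : 0 < W) :
    (∀ x : ℝ × ℝ, PsiL lam W (x.1, -x.2) = -PsiL lam W x) ∧
    ContDiffOn ℝ 1 (PsiL lam W) {(0 : ℝ × ℝ)}ᶜ ∧
    (∀ x ∈ UHP, rad x ≠ aLam lam →
      -lap (PsiL lam W) x + PsiL lam W x = lam * max (PsiL lam W x - W * x.2) 0) ∧
    (∀ x₁ : ℝ, PsiL lam W (x₁, 0) = 0) ∧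
    (∀ ε : ℝ, 0 < ε → ∃ R : ℝ, ∀ x : ℝ × ℝ, R ≤ rad x → |PsiL lam W x| ≤ ε) ∧
    (∀ x ∈ UHP, rad x < aLam lam → 0 < PsiL lam W x) := by
  refine ⟨?_, PsiL_contDiffOn W hlam, PsiL_pde hlam hW, ?_, PsiL_decay hlam hW, ?_⟩
  · intro x
    rw [PsiL_eq W hlam, PsiL_eq W hlam]
    simp
  · intro x₁
    rw [PsiL_eq W hlam]
    simp
  · intro x hx hr
    obtain ⟨ha, -, -, -⟩ := exists_a hlam
    have hx2 : 0 < x.2 := hx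
    have hlt : x.1 ^ 2 + x.2 ^ 2 < aLam lam ^ 2 := by
      rwa [rad, Real.sqrt_lt' ha] at hr
    have hp := inside_pos hlam hW (by positivity) hlt
    rw [PsiL_eq W hlam, RR, if_pos hlt.le]
    exact mul_pos hx2 (hW.trans hp)
end

section
/- Let λ > 1 and μ > 0. There exists ν₀ ≥ μϱ(λ) such that for every ν ≥ ν₀ the following compactness of maximizing sequences holds. Suppose {ω_n} is a sequence of nonnegative functions in L¹(Π) ∩ L²(Π) with ∫_Π ω_n dx ≤ ν for all n, sup_n ‖ω_n‖_{L²(Π)} < ∞, ∫_Π x₂ω_n dx → μ as n → ∞, and ℰ_λ(ω_n) → S_{μ,ν,λ} as n → ∞. Then there exist ω ∈ Σ_{μ,ν,λ}, a subsequence {ω_{n_k}} and real numbers {c_k} such that, as k → ∞, ω_{n_k}(· + c_k e₁) → ω in L²(Π) and x₂ ω_{n_k}(· + c_k e₁) → x₂ ω in L¹(Π), where e₁ = (1,0). -/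
open MeasureTheory Real Filter

open MeasureTheory Real Filter

/-! ### Bessel kernels -/

lemma cosh_inv_le (t : ℝ) : 1 / Real.cosh t ≤ 2 * Real.exp (-t) := by
  rw [div_le_iff₀ (Real.cosh_pos t), Real.cosh_eq]
  have h1 : Real.exp (-t) * Real.exp t = 1 := by rw [← Real.exp_add]; simp
  nlinarith [Real.exp_pos (-t)]

lemma intOn_cosh_inv : IntegrableOn (fun t => 1 / Real.cosh t) (Set.Ioi (0 : ℝ)) := by
  refine Integrable.mono' ((integrableOn_exp_neg_Ioi 0).const_mul 2) ?_ ?_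
  · exact (Continuous.div continuous_const Real.continuous_cosh
      (fun x => (Real.cosh_pos x).ne')).aestronglyMeasurable
  · refine Eventually.of_forall (fun t => ?_)
    rw [Real.norm_of_nonneg (by have := Real.cosh_pos t; positivity)]
    exact cosh_inv_le t

lemma intOn_K1 {r : ℝ} (hr : 0 < r) :
    IntegrableOn (fun t => Real.exp (-(r * Real.cosh t)) * Real.cosh t) (Set.Ioi (0 : ℝ)) := by
  refine Integrable.mono' (intOn_cosh_inv.const_mul (2 / r ^ 2)) ?_ ?_
  · exact Continuous.aestronglyMeasurable (by fun_prop)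
  · refine Eventually.of_forall (fun t => ?_)
    have hc := Real.cosh_pos t
    rw [Real.norm_of_nonneg (by positivity)]
    have h2 := Real.quadratic_le_exp_of_nonneg (x := r * Real.cosh t) (by positivity)
    have h3 : (r * Real.cosh t) ^ 2 / 2 ≤ Real.exp (r * Real.cosh t) := by
      have : 0 ≤ r * Real.cosh t := by positivity
      linarith
    rw [Real.exp_neg]
    rw [inv_mul_le_iff₀ (Real.exp_pos _)]
    calc Real.cosh t = (r * Real.cosh t) ^ 2 / 2 * (2 / r ^ 2 * (1 / Real.cosh t)) := by
          field_simp
      _ ≤ _ := by gcongr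

lemma intOn_K0 {r : ℝ} (hr : 0 < r) :
    IntegrableOn (fun t => Real.exp (-(r * Real.cosh t))) (Set.Ioi (0 : ℝ)) := by
  refine Integrable.mono' (intOn_K1 hr) (Continuous.aestronglyMeasurable (by fun_prop)) ?_
  refine Eventually.of_forall (fun t => ?_)
  rw [Real.norm_of_nonneg (by positivity)]
  have := Real.one_le_cosh t
  have h := Real.exp_pos (-(r * Real.cosh t))
  nlinarith

lemma K0_nonneg (r : ℝ) : 0 ≤ K0 r := by
  unfold K0; exact integral_nonneg (fun t => by positivity)

lemma K1_nonneg (r : ℝ) : 0 ≤ K1 r := by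
  unfold K1
  exact integral_nonneg (fun t => mul_nonneg (Real.exp_pos _).le (Real.cosh_pos t).le)

lemma K0_measurable : Measurable K0 := by
  unfold K0
  have : StronglyMeasurable (Function.uncurry fun (r t : ℝ) => Real.exp (-(r * Real.cosh t))) :=
    Continuous.stronglyMeasurable (by unfold Function.uncurry; fun_prop)
  exact this.integral_prod_right.measurable

lemma K1_measurable : Measurable K1 := by
  unfold K1
  have : StronglyMeasurable
      (Function.uncurry fun (r t : ℝ) => Real.exp (-(r * Real.cosh t)) * Real.cosh t) :=
    Continuous.stronglyMeasurable (by unfold Function.uncurry; fun_prop)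
  exact this.integral_prod_right.measurable

lemma K0_sub_le {r R : ℝ} (hr : 0 < r) (hR : r ≤ R) :
    K0 r - K0 R ≤ (R - r) * K1 r := by
  unfold K0 K1
  rw [← integral_sub (intOn_K0 hr) (intOn_K0 (hr.trans_le hR)), ← integral_const_mul]
  refine integral_mono ((intOn_K0 hr).sub (intOn_K0 (hr.trans_le hR)))
    ((intOn_K1 hr).const_mul _) (fun t => ?_)
  simp only
  have h1 : Real.exp (-(R * Real.cosh t)) =
      Real.exp (-(r * Real.cosh t)) * Real.exp (-((R - r) * Real.cosh t)) := by
    rw [← Real.exp_add]; ring_nf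
  have h2 := Real.add_one_le_exp (-((R - r) * Real.cosh t))
  rw [h1]
  nlinarith [Real.exp_pos (-(r * Real.cosh t))]

lemma K0_anti {r R : ℝ} (hr : 0 < r) (hR : r ≤ R) : K0 R ≤ K0 r := by
  unfold K0
  refine integral_mono (intOn_K0 (hr.trans_le hR)) (intOn_K0 hr) (fun t => ?_)
  simp only
  have := Real.cosh_pos t
  gcongr

lemma mul_K0_le {r : ℝ} (hr : 0 < r) : r * K0 r ≤ 2 := by
  unfold K0
  rw [← integral_const_mul]
  have h2 : ∫ t in Set.Ioi (0 : ℝ), 2 * Real.exp (-t) = 2 := by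
    rw [integral_const_mul, integral_exp_neg_Ioi_zero]; simp
  rw [← h2]
  refine integral_mono ((intOn_K0 hr).const_mul _) ((integrableOn_exp_neg_Ioi 0).const_mul 2)
    (fun t => ?_)
  simp only
  refine le_trans ?_ (cosh_inv_le t)
  have hc := Real.cosh_pos t
  rw [le_div_iff₀ hc, Real.exp_neg]
  have := Real.add_one_le_exp (r * Real.cosh t)
  have h3 := Real.exp_pos (r * Real.cosh t)
  have : r * (Real.exp (r * Real.cosh t))⁻¹ * Real.cosh t =
    (r * Real.cosh t) / Real.exp (r * Real.cosh t) := by field_simp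
  rw [this, div_le_one h3]
  linarith

lemma lint_gamma (n : ℕ) {c : ℝ} (hc : 0 < c) :
    ∫⁻ r in Set.Ioi (0 : ℝ), ENNReal.ofReal (r ^ n * Real.exp (-(r * c))) =
      ENNReal.ofReal (n.factorial / c ^ (n + 1)) := by
  have hI : IntegrableOn (fun r : ℝ => r ^ n * Real.exp (-(r * c))) (Set.Ioi 0) := by
    have h := integrableOn_rpow_mul_exp_neg_mul_rpow (p := 1) (s := n) (b := c)
      (by have : (0 : ℝ) ≤ n := n.cast_nonneg
          linarith) (by norm_num) hc
    refine h.congr_fun (fun r hr => ?_) measurableSet_Ioi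
    simp [mul_comm]
  rw [← ofReal_integral_eq_lintegral_ofReal hI]
  · congr 1
    have h := Real.integral_rpow_mul_exp_neg_mul_Ioi (a := n + 1) (r := c) (by positivity) hc
    rw [Real.Gamma_nat_eq_factorial] at h
    calc _ = ∫ (t : ℝ) in Set.Ioi 0, t ^ ((n : ℝ) + 1 - 1) * Real.exp (-(c * t)) := by
          refine setIntegral_congr_fun measurableSet_Ioi (fun r hr => ?_)
          simp [mul_comm]
      _ = _ := by
          rw [h]
          have : (1 / c) ^ ((n : ℝ) + 1) = (1 / c) ^ (n + 1) := by
            rw [← Real.rpow_natCast]; push_cast; rfl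
          rw [this, one_div, inv_pow]; field_simp
  · refine (ae_restrict_iff' measurableSet_Ioi).2 (Eventually.of_forall fun r hr => ?_)
    have : (0 : ℝ) < r := hr
    positivity

lemma lint_mom (n j : ℕ) :
    ∫⁻ r in Set.Ioi (0 : ℝ), ∫⁻ t in Set.Ioi (0 : ℝ),
      ENNReal.ofReal (r ^ n * (Real.exp (-(r * Real.cosh t)) * Real.cosh t ^ j)) =
    ∫⁻ t in Set.Ioi (0 : ℝ), ENNReal.ofReal (Real.cosh t ^ j *
      (n.factorial / Real.cosh t ^ (n + 1))) := by
  rw [lintegral_lintegral_swap]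
  · refine lintegral_congr (fun t => ?_)
    have hc := Real.cosh_pos t
    rw [ENNReal.ofReal_mul (by positivity), ← lint_gamma n hc, ← lintegral_const_mul]
    · refine lintegral_congr (fun r => ?_)
      rw [← ENNReal.ofReal_mul (by positivity)]
      congr 1; ring
    · fun_prop
  · refine Measurable.aemeasurable ?_
    unfold Function.uncurry
    fun_prop

lemma lint_K0 (n : ℕ) : ∫⁻ r in Set.Ioi (0 : ℝ), ENNReal.ofReal (r ^ n * K0 r) =
    ∫⁻ t in Set.Ioi (0 : ℝ), ENNReal.ofReal (n.factorial / Real.cosh t ^ (n + 1)) := by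
  have h := lint_mom n 0
  simp only [pow_zero, mul_one, one_mul] at h
  rw [← h]
  refine setLIntegral_congr_fun measurableSet_Ioi (fun r hr => ?_)
  have hr : 0 < r := hr
  rw [K0, ← integral_const_mul, ofReal_integral_eq_lintegral_ofReal ((intOn_K0 hr).const_mul _)]
  exact Eventually.of_forall fun t => by positivity

lemma lint_K1 : ∫⁻ r in Set.Ioi (0 : ℝ), ENNReal.ofReal (r * K1 r) =
    ∫⁻ t in Set.Ioi (0 : ℝ), ENNReal.ofReal (1 / Real.cosh t) := by
  have h := lint_mom 1 1
  have e : ∀ t : ℝ, Real.cosh t ^ 1 * ((Nat.factorial 1 : ℕ) / Real.cosh t ^ (1 + 1)) =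
      1 / Real.cosh t := fun t => by
    have := Real.cosh_pos t
    simp; field_simp
  simp only [e] at h
  rw [← h]
  refine setLIntegral_congr_fun measurableSet_Ioi (fun r hr => ?_)
  have hr : 0 < r := hr
  simp only [pow_one]
  rw [K1, ← integral_const_mul, ofReal_integral_eq_lintegral_ofReal ((intOn_K1 hr).const_mul _)]
  exact Eventually.of_forall fun t => by have := Real.cosh_pos t; positivity

lemma lint_cosh_fin : ∫⁻ t in Set.Ioi (0 : ℝ), ENNReal.ofReal (1 / Real.cosh t) < ⊤ :=
  intOn_cosh_inv.lintegral_lt_top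

lemma lint_cosh_sq : ∫⁻ t in Set.Ioi (0 : ℝ),
    ENNReal.ofReal ((Nat.factorial 1 : ℕ) / Real.cosh t ^ (1 + 1)) = 1 := by
  have hd : ∀ x ∈ Set.Ici (0 : ℝ), HasDerivAt (fun t => Real.sinh t / Real.cosh t)
      ((Nat.factorial 1 : ℕ) / Real.cosh x ^ (1 + 1)) x := fun x _ => by
    have h := (Real.hasDerivAt_sinh x).div (Real.hasDerivAt_cosh x) (Real.cosh_pos x).ne'
    have h2 := Real.cosh_sq x
    have : Real.cosh x * Real.cosh x - Real.sinh x * Real.sinh x = 1 := by nlinarith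
    rw [this] at h
    simpa [Pi.div_def] using h
  have hpos : ∀ x ∈ Set.Ioi (0 : ℝ), (0 : ℝ) ≤ (Nat.factorial 1 : ℕ) / Real.cosh x ^ (1 + 1) :=
    fun x _ => by have := Real.cosh_pos x; positivity
  have hlim : Tendsto (fun t => Real.sinh t / Real.cosh t) atTop (nhds 1) := by
    have h1 : ∀ t : ℝ, Real.sinh t / Real.cosh t = (1 - Real.exp (-t) ^ 2) /
        (1 + Real.exp (-t) ^ 2) := fun t => by
      have := Real.exp_pos t
      rw [Real.sinh_eq, Real.cosh_eq, Real.exp_neg]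
      field_simp
    simp_rw [h1]
    have h2 : Tendsto (fun t : ℝ => Real.exp (-t)) atTop (nhds 0) :=
      Real.tendsto_exp_neg_atTop_nhds_zero
    have := ((h2.pow 2).const_sub 1).div ((h2.pow 2).const_add 1) (by norm_num)
    simpa [Pi.div_def] using this
  rw [← ofReal_integral_eq_lintegral_ofReal
    (integrableOn_Ioi_deriv_of_nonneg' hd hpos hlim)
    ((ae_restrict_iff' measurableSet_Ioi).2 (Eventually.of_forall hpos)),
    integral_Ioi_of_hasDerivAt_of_nonneg' hd hpos hlim]
  simp

lemma rad_nonneg (z : ℝ × ℝ) : 0 ≤ rad z := Real.sqrt_nonneg _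

lemma rad_continuous : Continuous rad := by unfold rad; fun_prop

lemma rad_measurable : Measurable rad := rad_continuous.measurable

lemma lint_radial {F : ℝ → ENNReal} (hF : Measurable F) :
    ∫⁻ z : ℝ × ℝ, F (rad z) =
      (∫⁻ r in Set.Ioi (0 : ℝ), ENNReal.ofReal r * F r) * ENNReal.ofReal (2 * π) := by
  rw [← lintegral_comp_polarCoord_symm]
  have h1 : ∀ p ∈ polarCoord.target, ENNReal.ofReal p.1 • F (rad (polarCoord.symm p)) =
      ENNReal.ofReal p.1 * F p.1 := by
    intro p hp
    have hp1 : 0 < p.1 := by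
      rw [polarCoord_target] at hp; exact hp.1
    have : rad (polarCoord.symm p) = p.1 := by
      unfold rad
      rw [polarCoord_symm_apply]
      simp only
      rw [mul_pow, mul_pow, ← mul_add, Real.cos_sq_add_sin_sq, mul_one, Real.sqrt_sq hp1.le]
    rw [this, smul_eq_mul]
  rw [setLIntegral_congr_fun polarCoord.open_target.measurableSet h1, polarCoord_target]
  have hm : Measurable (fun p : ℝ × ℝ => ENNReal.ofReal p.1 * F p.1) := by fun_prop
  rw [Measure.volume_eq_prod, ← Measure.prod_restrict, lintegral_prod _ hm.aemeasurable]
  simp only [lintegral_const, Measure.restrict_apply_univ, Real.volume_Ioo]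
  rw [lintegral_mul_const]
  · congr 2; ring
  · fun_prop

/-- Newtonian-like convolution kernel. -/
noncomputable def hK (z : ℝ × ℝ) : ℝ := (1 / (2 * Real.pi)) * K0 (rad z)

noncomputable def kK (z : ℝ × ℝ) : ℝ := (1 / Real.pi) * K1 (rad z)

lemma hK_nonneg (z) : 0 ≤ hK z := mul_nonneg (by positivity) (K0_nonneg _)
lemma kK_nonneg (z) : 0 ≤ kK z := mul_nonneg (by positivity) (K1_nonneg _)
lemma hK_meas : Measurable hK := (K0_measurable.comp rad_measurable).const_mul _
lemma kK_meas : Measurable kK := (K1_measurable.comp rad_measurable).const_mul _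

lemma integrable_radial {f : ℝ → ℝ} (hf : Measurable f)
    (h : ∫⁻ r in Set.Ioi (0 : ℝ), ENNReal.ofReal (r * ‖f r‖) < ⊤) :
    Integrable (fun z : ℝ × ℝ => f (rad z)) := by
  refine ⟨(hf.comp rad_measurable).aestronglyMeasurable, ?_⟩
  unfold HasFiniteIntegral
  have := lint_radial (F := fun r => ‖f r‖ₑ) (by fun_prop)
  rw [this]
  refine ENNReal.mul_lt_top ?_ ENNReal.ofReal_lt_top
  refine lt_of_le_of_lt (le_of_eq ?_) h
  refine setLIntegral_congr_fun measurableSet_Ioi (fun r hr => ?_)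
  have hr : 0 < r := hr
  rw [ENNReal.ofReal_mul hr.le, ofReal_norm]

lemma lint_K0_fin (n : ℕ) : ∫⁻ r in Set.Ioi (0 : ℝ), ENNReal.ofReal (r ^ n * K0 r) < ⊤ := by
  rw [lint_K0]
  have : ∫⁻ t in Set.Ioi (0 : ℝ), ENNReal.ofReal (n.factorial * (1 / Real.cosh t)) < ⊤ :=
    (intOn_cosh_inv.const_mul _).lintegral_lt_top
  refine lt_of_le_of_lt (lintegral_mono fun t => ENNReal.ofReal_le_ofReal ?_) this
  rw [mul_one_div]
  have h1 := Real.one_le_cosh t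
  gcongr
  exact le_self_pow₀ h1 (by omega)

lemma hK_int : Integrable hK := by
  refine Integrable.const_mul (integrable_radial K0_measurable ?_) _
  simpa [abs_of_nonneg (K0_nonneg _)] using lint_K0_fin 1

lemma kK_int : Integrable kK := by
  refine Integrable.const_mul (integrable_radial K1_measurable ?_) _
  simp only [Real.norm_of_nonneg (K1_nonneg _), lint_K1]
  exact lint_cosh_fin

lemma radhK_int : Integrable (fun z => rad z * hK z) := by
  have : (fun z => rad z * hK z) = fun z => (1 / (2 * Real.pi)) * (rad z * K0 (rad z)) := by
    funext z; unfold hK; ring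
  rw [this]
  refine Integrable.const_mul (integrable_radial (f := fun r => r * K0 r)
    (measurable_id.mul K0_measurable) ?_) _
  refine lt_of_le_of_lt (le_of_eq ?_) (lint_K0_fin 2)
  refine setLIntegral_congr_fun measurableSet_Ioi (fun r hr => ?_)
  have hr : 0 < r := hr
  rw [Real.norm_of_nonneg (mul_nonneg hr.le (K0_nonneg _))]
  ring_nf

lemma hK_sq_int : Integrable (fun z => hK z ^ 2) := by
  have : (fun z => hK z ^ 2) = fun z => (1 / (2 * Real.pi)) ^ 2 * (K0 (rad z) ^ 2) := by
    funext z; unfold hK; ring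
  rw [this]
  refine Integrable.const_mul (integrable_radial (f := fun r => K0 r ^ 2)
    (K0_measurable.pow_const 2) ?_) _
  have h0 := lint_K0_fin 0
  have h2 : ∫⁻ r in Set.Ioi (0 : ℝ), 2 * ENNReal.ofReal (r ^ 0 * K0 r) < ⊤ := by
    rw [lintegral_const_mul' _ _ (by norm_num)]
    exact ENNReal.mul_lt_top (by norm_num) h0
  refine lt_of_le_of_lt (setLIntegral_mono' measurableSet_Ioi fun r hr => ?_) h2
  have hr : 0 < r := hr
  have e : (2 : ENNReal) = ENNReal.ofReal 2 := by simp
  rw [e, ← ENNReal.ofReal_mul (by norm_num)]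
  refine ENNReal.ofReal_le_ofReal ?_
  rw [Real.norm_of_nonneg (by positivity)]
  nlinarith [mul_K0_le hr, K0_nonneg r]

lemma hK_integral : ∫ z, hK z = 1 := by
  rw [integral_eq_lintegral_of_nonneg_ae (Eventually.of_forall hK_nonneg)
    hK_meas.aestronglyMeasurable]
  have h1 := lint_radial (F := fun r => ENNReal.ofReal ((1 / (2 * Real.pi)) * K0 r))
    ((K0_measurable.const_mul _).ennreal_ofReal)
  have h2 : ∫⁻ r in Set.Ioi (0 : ℝ), ENNReal.ofReal r *
      ENNReal.ofReal ((1 / (2 * Real.pi)) * K0 r) = ENNReal.ofReal (1 / (2 * Real.pi)) := by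
    have h3 := lint_K0 1
    rw [lint_cosh_sq] at h3
    rw [← mul_one (ENNReal.ofReal (1 / (2 * Real.pi))), ← h3,
      ← lintegral_const_mul' _ _ ENNReal.ofReal_ne_top]
    refine setLIntegral_congr_fun measurableSet_Ioi (fun r hr => ?_)
    have hr : 0 < r := hr
    rw [← ENNReal.ofReal_mul hr.le, ← ENNReal.ofReal_mul (by positivity)]
    congr 1; ring
  have h4 : ∫⁻ z, ENNReal.ofReal (hK z) = 1 := by
    unfold hK
    rw [h1, h2, ← ENNReal.ofReal_mul (by positivity)]
    rw [one_div, inv_mul_cancel₀ (by positivity)]; simp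
  rw [h4]; simp

open MeasureTheory Real Filter

/-! ### The half-plane kernel and the energy as a double integral -/

noncomputable abbrev PU : Measure (ℝ × ℝ) := volume.restrict UHP

lemma UHP_meas : MeasurableSet UHP := measurableSet_lt measurable_const measurable_snd

lemma ae_UHP : ∀ᵐ x ∂PU, x ∈ UHP := ae_restrict_mem UHP_meas

noncomputable def gk (x y : ℝ × ℝ) : ℝ := max (GUHP x y) 0

lemma Gker_eq (x y) : Gker x y = hK (x - y) := rfl

lemma gk_nonneg (x y) : 0 ≤ gk x y := le_max_right _ _

lemma rad_neg (z : ℝ × ℝ) : rad (-z) = rad z := by simp [rad]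

lemma hK_neg (z) : hK (-z) = hK z := by unfold hK; rw [rad_neg]
lemma kK_neg (z) : kK (-z) = kK z := by unfold kK; rw [rad_neg]

lemma GUHP_symm (x y) : GUHP x y = GUHP y x := by
  unfold GUHP Gker reflPt rad
  simp only [Prod.fst_sub, Prod.snd_sub]
  have e1 : (x.1 - y.1) ^ 2 = (y.1 - x.1) ^ 2 := by ring
  have e2 : (x.2 - y.2) ^ 2 = (y.2 - x.2) ^ 2 := by ring
  have e3 : (-x.2 - y.2) ^ 2 = (-y.2 - x.2) ^ 2 := by ring
  rw [e1, e2, e3]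

lemma gk_symm (x y) : gk x y = gk y x := by unfold gk; rw [GUHP_symm]

lemma gk_trans (x y : ℝ × ℝ) (c : ℝ) : gk (x + (c, 0)) (y + (c, 0)) = gk x y := by
  unfold gk GUHP Gker reflPt rad
  simp

lemma GUHP_trans (x y : ℝ × ℝ) (c : ℝ) : GUHP (x + (c, 0)) (y + (c, 0)) = GUHP x y := by
  unfold GUHP Gker reflPt rad
  simp

lemma gk_le_h (x y) : gk x y ≤ hK (x - y) := by
  unfold gk GUHP
  rw [Gker_eq, Gker_eq]
  exact max_le (by linarith [hK_nonneg (reflPt x - y)]) (hK_nonneg _)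

lemma GUHP_meas : Measurable (Function.uncurry GUHP) := by
  unfold GUHP Function.uncurry
  simp only [Gker_eq]
  refine Measurable.sub (hK_meas.comp (by fun_prop)) (hK_meas.comp ?_)
  unfold reflPt
  fun_prop

lemma gk_meas : Measurable (Function.uncurry gk) := GUHP_meas.max measurable_const

lemma gk_meas_right (x) : Measurable (gk x) := gk_meas.of_uncurry_left

lemma rad_pos {z : ℝ × ℝ} (h : z ≠ 0) : 0 < rad z := by
  unfold rad
  apply Real.sqrt_pos.2
  by_contra hc
  apply h
  have h1 : z.1 ^ 2 = 0 := by nlinarith [sq_nonneg z.1, sq_nonneg z.2]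
  have h2 : z.2 ^ 2 = 0 := by nlinarith [sq_nonneg z.1, sq_nonneg z.2]
  exact Prod.ext (by simpa using h1) (by simpa using h2)

lemma rad_refl_le {x y : ℝ × ℝ} (hx : x ∈ UHP) (hy : y ∈ UHP) :
    rad (x - y) ≤ rad (reflPt x - y) := by
  have hx : 0 < x.2 := hx
  have hy : 0 < y.2 := hy
  unfold rad reflPt
  apply Real.sqrt_le_sqrt
  simp only [Prod.fst_sub, Prod.snd_sub]
  nlinarith

lemma abs_snd_le_rad (z : ℝ × ℝ) : |z.2| ≤ rad z := by
  unfold rad; apply Real.abs_le_sqrt; nlinarith [sq_nonneg z.1]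

lemma abs_fst_le_rad (z : ℝ × ℝ) : |z.1| ≤ rad z := by
  unfold rad; apply Real.abs_le_sqrt; nlinarith [sq_nonneg z.2]

lemma rad_sq (z : ℝ × ℝ) : rad z ^ 2 = z.1 ^ 2 + z.2 ^ 2 := by
  unfold rad; rw [Real.sq_sqrt (by positivity)]

lemma rad_refl_sub {x y : ℝ × ℝ} (hx : x ∈ UHP) :
    rad (reflPt x - y) ≤ rad (x - y) + 2 * x.2 := by
  have hx : 0 < x.2 := hx
  refine abs_le_of_sq_le_sq' ?_ (by have := rad_nonneg (x - y); positivity) |>.2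
  have h1 := rad_sq (reflPt x - y)
  have h2 := rad_sq (x - y)
  have h3 := (abs_le.1 (abs_snd_le_rad (x - y))).1
  simp only [reflPt, Prod.fst_sub, Prod.snd_sub] at h1 h2 h3
  simp only [reflPt]
  nlinarith

lemma gk_eq {x y : ℝ × ℝ} (hx : x ∈ UHP) (hy : y ∈ UHP) (h : x ≠ y) : gk x y = GUHP x y := by
  unfold gk GUHP Gker
  apply max_eq_left
  have := K0_anti (rad_pos (sub_ne_zero.2 h)) (rad_refl_le hx hy)
  rw [← mul_sub]
  exact mul_nonneg (by positivity) (by linarith)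

lemma gk_le_k {x y : ℝ × ℝ} (hx : x ∈ UHP) (hy : y ∈ UHP) : gk x y ≤ x.2 * kK (x - y) := by
  have hx2 : 0 < x.2 := hx
  unfold gk
  refine max_le ?_ (mul_nonneg hx2.le (kK_nonneg _))
  by_cases h : x = y
  · subst h
    have : GUHP x x ≤ 0 := by
      unfold GUHP
      have h0 : Gker x x = 0 := by
        unfold Gker K0 rad
        simp [Measure.real]
      rw [h0, Gker_eq]
      linarith [hK_nonneg (reflPt x - x)]
    exact this.trans (mul_nonneg hx2.le (kK_nonneg _))
  · unfold GUHP Gker kK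
    have h1 := K0_sub_le (rad_pos (sub_ne_zero.2 h)) (rad_refl_le hx hy)
    have h2 := rad_refl_sub (y := y) hx
    have h3 := K1_nonneg (rad (x - y))
    have h4 : K0 (rad (x - y)) - K0 (rad (reflPt x - y)) ≤ 2 * x.2 * K1 (rad (x - y)) :=
      h1.trans (mul_le_mul_of_nonneg_right (by linarith) h3)
    rw [← mul_sub]
    calc _ ≤ 1 / (2 * π) * (2 * x.2 * K1 (rad (x - y))) := by gcongr
      _ = _ := by field_simp

structure Adm (ω : ℝ × ℝ → ℝ) : Prop where
  nn : ∀ x ∈ UHP, 0 ≤ ω x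
  i1 : Integrable ω PU
  i2 : Integrable (fun x => ω x ^ 2) PU
  ix : Integrable (fun x => x.2 * ω x) PU

lemma Adm.nnae {ω} (h : Adm ω) : ∀ᵐ x ∂PU, 0 ≤ ω x := ae_UHP.mono h.nn

lemma Adm.memLp {ω} (h : Adm ω) : MemLp ω 2 PU :=
  (memLp_two_iff_integrable_sq h.i1.aestronglyMeasurable).2 h.i2

noncomputable def N2 (ω : ℝ × ℝ → ℝ) : ℝ := ∫ x, ω x ^ 2 ∂PU

lemma N2_nonneg (ω) : 0 ≤ N2 ω := integral_nonneg fun _ => sq_nonneg _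

noncomputable def Gg (ω : ℝ × ℝ → ℝ) (x : ℝ × ℝ) : ℝ := ∫ y, gk x y * ω y ∂PU

noncomputable def Mh : ℝ := Real.sqrt (∫ z, hK z ^ 2)

noncomputable def kap : ℝ := ∫ z, kK z

lemma kap_nonneg : 0 ≤ kap := integral_nonneg kK_nonneg
lemma Mh_nonneg : 0 ≤ Mh := Real.sqrt_nonneg _

lemma gk_sq_int (x) : Integrable (fun y => gk x y ^ 2) PU := by
  have h : Integrable (fun y => hK (x - y) ^ 2) := hK_sq_int.comp_sub_left x
  refine Integrable.mono' h.restrict ((gk_meas_right x).pow_const 2).aestronglyMeasurable ?_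
  refine Eventually.of_forall fun y => ?_
  rw [Real.norm_of_nonneg (by positivity)]
  have := gk_nonneg x y
  gcongr
  exact gk_le_h x y

lemma gk_memLp (x) : MemLp (gk x) 2 PU :=
  (memLp_two_iff_integrable_sq (gk_meas_right x).aestronglyMeasurable).2 (gk_sq_int x)

lemma gk_sq_le (x) : ∫ y, gk x y ^ 2 ∂PU ≤ ∫ z, hK z ^ 2 := by
  have h : Integrable (fun y => hK (x - y) ^ 2) := hK_sq_int.comp_sub_left x
  calc ∫ y, gk x y ^ 2 ∂PU ≤ ∫ y, hK (x - y) ^ 2 ∂PU := by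
        refine integral_mono (gk_sq_int x) h.restrict fun y => ?_
        have := gk_nonneg x y
        simp only
        gcongr
        exact gk_le_h x y
    _ ≤ ∫ y, hK (x - y) ^ 2 :=
        setIntegral_le_integral h (Eventually.of_forall fun _ => sq_nonneg _)
    _ = _ := integral_sub_left_eq_self (fun z => hK z ^ 2) volume x

lemma cauchy_schwarz {μ : Measure (ℝ × ℝ)} {f g : ℝ × ℝ → ℝ} (hf : MemLp f 2 μ) (hg : MemLp g 2 μ) :
    |∫ x, f x * g x ∂μ| ≤ Real.sqrt (∫ x, f x ^ 2 ∂μ) * Real.sqrt (∫ x, g x ^ 2 ∂μ) := by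
  have hi : Integrable (fun x => ‖f x‖ * ‖g x‖) μ := hf.norm.integrable_mul hg.norm
  have h := integral_mul_le_Lp_mul_Lq_of_nonneg (μ := μ) (f := fun x => ‖f x‖)
    (g := fun x => ‖g x‖) (p := 2) (q := 2) Real.HolderConjugate.two_two
    (Eventually.of_forall fun _ => norm_nonneg _) (Eventually.of_forall fun _ => norm_nonneg _)
    (by simpa using hf.norm) (by simpa using hg.norm)
  calc |∫ x, f x * g x ∂μ| ≤ ∫ x, ‖f x * g x‖ ∂μ :=
        norm_integral_le_integral_norm (fun x => f x * g x)
    _ = ∫ x, ‖f x‖ * ‖g x‖ ∂μ := by simp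
    _ ≤ _ := h
    _ = _ := by simp [Real.sqrt_eq_rpow]

lemma Gg_integrand {ω} (hω : MemLp ω 2 PU) (x) : Integrable (fun y => gk x y * ω y) PU :=
  (gk_memLp x).integrable_mul hω

lemma Gg_bound {ω} (hω : MemLp ω 2 PU) (x) : |Gg ω x| ≤ Mh * Real.sqrt (N2 ω) := by
  refine (cauchy_schwarz (gk_memLp x) hω).trans ?_
  unfold Mh N2
  gcongr
  exact gk_sq_le x

lemma Gg_nonneg {ω} (h : Adm ω) (x) : 0 ≤ Gg ω x :=
  integral_nonneg_of_ae (h.nnae.mono fun y hy => mul_nonneg (gk_nonneg x y) hy)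

lemma Gg_congr {ω ω'} (h : ω =ᵐ[PU] ω') : Gg ω = Gg ω' := by
  funext x
  exact integral_congr_ae (h.mono fun y hy => by simp only [hy])

lemma Gg_meas {ω} (h : AEStronglyMeasurable ω PU) : Measurable (Gg ω) := by
  rw [Gg_congr h.ae_eq_mk]
  have : StronglyMeasurable (Function.uncurry fun x y => gk x y * h.mk ω y) := by
    have h2 : StronglyMeasurable (fun p : (ℝ × ℝ) × (ℝ × ℝ) => h.mk ω p.2) :=
      h.stronglyMeasurable_mk.comp_measurable measurable_snd
    exact gk_meas.stronglyMeasurable.mul h2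
  exact this.integral_prod_right.measurable

lemma Gop_eq {ω} {x} (hx : x ∈ UHP) : Gop ω x = Gg ω x := by
  unfold Gop Gg
  refine integral_congr_ae ?_
  have h2 : ∀ᵐ y ∂PU, y ≠ x := by
    refine ae_restrict_of_ae ?_
    exact (measure_eq_zero_iff_ae_notMem.1 (measure_singleton x)).mono fun y hy => by simpa using hy
  filter_upwards [ae_UHP, h2] with y hy hne
  rw [gk_eq hx hy (Ne.symm hne)]

/-- integrability for convolution-dominated kernels. -/
lemma conv_int {k : ℝ × ℝ → ℝ} (hk : Integrable k) {f : ℝ × ℝ → ℝ} (hf : Integrable f PU) :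
    Integrable (fun p : (ℝ × ℝ) × (ℝ × ℝ) => k (p.1 - p.2) * f p.2) (PU.prod PU) := by
  have h := hf.convolution_integrand (μ := (volume : Measure (ℝ × ℝ)))
    (ContinuousLinearMap.mul ℝ ℝ) hk
  have h2 : PU.prod PU ≤ (volume : Measure (ℝ × ℝ)).prod PU := by
    have : PU.prod PU = ((volume : Measure (ℝ × ℝ)).prod PU).restrict (UHP ×ˢ Set.univ) := by
      rw [← Measure.prod_restrict, Measure.restrict_univ]
    rw [this]; exact Measure.restrict_le_self
  refine (h.mono_measure h2).congr (Eventually.of_forall fun p => ?_)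
  simp [mul_comm]

lemma conv_le {k : ℝ × ℝ → ℝ} (hk : Integrable k) (hk0 : ∀ z, 0 ≤ k z) {f : ℝ × ℝ → ℝ}
    (hf : Integrable f PU) (hf0 : ∀ y, 0 ≤ f y) :
    ∫ p : (ℝ × ℝ) × (ℝ × ℝ), k (p.1 - p.2) * f p.2 ∂(PU.prod PU) ≤ (∫ z, k z) * ∫ y, f y ∂PU := by
  rw [integral_prod_symm _ (conv_int hk hf), ← integral_const_mul]
  refine integral_mono_of_nonneg (Eventually.of_forall fun y =>
    integral_nonneg fun x => mul_nonneg (hk0 _) (hf0 _)) (hf.const_mul _)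
    (Eventually.of_forall fun y => ?_)
  simp only
  rw [integral_mul_const]
  refine mul_le_mul_of_nonneg_right ?_ (hf0 y)
  calc ∫ x, k (x - y) ∂PU ≤ ∫ x, k (x - y) :=
        setIntegral_le_integral (hk.comp_sub_right y) (Eventually.of_forall fun _ => hk0 _)
    _ = _ := integral_sub_right_eq_self k y

section schur
variable {k : ℝ × ℝ → ℝ} (hkm : Measurable k) (hk : Integrable k) (hk0 : ∀ z, 0 ≤ k z)
  (hkn : ∀ z, k (-z) = k z) {ω : ℝ × ℝ → ℝ} (h : MemLp ω 2 PU)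

lemma schur_dom (hk : Integrable k) (hkn : ∀ z, k (-z) = k z) (h : MemLp ω 2 PU) :
    Integrable (fun p : (ℝ × ℝ) × (ℝ × ℝ) =>
    k (p.1 - p.2) * ((ω p.1 ^ 2 + ω p.2 ^ 2) / 2)) (PU.prod PU) := by
  have h1 := conv_int hk h.integrable_sq
  have h2 := h1.swap
  refine ((h1.add h2).div_const 2).congr (Eventually.of_forall fun p => ?_)
  simp only [Pi.add_apply, Function.comp, Prod.fst_swap, Prod.snd_swap]
  rw [← hkn (p.1 - p.2), neg_sub]; ring

lemma schur_int (hkm : Measurable k) (hk : Integrable k) (hk0 : ∀ z, 0 ≤ k z)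
    (hkn : ∀ z, k (-z) = k z) (h : MemLp ω 2 PU) :
    Integrable (fun p : (ℝ × ℝ) × (ℝ × ℝ) => k (p.1 - p.2) * (ω p.1 * ω p.2)) (PU.prod PU) := by
  refine Integrable.mono' (schur_dom hk hkn h) ?_ (Eventually.of_forall fun p => ?_)
  · refine AEStronglyMeasurable.mul ?_ ?_
    · exact (hkm.comp (by fun_prop : Measurable fun p : (ℝ × ℝ) × (ℝ × ℝ) => p.1 - p.2)).aestronglyMeasurable
    · exact AEStronglyMeasurable.mul (h.1.comp_fst (ν := PU)) (h.1.comp_snd (μ := PU))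
  · rw [norm_mul, Real.norm_of_nonneg (hk0 _), Real.norm_eq_abs, abs_mul]
    refine mul_le_mul_of_nonneg_left ?_ (hk0 _)
    nlinarith [sq_nonneg (|ω p.1| - |ω p.2|), sq_abs (ω p.1), sq_abs (ω p.2)]

lemma schur_le (hkm : Measurable k) (hk : Integrable k) (hk0 : ∀ z, 0 ≤ k z)
    (hkn : ∀ z, k (-z) = k z) (h : MemLp ω 2 PU) :
    ∫ p : (ℝ × ℝ) × (ℝ × ℝ), k (p.1 - p.2) * (ω p.1 * ω p.2) ∂(PU.prod PU) ≤
      (∫ z, k z) * N2 ω := by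
  have h1 := conv_int hk h.integrable_sq
  have h2 := h1.swap
  have e : (fun p : (ℝ × ℝ) × (ℝ × ℝ) => k (p.1 - p.2) * ω p.2 ^ 2) ∘ Prod.swap =
      fun p : (ℝ × ℝ) × (ℝ × ℝ) => k (p.1 - p.2) * ω p.1 ^ 2 := by
    funext p
    simp only [Function.comp, Prod.fst_swap, Prod.snd_swap]
    rw [← hkn (p.1 - p.2), neg_sub]
  have h3 : ∫ p : (ℝ × ℝ) × (ℝ × ℝ), k (p.1 - p.2) * ω p.1 ^ 2 ∂(PU.prod PU) =
      ∫ p : (ℝ × ℝ) × (ℝ × ℝ), k (p.1 - p.2) * ω p.2 ^ 2 ∂(PU.prod PU) := by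
    rw [← e]
    exact integral_prod_swap (fun p : (ℝ × ℝ) × (ℝ × ℝ) => k (p.1 - p.2) * ω p.2 ^ 2)
  have h4 := conv_le hk hk0 h.integrable_sq (fun _ => sq_nonneg _)
  rw [e] at h2
  calc _ ≤ ∫ p : (ℝ × ℝ) × (ℝ × ℝ), ((k (p.1 - p.2) * ω p.1 ^ 2) +
        k (p.1 - p.2) * ω p.2 ^ 2) / 2 ∂(PU.prod PU) := by
        refine integral_mono (schur_int hkm hk hk0 hkn h) ((h2.add h1).div_const 2) fun p => ?_
        simp only
        have := hk0 (p.1 - p.2)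
        nlinarith [mul_nonneg this (sq_nonneg (ω p.1 - ω p.2))]
    _ = _ := by
        rw [integral_div, integral_add h2 h1, h3, add_self_div_two]
    _ ≤ _ := h4
end schur

/-- energy density on the product -/
noncomputable def eD (ω : ℝ × ℝ → ℝ) (p : (ℝ × ℝ) × (ℝ × ℝ)) : ℝ := gk p.1 p.2 * (ω p.1 * ω p.2)

lemma ae_UHP2 : ∀ᵐ p ∂(PU.prod PU), p.1 ∈ UHP ∧ p.2 ∈ UHP := by
  have : PU.prod PU = ((volume : Measure (ℝ × ℝ)).prod volume).restrict (UHP ×ˢ UHP) := by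
    rw [← Measure.prod_restrict]
  rw [this]
  exact ae_restrict_mem (UHP_meas.prod UHP_meas)

lemma eD_nonneg {ω} (h : Adm ω) : ∀ᵐ p ∂(PU.prod PU), 0 ≤ eD ω p :=
  ae_UHP2.mono fun p hp => mul_nonneg (gk_nonneg _ _) (mul_nonneg (h.nn _ hp.1) (h.nn _ hp.2))

lemma eD_int {ω} (h : MemLp ω 2 PU) : Integrable (eD ω) (PU.prod PU) := by
  refine Integrable.mono (schur_int hK_meas hK_int hK_nonneg hK_neg h) ?_
    (Eventually.of_forall fun p => ?_)
  · refine AEStronglyMeasurable.mul ?_ ?_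
    · exact gk_meas.aestronglyMeasurable
    · exact AEStronglyMeasurable.mul (h.1.comp_fst (ν := PU)) (h.1.comp_snd (μ := PU))
  · unfold eD
    rw [norm_mul (gk _ _), norm_mul (hK _)]
    refine mul_le_mul_of_nonneg_right ?_ (norm_nonneg (ω p.1 * ω p.2))
    rw [Real.norm_of_nonneg (gk_nonneg _ _), Real.norm_of_nonneg (hK_nonneg _)]
    exact gk_le_h _ _

lemma eD_fst {ω} (x) : ∫ y, eD ω (x, y) ∂PU = ω x * Gg ω x := by
  unfold Gg eD
  rw [← integral_const_mul]
  exact integral_congr_ae (Eventually.of_forall fun y => by simp only; ring)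

lemma wG_int {ω} (h : MemLp ω 2 PU) : Integrable (fun x => ω x * Gg ω x) PU := by
  have := (eD_int h).integral_prod_left
  simpa only [eD_fst] using this

lemma kin_eq {ω} (h : MemLp ω 2 PU) : 2 * kineticE ω = ∫ p, eD ω p ∂(PU.prod PU) := by
  rw [integral_prod _ (eD_int h)]
  simp only [eD_fst]
  unfold kineticE
  rw [← mul_assoc]
  norm_num
  exact integral_congr_ae (ae_UHP.mono fun x hx => by simp only [Gop_eq hx])

lemma kin_eq' {ω} : 2 * kineticE ω = ∫ x, ω x * Gg ω x ∂PU := by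
  unfold kineticE
  rw [← mul_assoc]
  norm_num
  exact integral_congr_ae (ae_UHP.mono fun x hx => by simp only [Gop_eq hx])

lemma eD_swap {ω} (p) : eD ω p.swap = eD ω p := by
  unfold eD; simp only [Prod.fst_swap, Prod.snd_swap]; rw [gk_symm]; ring

lemma set_wG {ω} (h : MemLp ω 2 PU) {A : Set (ℝ × ℝ)} (hA : MeasurableSet A) :
    ∫ p, (Prod.fst ⁻¹' A).indicator (eD ω) p ∂(PU.prod PU) = ∫ x in A, ω x * Gg ω x ∂PU := by
  rw [integral_prod _ ((eD_int h).indicator (measurable_fst hA)), ← integral_indicator hA]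
  refine integral_congr_ae (Eventually.of_forall fun x => ?_)
  by_cases hx : x ∈ A
  · simp only [Set.indicator_of_mem hx]
    rw [← eD_fst]
    refine integral_congr_ae (Eventually.of_forall fun y => ?_)
    simp [hx]
  · simp [Set.indicator, hx]

/-- dominating density -/
lemma exists_F {ω} (h : Adm ω) : ∃ F : ℝ × ℝ → ℝ, Integrable F PU ∧ (∀ᵐ x ∂PU, 0 ≤ F x) ∧
    ∫ x, F x ∂PU ≤ kap * N2 ω ∧ ∀ᵐ x ∂PU, ω x * Gg ω x ≤ x.2 * F x := by
  have hi := schur_int kK_meas kK_int kK_nonneg kK_neg h.memLp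
  refine ⟨fun x => ∫ y, kK (x - y) * (ω x * ω y) ∂PU, hi.integral_prod_left, ?_, ?_, ?_⟩
  · filter_upwards [h.nnae] with x hx
    refine integral_nonneg_of_ae (h.nnae.mono fun y hy => ?_)
    exact mul_nonneg (kK_nonneg _) (mul_nonneg hx hy)
  · have := schur_le kK_meas kK_int kK_nonneg kK_neg h.memLp
    rwa [integral_prod _ hi] at this
  · filter_upwards [ae_UHP, hi.prod_right_ae, (eD_int h.memLp).prod_right_ae] with x hx hix hex
    rw [← eD_fst, ← integral_const_mul]
    refine integral_mono_ae hex (hix.const_mul _) ?_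
    filter_upwards [ae_UHP] with y hy
    simp only [eD]
    rw [← mul_assoc x.2]
    exact mul_le_mul_of_nonneg_right (gk_le_k hx hy) (mul_nonneg (h.nn _ hx) (h.nn _ hy))

lemma tail_bound {ω} (h : Adm ω) {A : Set (ℝ × ℝ)} (hA : MeasurableSet A) {δ : ℝ} (hδ : 0 < δ) :
    ∫ x in A, ω x * Gg ω x ∂PU ≤ δ * (kap * N2 ω) +
      Mh * Real.sqrt (N2 ω) / δ * ∫ x in A, x.2 * ω x ∂PU := by
  obtain ⟨F, hF, hF0, hF1, hF2⟩ := exists_F h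
  calc ∫ x in A, ω x * Gg ω x ∂PU ≤ ∫ x in A, (δ * F x + Mh * Real.sqrt (N2 ω) / δ *
        (x.2 * ω x)) ∂PU := by
        refine integral_mono_ae (wG_int h.memLp).integrableOn
          ((hF.const_mul _).add (h.ix.const_mul _)).integrableOn (ae_restrict_of_ae ?_)
        filter_upwards [ae_UHP, hF0, hF2] with x hx h0 h2
        have hx2 : 0 < x.2 := hx
        have hw := h.nn x hx
        have hM := (abs_le.1 (Gg_bound h.memLp x)).2
        have hMN : 0 ≤ Mh * Real.sqrt (N2 ω) := mul_nonneg Mh_nonneg (Real.sqrt_nonneg _)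
        by_cases hc : x.2 ≤ δ
        · have : 0 ≤ Mh * Real.sqrt (N2 ω) / δ * (x.2 * ω x) := by positivity
          nlinarith
        · push Not at hc
          have h3 : ω x * Gg ω x ≤ Mh * Real.sqrt (N2 ω) / δ * (x.2 * ω x) := by
            calc ω x * Gg ω x ≤ ω x * (Mh * Real.sqrt (N2 ω)) := by gcongr
              _ = Mh * Real.sqrt (N2 ω) / δ * (δ * ω x) := by field_simp
              _ ≤ _ := by gcongr
          nlinarith
    _ = δ * ∫ x in A, F x ∂PU + Mh * Real.sqrt (N2 ω) / δ * ∫ x in A, x.2 * ω x ∂PU := by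
        rw [integral_add (hF.const_mul _).integrableOn (h.ix.const_mul _).integrableOn,
          integral_const_mul, integral_const_mul]
    _ ≤ _ := by
        have : ∫ x in A, F x ∂PU ≤ kap * N2 ω :=
          (setIntegral_le_integral hF hF0).trans hF1
        gcongr

lemma Adm.indicator {ω} (h : Adm ω) {A : Set (ℝ × ℝ)} (hA : MeasurableSet A) :
    Adm (A.indicator ω) where
  nn := fun x hx => by
    by_cases hxA : x ∈ A <;> simp [hxA, h.nn x hx]
  i1 := h.i1.indicator hA
  i2 := by
    refine (h.i2.indicator hA).congr (Eventually.of_forall fun x => ?_)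
    by_cases hx : x ∈ A <;> simp [hx]
  ix := by
    refine (h.ix.indicator hA).congr (Eventually.of_forall fun x => ?_)
    by_cases hx : x ∈ A <;> simp [hx]

lemma Adm.smul {ω} (h : Adm ω) {c : ℝ} (hc : 0 ≤ c) : Adm (fun x => c * ω x) where
  nn := fun x hx => mul_nonneg hc (h.nn x hx)
  i1 := h.i1.const_mul c
  i2 := by
    refine (h.i2.const_mul (c ^ 2)).congr (Eventually.of_forall fun x => ?_)
    simp only; ring
  ix := by
    refine (h.ix.const_mul c).congr (Eventually.of_forall fun x => ?_)
    simp only; ring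

lemma impulse_eq (ω) : impulse ω = ∫ x, x.2 * ω x ∂PU := rfl

lemma impulse_nonneg {ω} (h : Adm ω) : 0 ≤ impulse ω :=
  integral_nonneg_of_ae (ae_UHP.mono fun x hx => mul_nonneg (le_of_lt hx) (h.nn x hx))

lemma impulse_indicator {ω : ℝ × ℝ → ℝ} {A : Set (ℝ × ℝ)} (hA : MeasurableSet A) :
    impulse (A.indicator ω) = ∫ x in A, x.2 * ω x ∂PU := by
  rw [impulse_eq, ← integral_indicator hA]
  congr 1; funext x
  by_cases hx : x ∈ A <;> simp [hx]

lemma N2_indicator {ω : ℝ × ℝ → ℝ} {A : Set (ℝ × ℝ)} (hA : MeasurableSet A) :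
    N2 (A.indicator ω) = ∫ x in A, ω x ^ 2 ∂PU := by
  rw [N2, ← integral_indicator hA]
  congr 1; funext x
  by_cases hx : x ∈ A <;> simp [hx]

lemma impulse_split {ω} (h : Adm ω) {A : Set (ℝ × ℝ)} (hA : MeasurableSet A) :
    impulse (A.indicator ω) + impulse (Aᶜ.indicator ω) = impulse ω := by
  rw [impulse_indicator hA, impulse_indicator hA.compl]
  exact integral_add_compl hA h.ix

lemma N2_split {ω} (h : Adm ω) {A : Set (ℝ × ℝ)} (hA : MeasurableSet A) :
    N2 (A.indicator ω) + N2 (Aᶜ.indicator ω) = N2 ω := by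
  rw [N2_indicator hA, N2_indicator hA.compl]
  exact integral_add_compl hA h.i2

lemma Efun_eq (lam ω) : Efun lam ω = kineticE ω - (1 / (2 * lam)) * N2 ω := rfl

lemma impulse_mono_set {ω} (h : Adm ω) {A B : Set (ℝ × ℝ)} (hA : MeasurableSet A)
    (hB : MeasurableSet B) (hAB : A ⊆ B) :
    impulse (A.indicator ω) ≤ impulse (B.indicator ω) := by
  rw [impulse_indicator hA, impulse_indicator hB]
  refine setIntegral_mono_set h.ix.integrableOn (ae_restrict_of_ae ?_) (Eventually.of_forall hAB)
  exact ae_UHP.mono fun x hx => mul_nonneg (le_of_lt hx) (h.nn x hx)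

lemma eD_indicator {ω : ℝ × ℝ → ℝ} {A : Set (ℝ × ℝ)} (p) :
    eD (A.indicator ω) p = (A ×ˢ A).indicator (eD ω) p := by
  unfold eD
  by_cases h1 : p.1 ∈ A <;> by_cases h2 : p.2 ∈ A <;> simp [h1, h2, Set.indicator, Set.mem_prod]

lemma kin_cut {ω} (h : Adm ω) {A : Set (ℝ × ℝ)} (hA : MeasurableSet A) :
    kineticE ω ≤ kineticE (A.indicator ω) + ∫ x in Aᶜ, ω x * Gg ω x ∂PU := by
  have hi := eD_int h.memLp
  have hi1 := hi.indicator (measurable_fst hA.compl)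
  have hi2 := hi.indicator (measurable_snd hA.compl)
  have hiA := eD_int (h.indicator hA).memLp
  have hi12 : Integrable (fun p => (Prod.fst ⁻¹' Aᶜ).indicator (eD ω) p +
    (Prod.snd ⁻¹' Aᶜ).indicator (eD ω) p) (PU.prod PU) := hi1.add hi2
  have e1 := set_wG h.memLp hA.compl
  have e2 : ∫ p, (Prod.snd ⁻¹' Aᶜ).indicator (eD ω) p ∂(PU.prod PU) =
      ∫ p, (Prod.fst ⁻¹' Aᶜ).indicator (eD ω) p ∂(PU.prod PU) := by
    rw [← integral_prod_swap]
    congr 1; funext p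
    by_cases hp : p.1 ∈ A <;> simp [Set.indicator, hp, eD_swap]
  have key : ∫ p, eD ω p ∂(PU.prod PU) ≤ ∫ p, (eD (A.indicator ω) p +
      ((Prod.fst ⁻¹' Aᶜ).indicator (eD ω) p + (Prod.snd ⁻¹' Aᶜ).indicator (eD ω) p))
      ∂(PU.prod PU) := by
    refine integral_mono_ae hi (hiA.add (hi1.add hi2)) ?_
    filter_upwards [eD_nonneg h] with p hp
    simp only [eD_indicator]
    by_cases h1 : p.1 ∈ A <;> by_cases h2 : p.2 ∈ A <;>
      simp [h1, h2, Set.indicator, Set.mem_prod, hp]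
  rw [integral_add hiA hi12, integral_add hi1 hi2, e2, e1, ← kin_eq h.memLp,
    ← kin_eq (h.indicator hA).memLp] at key
  linarith

lemma kin_cutX {ω} (h : Adm ω) {A : Set (ℝ × ℝ)} (hA : MeasurableSet A) :
    kineticE ω ≤ kineticE (A.indicator ω) + kineticE (Aᶜ.indicator ω) +
      ∫ p, (A ×ˢ Aᶜ).indicator (eD ω) p ∂(PU.prod PU) := by
  have hi := eD_int h.memLp
  have hi1 := hi.indicator (hA.prod hA.compl)
  have hi2 := hi.indicator (hA.compl.prod hA)
  have hiA := eD_int (h.indicator hA).memLp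
  have hiB := eD_int (h.indicator hA.compl).memLp
  have hi12 : Integrable (fun p => (A ×ˢ Aᶜ).indicator (eD ω) p +
    (Aᶜ ×ˢ A).indicator (eD ω) p) (PU.prod PU) := hi1.add hi2
  have hiAB : Integrable (fun p => eD (A.indicator ω) p + eD (Aᶜ.indicator ω) p)
    (PU.prod PU) := hiA.add hiB
  have e2 : ∫ p, (Aᶜ ×ˢ A).indicator (eD ω) p ∂(PU.prod PU) =
      ∫ p, (A ×ˢ Aᶜ).indicator (eD ω) p ∂(PU.prod PU) := by
    rw [← integral_prod_swap]
    congr 1; funext p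
    by_cases hp : p.1 ∈ A <;> by_cases hp2 : p.2 ∈ A <;>
      simp [Set.indicator, hp, hp2, eD_swap, Set.mem_prod]
  have key : ∫ p, eD ω p ∂(PU.prod PU) ≤ ∫ p, ((eD (A.indicator ω) p + eD (Aᶜ.indicator ω) p) +
      ((A ×ˢ Aᶜ).indicator (eD ω) p + (Aᶜ ×ˢ A).indicator (eD ω) p))
      ∂(PU.prod PU) := by
    refine integral_mono_ae hi ((hiA.add hiB).add (hi1.add hi2)) ?_
    filter_upwards [eD_nonneg h] with p hp
    simp only [eD_indicator]
    by_cases h1 : p.1 ∈ A <;> by_cases h2 : p.2 ∈ A <;>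
      simp [h1, h2, Set.indicator, Set.mem_prod]
  rw [integral_add hiAB hi12, integral_add hi1 hi2, integral_add hiA hiB, e2,
    ← kin_eq h.memLp,
    ← kin_eq (h.indicator hA).memLp, ← kin_eq (h.indicator hA.compl).memLp] at key
  linarith

open MeasureTheory Real Filter

/-! ### A priori bounds, truncation and positivity of the supremum -/

lemma kin_smul (ω : ℝ × ℝ → ℝ) (c : ℝ) : kineticE (fun x => c * ω x) = c ^ 2 * kineticE ω := by
  have h1 : ∀ x, Gop (fun x => c * ω x) x = c * Gop ω x := fun x => by
    unfold Gop
    rw [← integral_const_mul]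
    congr 1; funext y; ring
  unfold kineticE
  simp_rw [h1]
  have : ∀ x, c * ω x * (c * Gop ω x) = c ^ 2 * (ω x * Gop ω x) := fun x => by ring
  simp_rw [this]
  rw [integral_const_mul]; ring

lemma N2_smul (ω : ℝ × ℝ → ℝ) (c : ℝ) : N2 (fun x => c * ω x) = c ^ 2 * N2 ω := by
  unfold N2
  rw [← integral_const_mul]
  congr 1; funext y; ring

lemma impulse_smul (ω : ℝ × ℝ → ℝ) (c : ℝ) : impulse (fun x => c * ω x) = c * impulse ω := by
  rw [impulse_eq, impulse_eq, ← integral_const_mul]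
  congr 1; funext y; ring

lemma Efun_smul (lam : ℝ) (ω : ℝ × ℝ → ℝ) (c : ℝ) :
    Efun lam (fun x => c * ω x) = c ^ 2 * Efun lam ω := by
  rw [Efun_eq, Efun_eq, kin_smul, N2_smul]; ring

lemma apriori {lam : ℝ} (hlam : 1 < lam) : ∃ C : ℝ, 0 < C ∧ ∀ ω, Adm ω →
    Efun lam ω ≤ C * impulse ω ^ 2 - N2 ω / (8 * lam) := by
  set δ : ℝ := 1 / (2 * lam * (kap + 1)) with hδd
  have hk := kap_nonneg
  have hδ : 0 < δ := by positivity
  set C1 := Mh / (2 * δ) with hC1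
  refine ⟨2 * lam * C1 ^ 2 + 1, by positivity, fun ω h => ?_⟩
  have h1 := tail_bound h MeasurableSet.univ hδ
  rw [Measure.restrict_univ, ← kin_eq', ← impulse_eq] at h1
  set N := Real.sqrt (N2 ω) with hN
  have hN2 : N2 ω = N ^ 2 := (Real.sq_sqrt (N2_nonneg ω)).symm
  have hI := impulse_nonneg h
  set I := impulse ω
  have h2 : δ * (kap * N2 ω) ≤ N2 ω / (2 * lam) := by
    have : δ * kap ≤ 1 / (2 * lam) := by
      rw [hδd, div_mul_eq_mul_div, one_mul, div_le_div_iff₀ (by positivity) (by positivity)]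
      nlinarith
    have h3 := N2_nonneg ω
    calc δ * (kap * N2 ω) = (δ * kap) * N2 ω := by ring
      _ ≤ 1 / (2 * lam) * N2 ω := by gcongr
      _ = _ := by ring
  have h3 : Mh * N / δ * I = 2 * (C1 * N * I) := by rw [hC1]; field_simp
  have h4 : C1 * N * I ≤ N ^ 2 / (8 * lam) + 2 * lam * C1 ^ 2 * I ^ 2 := by
    have : N ^ 2 / (8 * lam) + 2 * lam * C1 ^ 2 * I ^ 2 - C1 * N * I =
      2 * lam * (N / (4 * lam) - C1 * I) ^ 2 := by field_simp; ring
    have h5 : 0 ≤ 2 * lam * (N / (4 * lam) - C1 * I) ^ 2 := by positivity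
    linarith
  rw [Efun_eq]
  have e1 : N2 ω / (2 * lam) = 4 * (N ^ 2 / (8 * lam)) := by rw [hN2]; field_simp; ring
  have e2 : 1 / (2 * lam) * N2 ω = 4 * (N ^ 2 / (8 * lam)) := by rw [hN2]; field_simp; ring
  rw [e2, hN2]
  rw [e1] at h2
  nlinarith [sq_nonneg I]

lemma Efun_cut {lam : ℝ} (hlam : 1 < lam) {ω} (h : Adm ω) {A : Set (ℝ × ℝ)}
    (hA : MeasurableSet A) :
    Efun lam ω ≤ Efun lam (A.indicator ω) + ∫ x in Aᶜ, ω x * Gg ω x ∂PU := by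
  rw [Efun_eq, Efun_eq]
  have h1 := kin_cut h hA
  have h2 := N2_split h hA
  have h3 := N2_nonneg (Aᶜ.indicator ω)
  have h4 : 1 / (2 * lam) * N2 (A.indicator ω) ≤ 1 / (2 * lam) * N2 ω := by
    gcongr; linarith
  linarith

lemma Efun_cutX {lam : ℝ} {ω} (h : Adm ω) {A : Set (ℝ × ℝ)}
    (hA : MeasurableSet A) :
    Efun lam ω ≤ Efun lam (A.indicator ω) + Efun lam (Aᶜ.indicator ω) +
      ∫ p, (A ×ˢ Aᶜ).indicator (eD ω) p ∂(PU.prod PU) := by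
  rw [Efun_eq, Efun_eq, Efun_eq, ← N2_split h hA]
  have h1 := kin_cutX h hA
  linarith

lemma Adm.inAdm {ω} (h : Adm ω) {μ ν} (h1 : impulse ω = μ) (h2 : ∫ x in UHP, ω x ≤ ν) :
    InAdm μ ν ω := ⟨h.nn, h.i1, h.i2, h.ix, h1, h2⟩

lemma InAdm.adm {ω μ ν} (h : InAdm μ ν ω) : Adm ω := ⟨h.1, h.2.1, h.2.2.1, h.2.2.2.1⟩

lemma trunc {lam μ S : ℝ} (hlam : 1 < lam) (hμ : 0 < μ) (hS : 0 < S) :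
    ∃ ν : ℝ, ∀ ω, Adm ω → impulse ω = μ → S ≤ Efun lam ω →
      ∃ ω', InAdm μ ν ω' ∧ Efun lam ω ≤ Efun lam ω' := by
  obtain ⟨C, hC, hap⟩ := apriori hlam
  set c := S / (2 * μ) with hc
  have hc0 : 0 < c := by positivity
  refine ⟨μ / Real.sqrt (S / (2 * C)) * (kap * (8 * lam * (C * μ ^ 2)) / c), fun ω h hI hE => ?_⟩
  set A : Set (ℝ × ℝ) := {x | c * x.2 < Gg ω x} with hAd
  have hA : MeasurableSet A :=
    measurableSet_lt (by fun_prop) (Gg_meas h.i1.aestronglyMeasurable)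
  have hu := h.indicator hA
  set u := A.indicator ω with hud
  have hN : N2 ω ≤ 8 * lam * (C * μ ^ 2) := by
    have := hap ω h
    rw [hI] at this
    have h2 : N2 ω / (8 * lam) ≤ C * μ ^ 2 := by linarith
    rw [div_le_iff₀ (by positivity)] at h2
    linarith
  have hsplit := impulse_split h hA
  rw [hI] at hsplit
  have hl0 := impulse_nonneg (h.indicator hA.compl)
  have hu0 := impulse_nonneg hu
  have hcut : Efun lam ω ≤ Efun lam u + c * impulse (Aᶜ.indicator ω) := by
    refine (Efun_cut hlam h hA).trans ?_
    gcongr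
    rw [impulse_indicator hA.compl, ← integral_const_mul]
    refine setIntegral_mono_on_ae (wG_int h.memLp).integrableOn (h.ix.const_mul c).integrableOn
      hA.compl ?_
    filter_upwards [ae_UHP] with x hx hxA
    have : Gg ω x ≤ c * x.2 := not_lt.1 hxA
    nlinarith [h.nn x hx]
  have hEu : S / 2 ≤ Efun lam u := by
    have : c * impulse (Aᶜ.indicator ω) ≤ c * μ := by gcongr; linarith
    have h3 : c * μ = S / 2 := by rw [hc]; field_simp
    linarith
  have hu2 : S / (2 * C) ≤ impulse u ^ 2 := by
    have := hap u hu
    have h3 : 0 ≤ N2 u / (8 * lam) := div_nonneg (N2_nonneg u) (by positivity)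
    rw [div_le_iff₀ (by positivity)]
    linarith
  have hm := Real.sqrt_le_sqrt hu2
  rw [Real.sqrt_sq hu0] at hm
  have hs0 : 0 < Real.sqrt (S / (2 * C)) := Real.sqrt_pos.2 (by positivity)
  have hm0 : 0 < impulse u := hs0.trans_le hm
  set m := impulse u with hmd
  have hmass : ∫ x, u x ∂PU ≤ kap * (8 * lam * (C * μ ^ 2)) / c := by
    obtain ⟨F, hF, hF0, hF1, hF2⟩ := exists_F h
    calc ∫ x, u x ∂PU ≤ ∫ x, F x / c ∂PU := by
          refine integral_mono_ae hu.i1 (hF.div_const c) ?_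
          filter_upwards [ae_UHP, hF0, hF2] with x hx h0 h2
          have hx2 : 0 < x.2 := hx
          by_cases hxA : x ∈ A
          · rw [hud, Set.indicator_of_mem hxA, le_div_iff₀ hc0]
            have h3 : c * x.2 < Gg ω x := hxA
            have h4 : ω x * (c * x.2) ≤ x.2 * F x := le_trans
              (mul_le_mul_of_nonneg_left h3.le (h.nn x hx)) h2
            exact le_of_mul_le_mul_left (by linarith) hx2
          · rw [hud, Set.indicator_of_notMem hxA]; positivity
      _ = (∫ x, F x ∂PU) / c := integral_div _ _
      _ ≤ _ := by
          have := kap_nonneg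
          gcongr
          exact hF1.trans (by gcongr)
  have hmass0 : 0 ≤ ∫ x, u x ∂PU := integral_nonneg_of_ae hu.nnae
  refine ⟨fun x => μ / m * u x, (hu.smul (by positivity)).inAdm ?_ ?_, ?_⟩
  · rw [impulse_smul]; field_simp; exact hmd
  · rw [integral_const_mul]
    gcongr
  · rw [Efun_smul, div_pow, div_mul_eq_mul_div, le_div_iff₀ (by positivity)]
    have h3 : S = 2 * c * μ := by rw [hc]; field_simp
    have hl : impulse (Aᶜ.indicator ω) = μ - m := by linarith
    rw [hl] at hcut hl0
    have h5 : μ ^ 2 * (Efun lam ω - c * (μ - m)) ≤ μ ^ 2 * Efun lam u := by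
      gcongr; linarith
    have h6 : 2 * c * μ * ((μ - m) * (μ + m)) ≤ Efun lam ω * ((μ - m) * (μ + m)) := by
      have : 0 ≤ (μ - m) * (μ + m) := mul_nonneg hl0 (by positivity)
      gcongr; linarith
    have h7 : 0 ≤ c * μ * (μ - m) * (μ + 2 * m) := by
      have : 0 ≤ c * μ * (μ - m) := mul_nonneg (by positivity) hl0
      positivity
    nlinarith

lemma hK_tail {η : ℝ} (hη : 0 < η) : ∃ D : ℝ, 0 < D ∧
    ∫ z, ({z | D ≤ rad z} : Set (ℝ × ℝ)).indicator hK z ≤ η := by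
  set C := ∫ z, rad z * hK z with hC
  have hC0 : 0 ≤ C := integral_nonneg fun z => mul_nonneg (rad_nonneg z) (hK_nonneg z)
  refine ⟨(C + 1) / η, by positivity, ?_⟩
  set D := (C + 1) / η with hD
  have hD0 : 0 < D := by positivity
  calc _ ≤ ∫ z, (rad z * hK z) / D := by
        refine integral_mono (hK_int.indicator (measurableSet_le measurable_const rad_measurable))
          (radhK_int.div_const D) fun z => ?_
        have h1 := hK_nonneg z
        have h2 := rad_nonneg z
        by_cases hz : D ≤ rad z
        · simp only
          rw [Set.indicator_of_mem (by exact hz), le_div_iff₀ hD0]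
          nlinarith
        · simp only
          rw [Set.indicator_of_notMem (by exact hz)]
          positivity
    _ = C / D := by rw [integral_div]
    _ ≤ η := by
        rw [div_le_iff₀ hD0, hD, mul_div_cancel₀ _ hη.ne']; linarith

lemma exists_pos_energy {lam μ : ℝ} (hlam : 1 < lam) (hμ : 0 < μ) :
    ∃ ω, Adm ω ∧ impulse ω = μ ∧ 0 < Efun lam ω := by
  suffices H : ∃ ω, Adm ω ∧ 0 < Efun lam ω by
    obtain ⟨ω, h, hE⟩ := H
    obtain ⟨C, hC, hap⟩ := apriori hlam
    have hI : 0 < impulse ω := by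
      rcases (impulse_nonneg h).lt_or_eq with h1 | h1
      · exact h1
      · have h2 := hap ω h
        rw [← h1] at h2
        have h3 : 0 ≤ N2 ω / (8 * lam) := div_nonneg (N2_nonneg ω) (by positivity)
        simp at h2; linarith
    refine ⟨fun x => μ / impulse ω * ω x, h.smul (by positivity), ?_, ?_⟩
    · rw [impulse_smul]; field_simp
    · rw [Efun_smul]; positivity
  set θ := 1 / lam with hθ
  have hθ0 : 0 < θ := by positivity
  have hθ1 : θ < 1 := by rw [hθ, div_lt_one (by linarith)]; exact hlam
  set η := (1 - θ) / 4 with hη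
  have hη0 : 0 < η := by rw [hη]; linarith
  obtain ⟨D, hD, hDη⟩ := hK_tail hη0
  set m := 16 / (1 - θ) + 2 with hm
  have h1θ : 0 < 1 - θ := by linarith
  have hm2 : 2 < m := by rw [hm]; have : 0 < 16 / (1 - θ) := by positivity
                         linarith
  set L := m * D with hL
  have hLD : 2 * D < L := by rw [hL]; gcongr
  set Q : Set (ℝ × ℝ) := Set.Icc 0 L ×ˢ Set.Icc L (2 * L) with hQ
  set Q' : Set (ℝ × ℝ) := Set.Icc D (L - D) ×ˢ Set.Icc (L + D) (2 * L - D) with hQ'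
  have hQm : MeasurableSet Q := measurableSet_Icc.prod measurableSet_Icc
  have hQ'm : MeasurableSet Q' := measurableSet_Icc.prod measurableSet_Icc
  have hQU : Q ⊆ UHP := fun x hx => by
    have := hx.2.1
    exact lt_of_lt_of_le (by linarith) this
  have hQQ : Q' ⊆ Q := fun x hx => by
    obtain ⟨⟨h1, h2⟩, h3, h4⟩ := hx
    exact ⟨⟨by linarith, by linarith⟩, by linarith, by linarith⟩
  have hvQ : PU.real Q = L ^ 2 := by
    rw [measureReal_restrict_apply hQm, Set.inter_eq_left.2 hQU, hQ, Measure.volume_eq_prod,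
      measureReal_prod_prod, Real.volume_real_Icc_of_le (by linarith),
      Real.volume_real_Icc_of_le (by linarith)]
    ring
  have hvQ' : PU.real Q' = (L - 2 * D) ^ 2 := by
    rw [measureReal_restrict_apply hQ'm, Set.inter_eq_left.2 (hQQ.trans hQU), hQ',
      Measure.volume_eq_prod,
      measureReal_prod_prod, Real.volume_real_Icc_of_le (by linarith),
      Real.volume_real_Icc_of_le (by linarith)]
    ring
  have hQc : IsCompact Q := isCompact_Icc.prod isCompact_Icc
  have hQfin : PU Q ≠ ⊤ := hQc.measure_lt_top.ne
  have hQ'fin : PU Q' ≠ ⊤ := ne_top_of_le_ne_top hQfin (measure_mono hQQ)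
  set ω : ℝ × ℝ → ℝ := Q.indicator (fun _ => 1) with hω
  have h : Adm ω := by
    have hi : Integrable ω PU :=
      (integrable_indicator_iff hQm).2 (integrableOn_const hQfin)
    refine ⟨fun x _ => Set.indicator_nonneg (fun _ _ => zero_le_one) x, hi, ?_, ?_⟩
    · refine hi.congr (Eventually.of_forall fun x => ?_)
      by_cases hx : x ∈ Q <;> simp [hω, hx]
    · have : Integrable (Q.indicator (fun x : ℝ × ℝ => x.2)) PU := by
        refine (integrable_indicator_iff hQm).2 ?_
        exact (continuous_snd.continuousOn.integrableOn_compact hQc)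
      refine this.congr (Eventually.of_forall fun x => ?_)
      by_cases hx : x ∈ Q <;> simp [hω, hx]
  refine ⟨ω, h, ?_⟩
  have hN : N2 ω = L ^ 2 := by
    rw [N2_indicator hQm, ← hvQ]; simp
  set t : ℝ × ℝ → ℝ := ({z | D ≤ rad z} : Set (ℝ × ℝ)).indicator hK with ht
  have htint : Integrable t :=
    hK_int.indicator (measurableSet_le measurable_const rad_measurable)
  have ht0 : ∀ z, 0 ≤ t z := fun z => Set.indicator_nonneg (fun z _ => hK_nonneg z) z
  have hGlow : ∀ x ∈ Q', 1 - 2 * η ≤ Gg ω x := by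
    intro x hx
    obtain ⟨⟨h1, h2⟩, h3, h4⟩ := hx
    have hr1 : ∀ y, y ∉ Q → D ≤ rad (x - y) := by
      intro y hy
      by_contra hc
      push Not at hc
      apply hy
      have a1 := abs_lt.1 ((abs_fst_le_rad (x - y)).trans_lt hc)
      have a2 := abs_lt.1 ((abs_snd_le_rad (x - y)).trans_lt hc)
      simp only [Prod.fst_sub, Prod.snd_sub] at a1 a2
      exact ⟨⟨by linarith, by linarith⟩, by linarith, by linarith⟩
    have hr2 : ∀ y, y ∈ Q → D ≤ rad (reflPt x - y) := by
      intro y hy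
      obtain ⟨_, h5, h6⟩ := hy
      refine le_trans ?_ (abs_snd_le_rad _)
      simp only [Prod.snd_sub, reflPt]
      rw [abs_of_nonpos (by linarith)]
      linarith
    have hlow : ∀ y, hK (x - y) - t (x - y) - t (reflPt x - y) ≤ gk x y * ω y := by
      intro y
      by_cases hy : y ∈ Q
      · have e : ω y = 1 := by rw [hω, Set.indicator_of_mem hy]
        have e2 : t (reflPt x - y) = hK (reflPt x - y) := by
          rw [ht, Set.indicator_of_mem]; exact hr2 y hy
        rw [e, e2, mul_one]
        have h5 : GUHP x y ≤ gk x y := le_max_left _ _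
        unfold GUHP at h5
        rw [Gker_eq, Gker_eq] at h5
        linarith [ht0 (x - y)]
      · have e : ω y = 0 := by rw [hω, Set.indicator_of_notMem hy]
        have e2 : t (x - y) = hK (x - y) := by
          rw [ht, Set.indicator_of_mem]; exact hr1 y hy
        rw [e, e2]
        linarith [ht0 (reflPt x - y)]
    have hi1 : Integrable (fun y => hK (x - y)) := hK_int.comp_sub_left x
    have hi2 : Integrable (fun y => t (x - y)) := htint.comp_sub_left x
    have hi3 : Integrable (fun y => t (reflPt x - y)) := htint.comp_sub_left _
    have hi12 : Integrable (fun y => hK (x - y) - t (x - y)) := hi1.sub hi2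
    have hgi : Integrable (fun y => gk x y * ω y) := by
      refine Integrable.mono' hi1 ?_ (Eventually.of_forall fun y => ?_)
      · exact ((gk_meas_right x).mul (measurable_const.indicator hQm)).aestronglyMeasurable
      · have a1 := gk_le_h x y
        have a0 := gk_nonneg x y
        by_cases hy : y ∈ Q
        · simpa [hω, hy, abs_of_nonneg a0] using a1
        · simpa [hω, hy] using hK_nonneg _
    have hG : Gg ω x = ∫ y, gk x y * ω y := by
      unfold Gg
      refine setIntegral_eq_integral_of_forall_compl_eq_zero fun y hy => ?_
      have : y ∉ Q := fun hc => hy (hQU hc)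
      rw [hω, Set.indicator_of_notMem this, mul_zero]
    rw [hG]
    calc 1 - 2 * η ≤ 1 - (∫ z, t z) - ∫ z, t z := by linarith
      _ = ∫ y, (hK (x - y) - t (x - y) - t (reflPt x - y)) := by
          rw [integral_sub hi12 hi3, integral_sub hi1 hi2,
            integral_sub_left_eq_self hK, integral_sub_left_eq_self t,
            integral_sub_left_eq_self t, hK_integral]
      _ ≤ _ := integral_mono (hi12.sub hi3) hgi hlow
  have hkin : (1 - 2 * η) * (L - 2 * D) ^ 2 ≤ 2 * kineticE ω := by
    rw [kin_eq']
    calc _ = ∫ x, Q'.indicator (fun _ => 1 - 2 * η) x ∂PU := by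
          rw [integral_indicator hQ'm, setIntegral_const, hvQ']; simp [mul_comm]
      _ ≤ _ := by
          refine integral_mono ((integrable_indicator_iff hQ'm).2 (integrableOn_const hQ'fin))
            (wG_int h.memLp) fun x => ?_
          by_cases hx : x ∈ Q'
          · simp only [Set.indicator_of_mem hx]
            rw [hω, Set.indicator_of_mem (hQQ hx), one_mul]
            exact hGlow x hx
          · simp only [Set.indicator_of_notMem hx]
            exact mul_nonneg (Set.indicator_nonneg (fun _ _ => zero_le_one) x) (Gg_nonneg h x)
  rw [Efun_eq, hN]
  have e1 : 1 / (2 * lam) * L ^ 2 = θ * L ^ 2 / 2 := by rw [hθ]; field_simp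
  rw [e1]
  suffices θ * L ^ 2 < (1 - 2 * η) * (L - 2 * D) ^ 2 by linarith
  have e2 : 1 - 2 * η = (1 + θ) / 2 := by rw [hη]; ring
  rw [e2, hL]
  have hmm : 16 + 2 * (1 - θ) = m * (1 - θ) := by rw [hm]; field_simp
  have hfin : θ * m ^ 2 < (1 + θ) / 2 * (m - 2) ^ 2 := by
    have h5 : m ^ 2 - 4 * m ≤ (m - 2) ^ 2 := by nlinarith
    have h6 : θ * m < (1 + θ) / 2 * (m - 4) := by nlinarith
    nlinarith
  calc θ * (m * D) ^ 2 = (θ * m ^ 2) * D ^ 2 := by ring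
    _ < ((1 + θ) / 2 * (m - 2) ^ 2) * D ^ 2 := by gcongr
    _ = _ := by ring

open MeasureTheory Real Filter

lemma homog {lam μ : ℝ} (hlam : 1 < lam) (hμ : 0 < μ) :
    ∃ ν₁ : ℝ, ∀ ν, ν₁ ≤ ν → 0 < Sval lam μ ν ∧
      ∀ ω, Adm ω → Efun lam ω ≤ Sval lam μ ν / μ ^ 2 * impulse ω ^ 2 := by
  obtain ⟨w, hw, hwI, hwE⟩ := exists_pos_energy hlam hμ
  obtain ⟨νb, hνb⟩ := trunc hlam hμ hwE
  obtain ⟨C, hC, hap⟩ := apriori hlam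
  refine ⟨max (∫ x in UHP, w x) νb, fun ν hν => ?_⟩
  have hbdd : BddAbove {s | ∃ ω, InAdm μ ν ω ∧ s = Efun lam ω} := by
    refine ⟨C * μ ^ 2, ?_⟩
    rintro s ⟨ω, hω, rfl⟩
    have := hap ω hω.adm
    rw [hω.2.2.2.2.1] at this
    have h2 : 0 ≤ N2 ω / (8 * lam) := div_nonneg (N2_nonneg _) (by linarith)
    linarith
  have hS : Efun lam w ≤ Sval lam μ ν :=
    le_csSup hbdd ⟨w, hw.inAdm hwI (le_trans (le_max_left _ _) hν), rfl⟩
  have hmain : ∀ ω, Adm ω → impulse ω = μ → Efun lam ω ≤ Sval lam μ ν := by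
    intro ω hω hI
    by_cases h : Efun lam w ≤ Efun lam ω
    · obtain ⟨ω', h1, h2⟩ := hνb ω hω hI h
      refine h2.trans (le_csSup hbdd ⟨ω', ?_, rfl⟩)
      exact h1.adm.inAdm h1.2.2.2.2.1 (h1.2.2.2.2.2.trans (le_trans (le_max_right _ _) hν))
    · push Not at h
      exact h.le.trans hS
  refine ⟨lt_of_lt_of_le hwE hS, fun ω hω => ?_⟩
  rcases (impulse_nonneg hω).eq_or_lt with h0 | h0
  · have := hap ω hω
    have h2 : 0 ≤ N2 ω / (8 * lam) := div_nonneg (N2_nonneg _) (by linarith)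
    rw [← h0] at this ⊢
    linarith
  · have h1 := hmain (fun x => μ / impulse ω * ω x) (hω.smul (by positivity))
      (by rw [impulse_smul]; field_simp)
    rw [Efun_smul] at h1
    have h3 : Efun lam ω = (impulse ω / μ) ^ 2 * ((μ / impulse ω) ^ 2 * Efun lam ω) := by
      field_simp
    rw [h3]
    calc _ ≤ (impulse ω / μ) ^ 2 * Sval lam μ ν := by gcongr
      _ = _ := by field_simp

/-- vertical tightness -/
lemma vert {lam s : ℝ} (hlam : 1 < lam) (hs : 0 < s)
    (hH : ∀ ω, Adm ω → Efun lam ω ≤ s * impulse ω ^ 2) {ω} (h : Adm ω) {H : ℝ} (hH0 : 0 < H) :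
    s * impulse ω * impulse (({x | x.2 ≤ H} : Set (ℝ × ℝ))ᶜ.indicator ω) ≤
      s * impulse ω ^ 2 - Efun lam ω + Mh * √(N2 ω) * impulse ω / H := by
  have hA : MeasurableSet ({x | x.2 ≤ H} : Set (ℝ × ℝ)) := measurableSet_le measurable_snd measurable_const
  set A : Set (ℝ × ℝ) := {x | x.2 ≤ H} with hAdef
  have h1 := Efun_cut hlam h hA
  have h2 := hH _ (h.indicator hA)
  have h3 := impulse_split h hA
  have n1 := impulse_nonneg (h.indicator hA)
  have n2 := impulse_nonneg (h.indicator hA.compl)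
  have nI := impulse_nonneg h
  have h4 : ∫ x in Aᶜ, ω x * Gg ω x ∂PU ≤ Mh * √(N2 ω) / H * impulse (Aᶜ.indicator ω) := by
    rw [impulse_indicator hA.compl, ← integral_const_mul]
    refine integral_mono_ae (wG_int h.memLp).integrableOn
      ((h.ix.integrableOn).const_mul _) ?_
    filter_upwards [ae_restrict_mem hA.compl, ae_restrict_of_ae h.nnae] with x hx hx0
    have hxH : H < x.2 := by simpa [hAdef] using hx
    have g1 : Gg ω x ≤ Mh * √(N2 ω) := (le_abs_self _).trans (Gg_bound h.memLp x)
    have g2 : 0 ≤ Mh * √(N2 ω) := mul_nonneg Mh_nonneg (sqrt_nonneg _)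
    calc ω x * Gg ω x ≤ ω x * (Mh * √(N2 ω)) := by gcongr
      _ = Mh * √(N2 ω) / H * (H * ω x) := by field_simp
      _ ≤ _ := by gcongr
  have h5 : Mh * √(N2 ω) / H * impulse (Aᶜ.indicator ω) ≤ Mh * √(N2 ω) * impulse ω / H := by
    rw [div_mul_eq_mul_div]
    have g2 : 0 ≤ Mh * √(N2 ω) := mul_nonneg Mh_nonneg (sqrt_nonneg _)
    gcongr
    linarith
  set a := impulse (A.indicator ω)
  set b := impulse (Aᶜ.indicator ω)
  have h6 : s * impulse ω * b ≤ s * impulse ω ^ 2 - s * a ^ 2 := by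
    rw [← h3]
    nlinarith [mul_nonneg hs.le (mul_nonneg n1 n2)]
  linarith

noncomputable def kH (z : ℝ × ℝ) : ℝ := (rad z + 1) * hK z

noncomputable def Ch : ℝ := ∫ z, kH z

lemma kH_nonneg (z) : 0 ≤ kH z := mul_nonneg (by linarith [rad_nonneg z]) (hK_nonneg z)
lemma kH_int : Integrable kH := by
  have : Integrable (fun z => rad z * hK z + hK z) := radhK_int.add hK_int
  refine this.congr (Eventually.of_forall fun z => ?_)
  simp only [kH]; ring
lemma kH_meas : Measurable kH := (rad_measurable.add_const 1).mul hK_meas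
lemma kH_neg (z) : kH (-z) = kH z := by unfold kH; rw [hK_neg, rad_neg]
lemma Ch_nonneg : 0 ≤ Ch := integral_nonneg kH_nonneg

lemma count_cut (a : ℤ) (m : ℕ) (x y : ℝ) :
    ∑ j ∈ Finset.range m, (if x < (a : ℝ) + j ∧ (a : ℝ) + j ≤ y then (1 : ℝ) else 0) ≤ |x - y| + 1 := by
  rw [Finset.sum_boole]
  have h1 : ((Finset.range m).filter fun j : ℕ => x < (a : ℝ) + j ∧ (a : ℝ) + j ≤ y).card ≤
      (Finset.Ioc ⌊x⌋ ⌊y⌋).card := by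
    refine Finset.card_le_card_of_injOn (fun j : ℕ => a + (j : ℤ)) ?_ ?_
    · intro j hj
      simp only [Finset.coe_filter, Set.mem_ofPred_eq] at hj
      simp only [Finset.coe_Ioc, Set.mem_Ioc]
      constructor
      · rw [Int.floor_lt]; push_cast; exact hj.2.1
      · rw [Int.le_floor]; push_cast; exact hj.2.2
    · intro i _ j _ hij
      simpa using hij
  rw [Int.card_Ioc] at h1
  have h2 : (((⌊y⌋ - ⌊x⌋).toNat : ℕ) : ℝ) ≤ |x - y| + 1 := by
    rcases le_total (⌊y⌋ - ⌊x⌋) 0 with h | h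
    · rw [Int.toNat_of_nonpos h]; simp; positivity
    · have : (((⌊y⌋ - ⌊x⌋).toNat : ℕ) : ℝ) = ((⌊y⌋ - ⌊x⌋ : ℤ) : ℝ) := by
        exact_mod_cast congrArg (Int.cast : ℤ → ℝ) (Int.toNat_of_nonneg h)
      rw [this]; push_cast
      have := Int.floor_le y
      have := Int.lt_floor_add_one x
      have := neg_abs_le (x - y)
      linarith
  exact le_trans (by exact_mod_cast h1) h2

def Lc (t : ℝ) : Set (ℝ × ℝ) := {x | x.1 < t}
lemma Lc_meas (t) : MeasurableSet (Lc t) := measurableSet_lt measurable_fst measurable_const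

lemma horiz_cut {ω} (h : Adm ω) (a : ℤ) {m : ℕ} (hm : 1 ≤ m) :
    ∃ j : ℕ, j < m ∧ ∫ p, (Lc (a + j) ×ˢ (Lc (a + j))ᶜ).indicator (eD ω) p ∂(PU.prod PU) ≤
      Ch * N2 ω / m := by
  have hi : ∀ j : ℕ, Integrable ((Lc (a + j) ×ˢ (Lc (a + j))ᶜ).indicator (eD ω)) (PU.prod PU) :=
    fun j => (eD_int h.memLp).indicator ((Lc_meas _).prod (Lc_meas _).compl)
  have hsum : ∑ j ∈ Finset.range m,
      ∫ p, (Lc (a + j) ×ˢ (Lc (a + j))ᶜ).indicator (eD ω) p ∂(PU.prod PU) ≤ Ch * N2 ω := by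
    rw [← integral_finsetSum _ fun j _ => hi j]
    refine le_trans ?_ (schur_le kH_meas kH_int kH_nonneg kH_neg h.memLp)
    refine integral_mono_ae (integrable_finsetSum _ fun j _ => hi j)
      (schur_int kH_meas kH_int kH_nonneg kH_neg h.memLp) ?_
    filter_upwards [ae_UHP2] with p hp
    have e : ∀ j : ℕ, (Lc (a + j) ×ˢ (Lc (a + j))ᶜ).indicator (eD ω) p =
        (if p.1.1 < (a : ℝ) + j ∧ (a : ℝ) + j ≤ p.2.1 then (1 : ℝ) else 0) * eD ω p := by
      intro j
      by_cases hc : p.1.1 < (a : ℝ) + j ∧ (a : ℝ) + j ≤ p.2.1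
      · rw [if_pos hc, Set.indicator_of_mem, one_mul]
        simpa [Lc] using hc
      · rw [if_neg hc, Set.indicator_of_notMem, zero_mul]
        simpa [Lc] using hc
    simp only [e, ← Finset.sum_mul]
    have w : 0 ≤ ω p.1 * ω p.2 := mul_nonneg (h.nn _ hp.1) (h.nn _ hp.2)
    have c1 := count_cut a m p.1.1 p.2.1
    have c2 : |p.1.1 - p.2.1| ≤ rad (p.1 - p.2) := abs_fst_le_rad (p.1 - p.2)
    have r0 := rad_nonneg (p.1 - p.2)
    have k0 := hK_nonneg (p.1 - p.2)
    calc _ ≤ (rad (p.1 - p.2) + 1) * eD ω p := by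
          refine mul_le_mul_of_nonneg_right (by linarith) ?_
          exact mul_nonneg (gk_nonneg _ _) w
      _ ≤ (rad (p.1 - p.2) + 1) * (hK (p.1 - p.2) * (ω p.1 * ω p.2)) := by
          unfold eD
          gcongr
          exact gk_le_h _ _
      _ = _ := by unfold kH; ring
  have hne : (Finset.range m).Nonempty := ⟨0, by simp; omega⟩
  have hm' : (0:ℝ) < m := by exact_mod_cast hm
  obtain ⟨j, hj, hle⟩ := Finset.exists_le_of_sum_le (s := Finset.range m) (g := fun _ => Ch * N2 ω / m) hne
    (by simpa [mul_div_cancel₀, hm'.ne'] using (hsum.trans (by field_simp; exact le_rfl)))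
  exact ⟨j, by simpa using hj, hle⟩

lemma horiz {lam s : ℝ} (hs : 0 < s)
    (hH : ∀ ω, Adm ω → Efun lam ω ≤ s * impulse ω ^ 2) {ω} (h : Adm ω) (a : ℤ) {m : ℕ} (hm : 1 ≤ m) :
    2 * s * impulse ((Lc a).indicator ω) * impulse ((Lc (a + m))ᶜ.indicator ω) ≤
      s * impulse ω ^ 2 - Efun lam ω + Ch * N2 ω / m := by
  obtain ⟨j, hj, hX⟩ := horiz_cut h a hm
  have hA := Lc_meas (a + j)
  have h1 := Efun_cutX (lam := lam) h hA
  have h2 := hH _ (h.indicator hA)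
  have h2' := hH _ (h.indicator hA.compl)
  have h3 := impulse_split h hA
  have jm : (j : ℝ) ≤ m := by exact_mod_cast hj.le
  have m1 : impulse ((Lc a).indicator ω) ≤ impulse ((Lc (a + j)).indicator ω) := by
    refine impulse_mono_set h (Lc_meas _) hA fun x hx => ?_
    simp only [Lc, Set.mem_ofPred_eq] at hx ⊢
    have : (0:ℝ) ≤ j := by positivity
    linarith
  have m2 : impulse ((Lc (a + m))ᶜ.indicator ω) ≤ impulse ((Lc (a + j))ᶜ.indicator ω) := by
    refine impulse_mono_set h (Lc_meas _).compl hA.compl fun x hx => ?_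
    simp only [Lc, Set.mem_ofPred_eq, Set.mem_compl_iff, not_lt] at hx ⊢
    linarith
  have n1 := impulse_nonneg (h.indicator (Lc_meas a))
  have n2 := impulse_nonneg (h.indicator (Lc_meas (a + m)).compl)
  have : impulse ((Lc a).indicator ω) * impulse ((Lc (a + m))ᶜ.indicator ω) ≤
    impulse ((Lc (a + j)).indicator ω) * impulse ((Lc (a + j))ᶜ.indicator ω) := by gcongr; linarith
  rw [← h3]
  nlinarith

lemma median {ω} (h : Adm ω) (hI : 0 < impulse ω) :
    ∃ c : ℤ, impulse ω / 2 ≤ impulse ((Lc c).indicator ω) ∧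
      impulse ω / 2 ≤ impulse ((Lc (c - 1 : ℤ))ᶜ.indicator ω) := by
  have hLcI : ∀ t, impulse ((Lc t).indicator ω) = ∫ x in Lc t, x.2 * ω x ∂PU :=
    fun t => impulse_indicator (Lc_meas t)
  have t1 : Tendsto (fun n : ℕ => impulse ((Lc (n : ℝ)).indicator ω)) atTop (nhds (impulse ω)) := by
    simp only [hLcI]
    have := tendsto_setIntegral_of_monotone (μ := PU) (f := fun x => x.2 * ω x) (s := fun n : ℕ => Lc (n : ℝ))
      (fun n => Lc_meas _) (by
        intro i j hij x hx
        simp only [Lc, Set.mem_ofPred_eq] at hx ⊢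
        have : (i : ℝ) ≤ j := by exact_mod_cast hij
        linarith) h.ix.integrableOn
    have hU : ⋃ n : ℕ, Lc (n : ℝ) = Set.univ := by
      ext x; simp only [Lc, Set.mem_iUnion, Set.mem_ofPred_eq, Set.mem_univ, iff_true]
      exact exists_nat_gt _
    rw [hU, Measure.restrict_univ] at this
    exact this
  have t2 : Tendsto (fun n : ℕ => impulse ((Lc (-(n : ℝ))).indicator ω)) atTop (nhds 0) := by
    simp only [hLcI]
    have := tendsto_setIntegral_of_antitone (μ := PU) (f := fun x => x.2 * ω x) (s := fun n : ℕ => Lc (-(n : ℝ)))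
      (fun n => Lc_meas _) (by
        intro i j hij x hx
        simp only [Lc, Set.mem_ofPred_eq] at hx ⊢
        have : (i : ℝ) ≤ j := by exact_mod_cast hij
        linarith) ⟨0, h.ix.integrableOn⟩
    have hU : ⋂ n : ℕ, Lc (-(n : ℝ)) = ∅ := by
      ext x; simp only [Lc, Set.mem_iInter, Set.mem_ofPred_eq, Set.mem_empty_iff_false, iff_false, not_forall, not_lt]
      obtain ⟨n, hn⟩ := exists_nat_gt (-x.1)
      exact ⟨n, by linarith⟩
    rw [hU] at this
    simpa using this
  obtain ⟨n1, hn1⟩ := (t1.eventually (lt_mem_nhds (show impulse ω / 2 < impulse ω by linarith))).exists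
  obtain ⟨n2, hn2⟩ := (t2.eventually (gt_mem_nhds (show (0:ℝ) < impulse ω / 2 by linarith))).exists
  have mono : ∀ s t : ℝ, s ≤ t → impulse ((Lc s).indicator ω) ≤ impulse ((Lc t).indicator ω) := by
    intro s t hst
    refine impulse_mono_set h (Lc_meas _) (Lc_meas _) fun x hx => ?_
    simp only [Lc, Set.mem_ofPred_eq] at hx ⊢
    linarith
  obtain ⟨c, hc, hmin⟩ := Int.exists_least_of_bdd (P := fun c : ℤ => impulse ω / 2 ≤ impulse ((Lc (c:ℝ)).indicator ω))
    ⟨-(n2 : ℤ), fun z hz => by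
      by_contra hlt
      push Not at hlt
      have : (z : ℝ) ≤ -(n2 : ℝ) := by exact_mod_cast hlt.le
      have := mono _ _ this
      linarith⟩ ⟨n1, by simpa using hn1.le⟩
  refine ⟨c, hc, ?_⟩
  have : impulse ((Lc ((c - 1 : ℤ) : ℝ)).indicator ω) < impulse ω / 2 := by
    by_contra hcon
    push Not at hcon
    have := hmin _ hcon
    omega
  have := impulse_split h (Lc_meas ((c - 1 : ℤ) : ℝ))
  linarith

/-- boxes -/
def Bx (m : ℕ) : Set (ℝ × ℝ) := {x | -(m : ℝ) ≤ x.1 ∧ x.1 ≤ m ∧ x.2 ≤ m}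
lemma Bx_meas (m) : MeasurableSet (Bx m) := by
  refine (measurableSet_le measurable_const measurable_fst).inter
    ((measurableSet_le measurable_fst measurable_const).inter (measurableSet_le measurable_snd measurable_const))

def Bc (c : ℝ) (m : ℕ) : Set (ℝ × ℝ) := {x | -(m : ℝ) ≤ x.1 - c ∧ x.1 - c ≤ m ∧ x.2 ≤ m}
lemma Bc_meas (c m) : MeasurableSet (Bc c m) := by
  have : Measurable fun x : ℝ × ℝ => x.1 - c := measurable_fst.sub_const c
  refine (measurableSet_le measurable_const this).inter
    ((measurableSet_le this measurable_const).inter (measurableSet_le measurable_snd measurable_const))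

lemma tight {lam s : ℝ} (hlam : 1 < lam) (hs : 0 < s)
    (hH : ∀ ω, Adm ω → Efun lam ω ≤ s * impulse ω ^ 2) {ω} (h : Adm ω) (hI : 0 < impulse ω) :
    ∃ c : ℝ, ∀ m : ℕ, 2 ≤ m → s * impulse ω * impulse ((Bc c m)ᶜ.indicator ω) ≤
      3 * (s * impulse ω ^ 2 - Efun lam ω) + (2 * Ch * N2 ω + Mh * √(N2 ω) * impulse ω) / (m - 1) := by
  obtain ⟨c, hc1, hc2⟩ := median h hI
  refine ⟨c, fun m hm => ?_⟩
  obtain ⟨k, rfl⟩ : ∃ k, m = k + 1 := ⟨m - 1, by omega⟩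
  have hk : 1 ≤ k := by omega
  have hk' : (1:ℝ) ≤ k := by exact_mod_cast hk
  have r := horiz hs hH h c hk
  have l := horiz hs hH h (c - 1 - k) hk
  have v := vert hlam hs hH h (H := ((k + 1 : ℕ) : ℝ)) (by positivity)
  have e1 : (((c - 1 - k : ℤ) : ℝ) + (k:ℝ)) = ((c - 1 : ℤ) : ℝ) := by push_cast; ring
  rw [e1] at l
  set V : Set (ℝ × ℝ) := {x | x.2 ≤ ((k + 1 : ℕ) : ℝ)}
  have hV : MeasurableSet V := measurableSet_le measurable_snd measurable_const
  have n1 := impulse_nonneg (h.indicator (Lc_meas ((c - 1 - k : ℤ) : ℝ)))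
  have n2 := impulse_nonneg (h.indicator (Lc_meas (c + k)).compl)
  have hun : impulse ((Bc c (k + 1))ᶜ.indicator ω) ≤ impulse ((Lc ((c - 1 - k : ℤ) : ℝ)).indicator ω) +
      impulse ((Lc (c + k))ᶜ.indicator ω) + impulse (Vᶜ.indicator ω) := by
    rw [impulse_eq, impulse_eq, impulse_eq, impulse_eq]
    have i1 := (h.indicator (Lc_meas ((c - 1 - k : ℤ) : ℝ))).ix
    have i2 := (h.indicator (Lc_meas (c + k)).compl).ix
    have i3 := (h.indicator hV.compl).ix
    have i12 : Integrable (fun x => x.2 * (Lc ((c - 1 - k : ℤ) : ℝ)).indicator ω x +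
      x.2 * (Lc (c + k))ᶜ.indicator ω x) PU := i1.add i2
    have i123 := i12.add i3
    rw [← integral_add i1 i2, ← integral_add i12 i3]
    refine integral_mono_ae (h.indicator (Bc_meas _ _).compl).ix i123 ?_
    filter_upwards [ae_UHP] with x hx
    have hx' : 0 < x.2 := hx
    have hw := h.nn x hx
    simp only [Pi.add_apply, ← mul_add]
    refine mul_le_mul_of_nonneg_left ?_ hx'.le
    have q1 : 0 ≤ (Lc ((c - 1 - k : ℤ) : ℝ)).indicator ω x := Set.indicator_apply_nonneg fun _ => hw
    have q2 : 0 ≤ (Lc (c + k))ᶜ.indicator ω x := Set.indicator_apply_nonneg fun _ => hw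
    have q3 : 0 ≤ Vᶜ.indicator ω x := Set.indicator_apply_nonneg fun _ => hw
    by_cases hb : x ∈ (Bc c (k + 1))ᶜ
    · rw [Set.indicator_of_mem hb]
      by_cases a1 : x ∈ Lc ((c - 1 - k : ℤ) : ℝ)
      · rw [Set.indicator_of_mem a1]; linarith
      by_cases a2 : x ∈ (Lc (c + k))ᶜ
      · rw [Set.indicator_of_mem a2]; linarith
      by_cases a3 : x ∈ Vᶜ
      · rw [Set.indicator_of_mem a3]; linarith
      exfalso
      apply hb
      simp only [Lc, V, Set.mem_ofPred_eq, Set.mem_compl_iff, not_lt, not_le] at a1 a2 a3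
      simp only [Bc, Set.mem_ofPred_eq]
      push_cast at *
      refine ⟨by linarith, by linarith, by linarith⟩
    · rw [Set.indicator_of_notMem hb]; linarith
  have e2 : (((k + 1 : ℕ) : ℝ) - 1) = k := by push_cast; ring
  rw [e2]
  have v2 : Mh * √(N2 ω) * impulse ω / ((k + 1 : ℕ) : ℝ) ≤ Mh * √(N2 ω) * impulse ω / k := by
    have g2 : 0 ≤ Mh * √(N2 ω) * impulse ω := mul_nonneg (mul_nonneg Mh_nonneg (sqrt_nonneg _)) hI.le
    gcongr
    push_cast; linarith
  have r2 : s * impulse ω * impulse ((Lc (c + k))ᶜ.indicator ω) ≤ 2 * s * impulse ((Lc c).indicator ω) *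
      impulse ((Lc (c + k))ᶜ.indicator ω) := by
    refine mul_le_mul_of_nonneg_right ?_ n2
    nlinarith
  have l2 : s * impulse ω * impulse ((Lc ((c - 1 - k : ℤ) : ℝ)).indicator ω) ≤
     2 * s * impulse ((Lc ((c - 1 - k : ℤ) : ℝ)).indicator ω) * impulse ((Lc ((c - 1 : ℤ) : ℝ))ᶜ.indicator ω) := by
    nlinarith [mul_nonneg hs.le n1]
  have : s * impulse ω * impulse ((Bc c (k + 1))ᶜ.indicator ω) ≤ s * impulse ω * (impulse ((Lc ((c - 1 - k : ℤ) : ℝ)).indicator ω) +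
      impulse ((Lc (c + k))ᶜ.indicator ω) + impulse (Vᶜ.indicator ω)) :=
    mul_le_mul_of_nonneg_left hun (by positivity)
  have : (2 * Ch * N2 ω + Mh * √(N2 ω) * impulse ω) / k = Ch * N2 ω / k + Ch * N2 ω / k + Mh * √(N2 ω) * impulse ω / k := by ring
  rw [this]
  linarith

open MeasureTheory Real Filter

/-! translations -/
lemma tr_mp (c : ℝ) : MeasurePreserving (fun x : ℝ × ℝ => x + (c, 0)) PU PU := by
  have h := (measurePreserving_add_right (volume : Measure (ℝ × ℝ)) (c, 0)).restrict_preimage UHP_meas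
  have e : (fun x : ℝ × ℝ => x + (c, 0)) ⁻¹' UHP = UHP := by
    ext x; simp [UHP]
  rwa [e] at h

lemma tr_emb (c : ℝ) : MeasurableEmbedding (fun x : ℝ × ℝ => x + (c, 0)) :=
  measurableEmbedding_addRight _

lemma tr_int (c : ℝ) (f : ℝ × ℝ → ℝ) : ∫ x, f (x + (c, 0)) ∂PU = ∫ x, f x ∂PU :=
  (tr_mp c).integral_comp (tr_emb c) f

lemma tr_integrable (c : ℝ) {f : ℝ × ℝ → ℝ} (h : Integrable f PU) :
    Integrable (fun x => f (x + (c, 0))) PU :=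
  ((tr_mp c).integrable_comp_emb (tr_emb c)).2 h

def tr (c : ℝ) (ω : ℝ × ℝ → ℝ) : ℝ × ℝ → ℝ := fun x => ω (x + (c, 0))

lemma tr_adm {ω} (h : Adm ω) (c : ℝ) : Adm (tr c ω) where
  nn := fun x hx => h.nn _ (by simpa [UHP] using hx)
  i1 := tr_integrable c h.i1
  i2 := tr_integrable c h.i2
  ix := by simpa [tr] using tr_integrable c h.ix

lemma tr_impulse (ω) (c : ℝ) : impulse (tr c ω) = impulse ω := by
  rw [impulse_eq, impulse_eq, ← tr_int c fun x => x.2 * ω x]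
  simp [tr]

lemma tr_N2 (ω) (c : ℝ) : N2 (tr c ω) = N2 ω := tr_int c fun x => ω x ^ 2

lemma tr_Gg (ω) (c : ℝ) (x) : Gg (tr c ω) x = Gg ω (x + (c, 0)) := by
  unfold Gg
  rw [← tr_int c fun y => gk (x + (c, 0)) y * ω y]
  simp only [gk_trans]
  rfl

lemma tr_kin (ω) (c : ℝ) : kineticE (tr c ω) = kineticE ω := by
  have h1 := kin_eq' (ω := tr c ω)
  have h2 := kin_eq' (ω := ω)
  simp only [tr_Gg] at h1
  rw [← tr_int c] at h2
  simp only [tr] at h1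
  linarith

lemma tr_Efun (lam ω) (c : ℝ) : Efun lam (tr c ω) = Efun lam ω := by
  rw [Efun_eq, Efun_eq, tr_kin, tr_N2]

lemma tr_box (ω) (c : ℝ) (m) :
    impulse ((Bx m)ᶜ.indicator (tr c ω)) = impulse ((Bc c m)ᶜ.indicator ω) := by
  rw [← tr_impulse ((Bc c m)ᶜ.indicator ω) c]
  congr 1
  ext x
  have : x + (c, 0) ∈ (Bc c m)ᶜ ↔ x ∈ (Bx m)ᶜ := by
    simp only [Bc, Bx, Set.mem_compl_iff, Set.mem_ofPred_eq, Prod.fst_add, Prod.snd_add,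
      add_sub_cancel_right, add_zero]
  by_cases hx : x ∈ (Bx m)ᶜ
  · rw [Set.indicator_of_mem hx]
    exact (Set.indicator_of_mem (this.2 hx) ω).symm
  · rw [Set.indicator_of_notMem hx]
    exact (Set.indicator_of_notMem (mt this.1 hx) ω).symm

/-! boxes -/
lemma Bx_fin (m) : PU (Bx m) < ⊤ := by
  rw [Measure.restrict_apply (Bx_meas m)]
  refine lt_of_le_of_lt (measure_mono (t := Set.Icc (-(m:ℝ)) m ×ˢ Set.Icc (0:ℝ) m) ?_) ?_
  · rintro x ⟨⟨h1, h2, h3⟩, h4⟩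
    exact ⟨⟨h1, h2⟩, ⟨le_of_lt h4, h3⟩⟩
  · exact ((isCompact_Icc).prod isCompact_Icc).measure_lt_top

instance Bx_fm (m) : IsFiniteMeasure (PU.restrict (Bx m)) := ⟨by
  rw [Measure.restrict_apply_univ]; exact Bx_fin m⟩

lemma Bx_cover : AECover PU atTop Bx where
  ae_eventually_mem := Eventually.of_forall fun x => by
    obtain ⟨n, hn⟩ := exists_nat_ge (max (|x.1|) (x.2))
    filter_upwards [eventually_ge_atTop n] with m hm
    have : (n:ℝ) ≤ m := by exact_mod_cast hm
    have h1 := (le_max_left _ _).trans (hn.trans this)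
    have h2 := (le_max_right _ _).trans (hn.trans this)
    rw [abs_le] at h1
    exact ⟨h1.1, h1.2, h2⟩
  measurableSet := Bx_meas

lemma box_memLp {m : ℕ} {g : ℝ × ℝ → ℝ} (hg : Measurable g) {M : ℝ}
    (hM : ∀ x ∈ UHP, x ∈ Bx m → |g x| ≤ M) : MemLp ((Bx m).indicator g) 2 PU := by
  rw [memLp_indicator_iff_restrict (Bx_meas m)]
  refine MemLp.of_bound hg.aestronglyMeasurable M ?_
  filter_upwards [ae_restrict_mem (Bx_meas m), ae_restrict_of_ae ae_UHP] with x h1 h2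
  exact hM x h2 h1

lemma box_le {g : ℝ × ℝ → ℝ} (hg : ∀ᵐ x ∂PU, 0 ≤ g x) {M : ℝ}
    (hi : ∀ m, IntegrableOn g (Bx m) PU) (hM : ∀ m, ∫ x in Bx m, g x ∂PU ≤ M) :
    Integrable g PU ∧ ∫ x, g x ∂PU ≤ M := by
  have h1 : Integrable g PU := Bx_cover.integrable_of_integral_bounded_of_nonneg_ae M hi hg
    (Eventually.of_forall hM)
  exact ⟨h1, le_of_tendsto (Bx_cover.integral_tendsto_of_countably_generated h1) (Eventually.of_forall hM)⟩

/-! weak compactness -/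
lemma N2_norm {f : ℝ × ℝ → ℝ} (hf : MemLp f 2 PU) : ‖hf.toLp f‖ ^ 2 = N2 f := by
  rw [← real_inner_self_eq_norm_sq, L2.inner_def]
  refine integral_congr_ae ?_
  filter_upwards [hf.coeFn_toLp] with x hx
  rw [hx]; simp [sq]

lemma inner_eq {f g : ℝ × ℝ → ℝ} (hf : MemLp f 2 PU) (hg : MemLp g 2 PU) :
    inner ℝ (hf.toLp f) (hg.toLp g) = ∫ x, f x * g x ∂PU := by
  rw [L2.inner_def]
  refine integral_congr_ae ?_
  filter_upwards [hf.coeFn_toLp, hg.coeFn_toLp] with x hx hy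
  rw [hx, hy]; simp [mul_comm]

lemma weak_cpt {ζ : ℕ → ℝ × ℝ → ℝ} (h : ∀ n, MemLp (ζ n) 2 PU) {N : ℝ} (hN : ∀ n, N2 (ζ n) ≤ N) :
    ∃ f : ℝ × ℝ → ℝ, MemLp f 2 PU ∧ ∃ φ : ℕ → ℕ, StrictMono φ ∧ ∀ g, MemLp g 2 PU →
      Tendsto (fun k => ∫ x, ζ (φ k) x * g x ∂PU) atTop (nhds (∫ x, f x * g x ∂PU)) := by
  have hsep : TopologicalSpace.SeparableSpace (Lp ℝ 2 PU) := by
    have : Fact ((2 : ENNReal) ≠ ⊤) := ⟨by simp⟩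
    infer_instance
  let D := InnerProductSpace.toDual ℝ (Lp ℝ 2 PU)
  have hc := WeakDual.isSeqCompact_closedBall (𝕜 := ℝ) (E := Lp ℝ 2 PU) 0 (√N)
  have hmem : ∀ n, StrongDual.toWeakDual (D ((h n).toLp (ζ n))) ∈
      WeakDual.toStrongDual ⁻¹' Metric.closedBall (0 : StrongDual ℝ (Lp ℝ 2 PU)) (√N) := by
    intro n
    rw [Set.mem_preimage, mem_closedBall_zero_iff]
    change ‖D ((h n).toLp (ζ n))‖ ≤ _
    rw [LinearIsometryEquiv.norm_map]
    refine Real.le_sqrt_of_sq_le ?_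
    rw [N2_norm]; exact hN n
  obtain ⟨F, -, φ, hφ, hlim⟩ := hc hmem
  have hF := (tendsto_iff_forall_eval_tendsto_topDualPairing).1 hlim
  let f := D.symm (WeakDual.toStrongDual F)
  refine ⟨f, Lp.memLp f, φ, hφ, fun g hg => ?_⟩
  have h1 := hF (hg.toLp g)
  have e1 : ∀ k, topDualPairing ℝ (Lp ℝ 2 PU) (StrongDual.toWeakDual (D ((h (φ k)).toLp (ζ (φ k))))) (hg.toLp g)
      = ∫ x, ζ (φ k) x * g x ∂PU := by
    intro k
    rw [← inner_eq (h (φ k)) hg]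
    rfl
  have e2 : topDualPairing ℝ (Lp ℝ 2 PU) F (hg.toLp g) = ∫ x, f x * g x ∂PU := by
    rw [← inner_eq (Lp.memLp f) hg, Lp.toLp_coeFn]
    have : D f = WeakDual.toStrongDual F := D.apply_symm_apply _
    change (WeakDual.toStrongDual F) _ = _
    rw [← this]
    rfl
  rw [e2] at h1
  exact h1.congr e1

open MeasureTheory Real Filter

def WeakTo (ζ : ℕ → ℝ × ℝ → ℝ) (f : ℝ × ℝ → ℝ) : Prop :=
  ∀ g, MemLp g 2 PU → Tendsto (fun k => ∫ x, ζ k x * g x ∂PU) atTop (nhds (∫ x, f x * g x ∂PU))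

lemma weak_nonneg {ζ : ℕ → ℝ × ℝ → ℝ} {f} (h : ∀ n, Adm (ζ n)) (hf : MemLp f 2 PU) (hw : WeakTo ζ f) :
    ∃ ω, (∀ x, 0 ≤ ω x) ∧ MemLp ω 2 PU ∧ WeakTo ζ ω := by
  have hg : MemLp (fun x => min (f x) 0) 2 PU := by
    refine hf.mono (hf.1.inf aestronglyMeasurable_const) (Eventually.of_forall fun x => ?_)
    rw [norm_eq_abs, norm_eq_abs]
    rcases le_total (f x) 0 with h | h
    · simp [h]
    · simp [h]
  have h1 := hw _ hg
  have h2 : ∫ x, f x * min (f x) 0 ∂PU ≤ 0 := by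
    refine le_of_tendsto h1 (Eventually.of_forall fun k => ?_)
    refine integral_nonpos_of_ae ?_
    filter_upwards [(h k).nnae] with x hx
    exact mul_nonpos_of_nonneg_of_nonpos hx (min_le_right _ _)
  have e : ∀ x, f x * min (f x) 0 = min (f x) 0 ^ 2 := by
    intro x
    rcases le_total (f x) 0 with h | h
    · simp [h, sq]
    · simp [h]
  simp only [e] at h2
  have h3 : ∫ x, min (f x) 0 ^ 2 ∂PU = 0 := le_antisymm h2 (integral_nonneg fun x => sq_nonneg _)
  rw [integral_eq_zero_iff_of_nonneg (fun x => sq_nonneg _) hg.integrable_sq] at h3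
  have h4 : f =ᵐ[PU] fun x => max (f x) 0 := by
    filter_upwards [h3] with x hx
    have : min (f x) 0 = 0 := by simpa using hx
    have : 0 ≤ f x := by simpa using this
    simp [this]
  refine ⟨fun x => max (f x) 0, fun x => le_max_right _ _, hf.ae_eq h4, fun g hg => ?_⟩
  have : ∫ x, max (f x) 0 * g x ∂PU = ∫ x, f x * g x ∂PU := by
    refine integral_congr_ae ?_
    filter_upwards [h4] with x hx
    rw [← hx]
  rw [this]
  exact hw g hg

lemma mul_box (m : ℕ) (u v : ℝ × ℝ → ℝ) : ∫ x, u x * (Bx m).indicator v x ∂PU = ∫ x in Bx m, u x * v x ∂PU := by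
  rw [← integral_indicator (Bx_meas m)]
  refine integral_congr_ae (Eventually.of_forall fun x => ?_)
  by_cases hx : x ∈ Bx m <;> simp [hx]

lemma one_box (m : ℕ) : MemLp ((Bx m).indicator fun _ => (1:ℝ)) 2 PU :=
  box_memLp measurable_const (M := 1) (by simp)

lemma snd_box (m : ℕ) : MemLp ((Bx m).indicator fun x => x.2) 2 PU :=
  box_memLp measurable_snd (M := m) (fun x hx hb => by
    rw [abs_of_pos hx]; exact hb.2.2)

lemma mul_box_int {m : ℕ} {u v : ℝ × ℝ → ℝ} (hu : MemLp u 2 PU) (hv : MemLp ((Bx m).indicator v) 2 PU) :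
    IntegrableOn (fun x => u x * v x) (Bx m) PU := by
  have h := hu.integrable_mul hv
  rw [← integrable_indicator_iff (Bx_meas m)]
  refine h.congr (Eventually.of_forall fun x => ?_)
  by_cases hx : x ∈ Bx m <;> simp [hx]

lemma weak_adm {ζ : ℕ → ℝ × ℝ → ℝ} {ω} (h : ∀ n, Adm (ζ n)) (h0 : ∀ x, 0 ≤ ω x) (hω : MemLp ω 2 PU)
    (hw : WeakTo ζ ω) {ν μ : ℝ} (hν : ∀ n, ∫ x, ζ n x ∂PU ≤ ν)
    (hμ : Tendsto (fun n => impulse (ζ n)) atTop (nhds μ)) :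
    Adm ω ∧ ∫ x, ω x ∂PU ≤ ν ∧ impulse ω ≤ μ := by
  have m1 : ∀ m, ∫ x in Bx m, ω x ∂PU ≤ ν := by
    intro m
    have := hw _ (one_box m)
    simp only [mul_box, mul_one] at this
    refine le_of_tendsto this (Eventually.of_forall fun k => ?_)
    exact (setIntegral_le_integral (h k).i1 (h k).nnae).trans (hν k)
  have m2 : ∀ m, ∫ x in Bx m, x.2 * ω x ∂PU ≤ μ := by
    intro m
    have := hw _ (snd_box m)
    simp only [mul_box] at this
    simp only [mul_comm _ (Prod.snd _)] at this
    refine le_of_tendsto_of_tendsto this hμ (Eventually.of_forall fun k => ?_)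
    refine setIntegral_le_integral (h k).ix ?_
    filter_upwards [ae_UHP] with x hx
    exact mul_nonneg (le_of_lt hx) ((h k).nn x hx)
  have r1 := box_le (Eventually.of_forall h0) (fun m => by simpa using mul_box_int hω (one_box m)) m1
  have r2 := box_le (g := fun x => x.2 * ω x) (by
    filter_upwards [ae_UHP] with x hx
    exact mul_nonneg (le_of_lt hx) (h0 x)) (fun m => by
      simpa [mul_comm] using mul_box_int hω (snd_box m)) m2
  exact ⟨⟨fun x _ => h0 x, r1.1, hω.integrable_sq, r2.1⟩, r1.2, r2.2⟩

lemma Gg_box {ω} (hω : MemLp ω 2 PU) (m : ℕ) : MemLp ((Bx m).indicator (Gg ω)) 2 PU :=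
  box_memLp (Gg_meas hω.1) (fun x _ _ => Gg_bound hω x)

lemma box_conv {ζ : ℕ → ℝ × ℝ → ℝ} {ω} (h : ∀ n, MemLp (ζ n) 2 PU) (hω : MemLp ω 2 PU)
    (hw : WeakTo ζ ω) {N : ℝ} (hN : ∀ n, N2 (ζ n) ≤ N) (m : ℕ) :
    Tendsto (fun k => ∫ x in Bx m, ζ k x * Gg (ζ k) x ∂PU) atTop
      (nhds (∫ x in Bx m, ω x * Gg ω x ∂PU)) := by
  have hpt : ∀ x, Tendsto (fun k => Gg (ζ k) x) atTop (nhds (Gg ω x)) := by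
    intro x
    have := hw _ (gk_memLp x)
    simpa [Gg, mul_comm] using this
  have hb : ∀ k x, |Gg (ζ k) x| ≤ Mh * √N := fun k x => (Gg_bound (h k) x).trans
    (mul_le_mul_of_nonneg_left (Real.sqrt_le_sqrt (hN k)) Mh_nonneg)
  have hb' : ∀ x, |Gg ω x| ≤ Mh * √N := fun x => le_of_tendsto (hpt x).abs (Eventually.of_forall fun k => hb k x)
  let d := fun k x => Gg (ζ k) x - Gg ω x
  have hd : ∀ k, MemLp ((Bx m).indicator (d k)) 2 PU := fun k =>
    box_memLp ((Gg_meas (h k).1).sub (Gg_meas hω.1)) (M := 2 * (Mh * √N)) (fun x _ _ => by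
      have := abs_sub (Gg (ζ k) x) (Gg ω x)
      have := hb k x
      have := hb' x
      simp only [d]; linarith)
  have hd2 : Tendsto (fun k => N2 ((Bx m).indicator (d k))) atTop (nhds 0) := by
    simp only [N2_indicator (Bx_meas m)]
    have : Tendsto (fun k => ∫ x in Bx m, d k x ^ 2 ∂PU) atTop (nhds (∫ x in Bx m, (0:ℝ) ∂PU)) := by
      refine tendsto_integral_of_dominated_convergence (fun _ => (2 * (Mh * √N)) ^ 2) (fun k =>
        (((Gg_meas (h k).1).sub (Gg_meas hω.1)).pow_const 2).aestronglyMeasurable)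
        (integrable_const _) (fun k => Eventually.of_forall fun x => ?_)
        (Eventually.of_forall fun x => ?_)
      · rw [norm_eq_abs, abs_pow]
        have := abs_sub (Gg (ζ k) x) (Gg ω x)
        have := hb k x
        have := hb' x
        have : |d k x| ≤ 2 * (Mh * √N) := by simp only [d]; linarith
        gcongr
      · have := (((hpt x).sub_const (Gg ω x)).pow 2)
        simpa [d] using this
    simpa using this
  have h1 := hw _ (Gg_box hω m)
  have h2 : Tendsto (fun k => ∫ x, ζ k x * (Bx m).indicator (d k) x ∂PU) atTop (nhds 0) := by
    refine squeeze_zero_norm (a := fun k => √N * √(N2 ((Bx m).indicator (d k)))) (fun k => ?_) ?_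
    · refine (cauchy_schwarz (h k) (hd k)).trans ?_
      refine mul_le_mul_of_nonneg_right (Real.sqrt_le_sqrt (hN k)) (sqrt_nonneg _)
    · have := (hd2.sqrt).const_mul (√N)
      simpa using this
  have h3 := h1.add h2
  simp only [mul_box, add_zero] at h3
  refine h3.congr fun k => ?_
  have i1 := mul_box_int (h k) (Gg_box hω m)
  have i2 := mul_box_int (h k) (hd k)
  rw [← integral_add i1 i2]
  refine integral_congr_ae (Eventually.of_forall fun x => ?_)
  simp only [d]; ring

def Tight (ζ : ℕ → ℝ × ℝ → ℝ) : Prop :=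
  ∀ ε > 0, ∃ m : ℕ, ∀ᶠ k in atTop, impulse ((Bx m)ᶜ.indicator (ζ k)) ≤ ε

lemma kin_limsup {ζ : ℕ → ℝ × ℝ → ℝ} {ω} (h : ∀ n, Adm (ζ n)) (hω : Adm ω)
    (hw : WeakTo ζ ω) {N : ℝ} (hN : ∀ n, N2 (ζ n) ≤ N) (ht : Tight ζ) {ε : ℝ} (hε : 0 < ε) :
    ∀ᶠ k in atTop, kineticE (ζ k) ≤ kineticE ω + ε := by
  have hN0 : 0 ≤ N := (N2_nonneg _).trans (hN 0)
  have hk := kap_nonneg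
  have hM := Mh_nonneg
  set δ := ε / (2 * (kap * N + 1)) with hδ
  have hP : 0 < kap * N + 1 := by positivity
  have hδ0 : 0 < δ := by positivity
  have hQ : 0 < Mh * √N / δ + 1 := by positivity
  obtain ⟨m, hm⟩ := ht (ε / (2 * (Mh * √N / δ + 1))) (by positivity)
  have hc := box_conv (fun n => (h n).memLp) hω.memLp hw hN m
  have hc' := hc.eventually (gt_mem_nhds (show _ < _ + ε from lt_add_of_pos_right _ hε))
  filter_upwards [hm, hc'] with k h1 h2
  have e1 := kin_eq' (ω := ζ k)
  have e2 := kin_eq' (ω := ω)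
  rw [← integral_add_compl (Bx_meas m) (wG_int (h k).memLp)] at e1
  have tb := tail_bound (h k) (Bx_meas m).compl hδ0
  rw [← impulse_indicator (Bx_meas m).compl] at tb
  have i0 := impulse_nonneg ((h k).indicator (Bx_meas m).compl)
  have b1 : δ * (kap * N2 (ζ k)) ≤ ε / 2 := by
    calc δ * (kap * N2 (ζ k)) ≤ δ * (kap * N + 1) := by
          have := mul_le_mul_of_nonneg_left (hN k) hk
          gcongr; linarith
      _ = ε / 2 := by rw [hδ]; field_simp
  have b2 : Mh * √(N2 (ζ k)) / δ * impulse ((Bx m)ᶜ.indicator (ζ k)) ≤ ε / 2 := by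
    calc _ ≤ (Mh * √N / δ + 1) * (ε / (2 * (Mh * √N / δ + 1))) := by
          have : Mh * √(N2 (ζ k)) / δ ≤ Mh * √N / δ := by
            gcongr; exact hN k
          refine mul_le_mul (by linarith) h1 i0 hQ.le
      _ = ε / 2 := by field_simp
  have b3 : ∫ x in Bx m, ω x * Gg ω x ∂PU ≤ ∫ x, ω x * Gg ω x ∂PU := by
    refine setIntegral_le_integral (wG_int hω.memLp) ?_
    filter_upwards [hω.nnae] with x hx
    exact mul_nonneg hx (Gg_nonneg hω x)
  linarith

lemma core {lam s μ ν N : ℝ} (hlam : 1 < lam) (hs : 0 < s) (hμ : 0 < μ)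
    (hH : ∀ ω, Adm ω → Efun lam ω ≤ s * impulse ω ^ 2)
    {ζ : ℕ → ℝ × ℝ → ℝ} {f} (h : ∀ n, Adm (ζ n)) (hν : ∀ n, ∫ x, ζ n x ∂PU ≤ ν)
    (hN : ∀ n, N2 (ζ n) ≤ N)
    (hI : Tendsto (fun n => impulse (ζ n)) atTop (nhds μ))
    (hE : Tendsto (fun n => Efun lam (ζ n)) atTop (nhds (s * μ ^ 2)))
    (ht : Tight ζ) (hf : MemLp f 2 PU) (hwf : WeakTo ζ f) :
    ∃ ω, Adm ω ∧ ∫ x, ω x ∂PU ≤ ν ∧ impulse ω = μ ∧ Efun lam ω = s * μ ^ 2 ∧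
      Tendsto (fun k => N2 (fun x => ζ k x - ω x)) atTop (nhds 0) ∧
      Tendsto (fun k => ∫ x, |x.2 * (ζ k x - ω x)| ∂PU) atTop (nhds 0) := by
  obtain ⟨ω, h0, hωL, hw⟩ := weak_nonneg h hf hwf
  obtain ⟨hω, hων, hωμ⟩ := weak_adm h h0 hωL hw hν hI
  have hl0 : 0 < lam := by linarith
  have hww : Tendsto (fun k => ∫ x, ζ k x * ω x ∂PU) atTop (nhds (N2 ω)) := by
    have := hw ω hωL
    simpa [N2, sq] using this
  have expand : ∀ k, N2 (fun x => ζ k x - ω x) = N2 (ζ k) - 2 * ∫ x, ζ k x * ω x ∂PU + N2 ω := by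
    intro k
    have i1 := (h k).i2
    have i2 : Integrable (fun x => ζ k x * ω x) PU := (h k).memLp.integrable_mul hωL
    have i3 := hω.i2
    have i12 : Integrable (fun x => ζ k x ^ 2 - 2 * (ζ k x * ω x)) PU := i1.sub (i2.const_mul 2)
    unfold N2
    rw [← integral_const_mul, ← integral_sub i1 (i2.const_mul 2), ← integral_add i12 i3]
    refine integral_congr_ae (Eventually.of_forall fun x => ?_)
    simp only []; ring
  have hlow : ∀ ε > 0, ∀ᶠ k in atTop, N2 ω - ε ≤ N2 (ζ k) := by
    intro ε hε
    have := hww.eventually (lt_mem_nhds (show N2 ω - ε / 2 < N2 ω by linarith))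
    filter_upwards [this] with k hk
    have := N2_nonneg (fun x => ζ k x - ω x)
    rw [expand] at this
    linarith
  have hEge : s * μ ^ 2 ≤ Efun lam ω := by
    refine le_of_forall_pos_le_add fun ε hε => ?_
    refine le_of_tendsto hE ?_
    filter_upwards [hlow (lam * ε) (by positivity), kin_limsup h hω hw hN ht (half_pos hε)] with k h1 h2
    rw [Efun_eq, Efun_eq]
    have : 1 / (2 * lam) * (N2 ω - lam * ε) ≤ 1 / (2 * lam) * N2 (ζ k) := by gcongr
    have e : 1 / (2 * lam) * (N2 ω - lam * ε) = 1 / (2 * lam) * N2 ω - ε / 2 := by field_simp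
    linarith
  have hEle := hH ω hω
  have hI0 := impulse_nonneg hω
  have hIeq : impulse ω = μ := by
    refine le_antisymm hωμ ?_
    have : s * μ ^ 2 ≤ s * impulse ω ^ 2 := hEge.trans hEle
    have := le_of_mul_le_mul_left this hs
    exact (sq_le_sq₀ hμ.le hI0).1 this
  have hEeq : Efun lam ω = s * μ ^ 2 := le_antisymm (by rw [← hIeq]; exact hEle) hEge
  have hL2 : Tendsto (fun k => N2 (fun x => ζ k x - ω x)) atTop (nhds 0) := by
    rw [tendsto_order]
    refine ⟨fun a ha => Eventually.of_forall fun k => lt_of_lt_of_le ha (N2_nonneg _), fun ε hε => ?_⟩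
    have q1 := hww.eventually (lt_mem_nhds (show N2 ω - ε / 8 < N2 ω by linarith))
    have q2 := kin_limsup h hω hw hN ht (show 0 < ε / (16 * lam) by positivity)
    have q3 := hE.eventually (lt_mem_nhds (show s * μ ^ 2 - ε / (16 * lam) < s * μ ^ 2 by
      have : 0 < ε / (16 * lam) := by positivity
      linarith))
    filter_upwards [q1, q2, q3] with k h1 h2 h3
    rw [expand]
    rw [← hEeq, Efun_eq, Efun_eq] at h3
    have : 1 / (2 * lam) * N2 (ζ k) ≤ 1 / (2 * lam) * N2 ω + 2 * (ε / (16 * lam)) := by linarith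
    have := mul_le_mul_of_nonneg_left this (show 0 ≤ 2 * lam by positivity)
    have e1 : 2 * lam * (1 / (2 * lam) * N2 (ζ k)) = N2 (ζ k) := by field_simp
    have e2 : 2 * lam * (1 / (2 * lam) * N2 ω + 2 * (ε / (16 * lam))) = N2 ω + ε / 4 := by field_simp; ring
    rw [e1, e2] at this
    linarith
  refine ⟨ω, hω, hων, hIeq, hEeq, hL2, ?_⟩
  rw [tendsto_order]
  refine ⟨fun a ha => Eventually.of_forall fun k => lt_of_lt_of_le ha (integral_nonneg fun x => abs_nonneg _),
    fun ε hε => ?_⟩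
  obtain ⟨m, hm⟩ := ht (ε / 8) (by positivity)
  have hBω : impulse ((Bx m)ᶜ.indicator ω) ≤ ε / 4 := by
    have c1 := hw _ (snd_box m)
    simp only [mul_box] at c1
    simp only [mul_comm _ (Prod.snd _)] at c1
    simp only [← impulse_indicator (Bx_meas m)] at c1
    have sp := impulse_split hω (Bx_meas m)
    have : μ - ε / 4 ≤ impulse ((Bx m).indicator ω) := by
      refine ge_of_tendsto c1 ?_
      filter_upwards [hm, hI.eventually (lt_mem_nhds (show μ - ε / 8 < μ by linarith))] with k h1 h2
      have := impulse_split (h k) (Bx_meas m)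
      linarith
    linarith
  have hBd : Tendsto (fun k => √(N2 ((Bx m).indicator fun x => x.2)) * √(N2 (fun x => ζ k x - ω x))) atTop (nhds 0) := by
    have := (hL2.sqrt).const_mul (√(N2 ((Bx m).indicator fun x => x.2)))
    simpa using this
  filter_upwards [hm, hBd.eventually (gt_mem_nhds (show 0 < ε / 4 by positivity))] with k h1 h2
  have hdL : MemLp (fun x => |ζ k x - ω x|) 2 PU := ((h k).memLp.sub hωL).abs
  have hdi : Integrable (fun x => x.2 * (ζ k x - ω x)) PU := by
    refine ((h k).ix.sub hω.ix).congr (Eventually.of_forall fun x => ?_)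
    simp only [Pi.sub_apply]; ring
  rw [← integral_add_compl (Bx_meas m) hdi.abs]
  have p1 : ∫ x in Bx m, |x.2 * (ζ k x - ω x)| ∂PU ≤
      √(N2 ((Bx m).indicator fun x => x.2)) * √(N2 (fun x => ζ k x - ω x)) := by
    have cs := (le_abs_self _).trans (cauchy_schwarz hdL (snd_box m))
    rw [mul_box] at cs
    simp only [sq_abs] at cs
    rw [mul_comm]
    refine le_trans (le_of_eq ?_) cs
    refine integral_congr_ae ?_
    filter_upwards [ae_restrict_of_ae ae_UHP] with x hx
    rw [abs_mul, abs_of_pos (show 0 < x.2 from hx), mul_comm]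
  have p2 : ∫ x in (Bx m)ᶜ, |x.2 * (ζ k x - ω x)| ∂PU ≤
      impulse ((Bx m)ᶜ.indicator (ζ k)) + impulse ((Bx m)ᶜ.indicator ω) := by
    rw [impulse_indicator (Bx_meas m).compl, impulse_indicator (Bx_meas m).compl,
      ← integral_add (h k).ix.integrableOn hω.ix.integrableOn]
    refine integral_mono_ae hdi.abs.integrableOn ((h k).ix.add hω.ix).integrableOn ?_
    filter_upwards [ae_restrict_of_ae ae_UHP] with x hx
    have hx' : 0 < x.2 := hx
    have a1 := (h k).nn x hx
    have a2 := h0 x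
    rw [abs_mul, abs_of_pos hx']
    rw [← mul_add]
    refine mul_le_mul_of_nonneg_left ?_ hx'.le
    rw [abs_le]; constructor <;> linarith
  linarith

open MeasureTheory Real Filter

lemma normL2_eq (f : ℝ × ℝ → ℝ) : normL2 f = √(N2 f) := by
  rw [Real.sqrt_eq_rpow]; rfl

lemma tight_seq {lam s μ N : ℝ} (hlam : 1 < lam) (hs : 0 < s) (hμ : 0 < μ)
    (hH : ∀ ω, Adm ω → Efun lam ω ≤ s * impulse ω ^ 2)
    {w : ℕ → ℝ × ℝ → ℝ} (h : ∀ n, Adm (w n)) (hN : ∀ n, N2 (w n) ≤ N)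
    (hI : Tendsto (fun n => impulse (w n)) atTop (nhds μ))
    (hE : Tendsto (fun n => Efun lam (w n)) atTop (nhds (s * μ ^ 2))) :
    ∃ c : ℕ → ℝ, Tight (fun n => tr (c n) (w n)) := by
  have hex : ∀ n, ∃ c : ℝ, 0 < impulse (w n) → ∀ m : ℕ, 2 ≤ m →
      s * impulse (w n) * impulse ((Bc c m)ᶜ.indicator (w n)) ≤
      3 * (s * impulse (w n) ^ 2 - Efun lam (w n)) +
        (2 * Ch * N2 (w n) + Mh * √(N2 (w n)) * impulse (w n)) / (m - 1) := by
    intro n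
    by_cases hp : 0 < impulse (w n)
    · obtain ⟨c, hc⟩ := tight hlam hs hH (h n) hp
      exact ⟨c, fun _ => hc⟩
    · exact ⟨0, fun h => absurd h hp⟩
  choose c hc using hex
  refine ⟨c, fun ε hε => ?_⟩
  have hN0 : 0 ≤ N := (N2_nonneg _).trans (hN 0)
  have hCh := Ch_nonneg
  have hM := Mh_nonneg
  set D := 2 * Ch * N + Mh * √N * (2 * μ) with hD
  have hD0 : 0 ≤ D := by positivity
  obtain ⟨k, hk⟩ := exists_nat_gt (D / (s * μ * ε / 4))
  refine ⟨k + 2, ?_⟩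
  have hlim : Tendsto (fun n => 3 * (s * impulse (w n) ^ 2 - Efun lam (w n))) atTop (nhds 0) := by
    have := (((hI.pow 2).const_mul s).sub hE).const_mul 3
    simpa using this
  filter_upwards [hlim.eventually (gt_mem_nhds (show 0 < s * μ * ε / 4 by positivity)),
    hI.eventually (lt_mem_nhds (show μ / 2 < μ by linarith)),
    hI.eventually (gt_mem_nhds (show μ < 2 * μ by linarith))] with n h1 h2 h3
  rw [tr_box]
  have ip : 0 < impulse (w n) := by linarith
  have t := hc n ip (k + 2) (by omega)
  have i0 := impulse_nonneg ((h n).indicator (Bc_meas (c n) (k + 2)).compl)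
  have e : (((k + 2 : ℕ) : ℝ) - 1) = k + 1 := by push_cast; ring
  rw [e] at t
  have hsq := Real.sqrt_le_sqrt (hN n)
  have hNn := hN n
  have b : (2 * Ch * N2 (w n) + Mh * √(N2 (w n)) * impulse (w n)) / ((k:ℝ) + 1) ≤ s * μ * ε / 4 := by
    rw [div_lt_iff₀ (by positivity)] at hk
    rw [div_le_iff₀ (by positivity)]
    have : 2 * Ch * N2 (w n) + Mh * √(N2 (w n)) * impulse (w n) ≤ D := by
      rw [hD]; gcongr
    have : 0 < s * μ * ε / 4 := by positivity
    nlinarith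
  have g : s * (μ / 2) * impulse ((Bc (c n) (k + 2))ᶜ.indicator (w n)) ≤ s * (μ / 2) * ε := by
    have : s * (μ / 2) * impulse ((Bc (c n) (k + 2))ᶜ.indicator (w n)) ≤
      s * impulse (w n) * impulse ((Bc (c n) (k + 2))ᶜ.indicator (w n)) := by gcongr
    linarith
  exact le_of_mul_le_mul_left g (by positivity)


/-- compactness, up to `x₁`-translations, of maximizing sequences. -/
theorem stmt16 (lam μ : ℝ) (hlam : 1 < lam) (hμ : 0 < μ) :
    ∃ ν₀ : ℝ, μ * varrho lam ≤ ν₀ ∧ ∀ ν : ℝ, ν₀ ≤ ν →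
      ∀ ωn : ℕ → ℝ × ℝ → ℝ,
        (∀ n : ℕ, (∀ x ∈ UHP, 0 ≤ ωn n x) ∧ IntegrableOn (ωn n) UHP ∧
          IntegrableOn (fun x => (ωn n x) ^ 2) UHP ∧
          IntegrableOn (fun x => x.2 * ωn n x) UHP ∧
          (∫ x in UHP, ωn n x) ≤ ν) →
        (∃ C : ℝ, ∀ n : ℕ, normL2 (ωn n) ≤ C) →
        Filter.Tendsto (fun n => impulse (ωn n)) Filter.atTop (nhds μ) →
        Filter.Tendsto (fun n => Efun lam (ωn n)) Filter.atTop (nhds (Sval lam μ ν)) →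
        ∃ ω : ℝ × ℝ → ℝ, IsMaximizer lam μ ν ω ∧
          ∃ φ : ℕ → ℕ, StrictMono φ ∧ ∃ c : ℕ → ℝ,
            Filter.Tendsto
              (fun k => normL2 (fun x => ωn (φ k) (x + (c k, 0)) - ω x))
              Filter.atTop (nhds 0) ∧
            Filter.Tendsto
              (fun k => normL1 (fun x => x.2 * (ωn (φ k) (x + (c k, 0)) - ω x)))
              Filter.atTop (nhds 0) := by
  obtain ⟨ν₁, hν₁⟩ := homog hlam hμ
  refine ⟨max (μ * varrho lam) ν₁, le_max_left _ _, ?_⟩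
  intro ν hν w hw hC hI hE
  obtain ⟨hS, hHS⟩ := hν₁ ν ((le_max_right _ _).trans hν)
  obtain ⟨C, hC⟩ := hC
  have hA : ∀ n, Adm (w n) := fun n => ⟨(hw n).1, (hw n).2.1, (hw n).2.2.1, (hw n).2.2.2.1⟩
  have hN : ∀ n, N2 (w n) ≤ C ^ 2 := by
    intro n
    have h1 := hC n
    rw [normL2_eq] at h1
    exact (Real.sqrt_le_left ((sqrt_nonneg _).trans h1)).1 h1
  have hs : 0 < Sval lam μ ν / μ ^ 2 := by positivity
  have hsμ : Sval lam μ ν / μ ^ 2 * μ ^ 2 = Sval lam μ ν := by field_simp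
  obtain ⟨c, hc⟩ := tight_seq hlam hs hμ hHS hA hN hI (by rw [hsμ]; exact hE)
  obtain ⟨f, hf, φ, hφ, hweak⟩ := weak_cpt (ζ := fun n => tr (c n) (w n))
    (fun n => (tr_adm (hA n) (c n)).memLp) (N := C ^ 2) (fun n => by rw [tr_N2]; exact hN n)
  obtain ⟨ω, h1, h2, h3, h4, h5, h6⟩ := core (ν := ν) (N := C ^ 2) hlam hs hμ hHS
    (ζ := fun k => tr (c (φ k)) (w (φ k))) (f := f) (fun k => tr_adm (hA _) _)
    (fun k => by
      have := tr_int (c (φ k)) (w (φ k))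
      exact this.le.trans (hw (φ k)).2.2.2.2)
    (fun k => by rw [tr_N2]; exact hN _)
    (by simp only [tr_impulse]; exact hI.comp hφ.tendsto_atTop)
    (by simp only [tr_Efun, hsμ]; exact hE.comp hφ.tendsto_atTop)
    (fun ε hε => by
      obtain ⟨m, hm⟩ := hc ε hε
      exact ⟨m, hφ.tendsto_atTop.eventually hm⟩)
    hf hweak
  refine ⟨ω, ⟨h1.inAdm h3 h2, by rw [h4, hsμ]⟩, φ, hφ, fun k => c (φ k), ?_, ?_⟩
  · simp only [normL2_eq]
    have := h5.sqrt
    simpa [tr] using this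
  · exact h6
end
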